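/- Let 1 < p < ∞ and c₃ > 0, and set 𝔻_{c₃,∞} = {N ∈ 𝔻 : N ≥ c₃ d}. There exists a constant C_p > 0 depending only on p and c₃ (in particular independent of the dimension d) such that for every d ≥ 1 and every f ∈ ℓ_p(ℤ^d; ℂ), ‖ sup_{N ∈ 𝔻_{c₃,∞}} |M_N^B f| ‖_{ℓ_p(ℤ^d)} ≤ C_p ‖f‖_{ℓ_p(ℤ^d)}. (This is the scalar-valued case of the paper's Theorem 1.2 on large radii.) -/

import Mathlib

open MeasureTheory ENNReal

/-- The set of lattice points in the closed Euclidean ball of radius `N`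
centered at the origin of `ℝ^d`. -/
def latticeBallSet (d : ℕ) (N : ℝ) : Set (Fin d → ℤ) :=
  {y | ∑ j, ((y j : ℝ)) ^ 2 ≤ N ^ 2}

/-- The discrete Hardy–Littlewood averaging operator over the Euclidean ball
of radius `N`: `M_N^B f (x) = (1/#(B_N ∩ ℤ^d)) ∑_{y ∈ B_N ∩ ℤ^d} f (x - y)`. -/
noncomputable def ballAvg (d : ℕ) (N : ℝ) (f : (Fin d → ℤ) → ℂ) (x : Fin d → ℤ) : ℂ :=
  (∑ᶠ y ∈ latticeBallSet d N, f (x - y)) / ((latticeBallSet d N).ncard : ℂ)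

/-- The `ℓ_p` norm on `ℤ^d` of an `ℝ≥0∞`-valued function. -/
noncomputable def lpNorm (d : ℕ) (p : ℝ) (g : (Fin d → ℤ) → ℝ≥0∞) : ℝ≥0∞ :=
  (∑' x : Fin d → ℤ, (g x) ^ p) ^ (1 / p)

namespace PlanarDyadic

section Cells

/-- Bounded measurable functions of bounded support. -/
structure Nice {α : Type*} [MeasurableSpace α] [Norm α] (f : α → ℝ) : Prop where
  meas : Measurable f
  bdd : ∃ C, ∀ x, |f x| ≤ C
  supp : ∃ R, ∀ x, f x ≠ 0 → ‖x‖ ≤ R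

namespace Nice

variable {α : Type*} [MeasurableSpace α] [NormedAddCommGroup α] {f g : α → ℝ}

lemma add (hf : Nice f) (hg : Nice g) : Nice (fun x => f x + g x) := by
  obtain ⟨C, hC⟩ := hf.bdd
  obtain ⟨R, hR⟩ := hf.supp
  obtain ⟨C', hC'⟩ := hg.bdd
  obtain ⟨R', hR'⟩ := hg.supp
  refine ⟨hf.meas.add hg.meas,
    ⟨C + C', fun x => (abs_add_le _ _).trans (add_le_add (hC x) (hC' x))⟩,
    ⟨max R R', fun x hx => ?_⟩⟩
  by_cases h : f x = 0
  · exact (hR' x (by simpa [h] using hx)).trans (le_max_right _ _)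
  · exact (hR x h).trans (le_max_left _ _)

lemma mul_bdd (hf : Nice f) (hg : Measurable g) {C' : ℝ} (hC' : ∀ x, |g x| ≤ C') :
    Nice (fun x => f x * g x) := by
  obtain ⟨C, hC⟩ := hf.bdd
  obtain ⟨R, hR⟩ := hf.supp
  refine ⟨hf.meas.mul hg, ⟨C * C', fun x => ?_⟩, ⟨R, fun x hx => hR x (left_ne_zero_of_mul hx)⟩⟩
  rw [abs_mul]
  exact mul_le_mul (hC x) (hC' x) (abs_nonneg _) ((abs_nonneg _).trans (hC x))

lemma mul (hf : Nice f) (hg : Nice g) : Nice (fun x => f x * g x) :=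
  let ⟨_, hC⟩ := hg.bdd
  hf.mul_bdd hg.meas hC

lemma const_mul (hf : Nice f) (c : ℝ) : Nice (fun x => c * f x) := by
  have := hf.mul_bdd (g := fun _ => c) measurable_const (C' := |c|) (fun _ => le_rfl)
  simpa [mul_comm] using this

lemma neg (hf : Nice f) : Nice (fun x => - f x) := by
  simpa using hf.const_mul (-1)

lemma sub (hf : Nice f) (hg : Nice g) : Nice (fun x => f x - g x) := by
  simpa [sub_eq_add_neg] using hf.add hg.neg

lemma abs (hf : Nice f) : Nice (fun x => |f x|) := by
  obtain ⟨C, hC⟩ := hf.bdd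
  obtain ⟨R, hR⟩ := hf.supp
  exact ⟨measurable_abs.comp hf.meas, ⟨C, by simpa using hC⟩,
    ⟨R, fun x hx => hR x (by simpa using hx)⟩⟩

lemma sq (hf : Nice f) : Nice (fun x => f x ^ 2) := by
  simpa [pow_two] using hf.mul hf

lemma zero : Nice (fun _ : α => (0 : ℝ)) :=
  ⟨measurable_const, ⟨0, by simp⟩, ⟨0, by simp⟩⟩

lemma sum {ι : Type*} (s : Finset ι) {F : ι → α → ℝ} (h : ∀ i ∈ s, Nice (F i)) :
    Nice (fun x => ∑ i ∈ s, F i x) := by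
  classical
  induction s using Finset.induction_on with
  | empty => simpa using zero
  | insert a s ha ih =>
    simp only [Finset.sum_insert ha]
    exact (h a (by simp)).add (ih fun i hi => h i (by simp [hi]))

lemma integrable {f : α → ℝ} [ProperSpace α] {μ : Measure α}
    [IsFiniteMeasureOnCompacts μ] (hf : Nice f) : Integrable f μ := by
  obtain ⟨C, hC⟩ := hf.bdd
  obtain ⟨R, hR⟩ := hf.supp
  have : IntegrableOn f (Metric.closedBall 0 R) μ := by
    refine Measure.integrableOn_of_bounded (M := C) ?_ hf.meas.aestronglyMeasurable ?_
    · exact (isCompact_closedBall 0 R).measure_lt_top.ne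
    · exact Filter.Eventually.of_forall fun x => hC x
  refine (integrableOn_iff_integrable_of_support_subset fun x hx => ?_).1 this
  simpa using hR x hx

end Nice

/-- Index of the dyadic square of side `2 ^ n` containing `x`. -/
noncomputable def idx (n : ℤ) (x : ℝ × ℝ) : ℤ × ℤ :=
  (⌊x.1 / (2 : ℝ) ^ n⌋, ⌊x.2 / (2 : ℝ) ^ n⌋)

/-- The dyadic square of side `2 ^ n` containing `x`. -/
def cell (n : ℤ) (x : ℝ × ℝ) : Set (ℝ × ℝ) := {y | idx n y = idx n x}

/-- The conditional expectation on dyadic squares of side `2 ^ n`. -/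
noncomputable def dyadicMean (n : ℤ) (f : ℝ × ℝ → ℝ) (x : ℝ × ℝ) : ℝ :=
  ((4 : ℝ) ^ n)⁻¹ * ∫ y in cell n x, f y

lemma measurable_idx (n : ℤ) : Measurable (idx n) := by
  unfold idx
  fun_prop

lemma measurableSet_cell (n : ℤ) (x : ℝ × ℝ) : MeasurableSet (cell n x) :=
  measurable_idx n (measurableSet_singleton _)

lemma floor_refine {m n : ℤ} (h : m ≤ n) {a b : ℝ}
    (hab : ⌊a / (2 : ℝ) ^ m⌋ = ⌊b / (2 : ℝ) ^ m⌋) : ⌊a / (2 : ℝ) ^ n⌋ = ⌊b / (2 : ℝ) ^ n⌋ := by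
  obtain ⟨k, rfl⟩ := Int.le.dest h
  have key : ∀ c : ℝ, ⌊c / (2 : ℝ) ^ (m + (k : ℤ))⌋ = ⌊c / (2 : ℝ) ^ m⌋ / ((2 ^ k : ℕ) : ℤ) := by
    intro c
    rw [zpow_add₀ two_ne_zero, ← div_div, ← Int.floor_div_natCast]
    simp
  rw [key, key, hab]

lemma idx_refine {m n : ℤ} (h : m ≤ n) {x y : ℝ × ℝ} (hxy : idx m x = idx m y) :
    idx n x = idx n y := by
  simp only [idx, Prod.mk.injEq] at hxy ⊢
  exact ⟨floor_refine h hxy.1, floor_refine h hxy.2⟩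

lemma preimage_idx (n : ℤ) (k : ℤ × ℤ) : idx n ⁻¹' {k} =
    Set.Ico ((2 : ℝ) ^ n * k.1) ((2 : ℝ) ^ n * (k.1 + 1)) ×ˢ
      Set.Ico ((2 : ℝ) ^ n * k.2) ((2 : ℝ) ^ n * (k.2 + 1)) := by
  have h2 : (0 : ℝ) < (2 : ℝ) ^ n := by positivity
  ext ⟨a, b⟩
  simp only [idx, Set.mem_preimage, Set.mem_singleton_iff, Prod.ext_iff, Int.floor_eq_iff,
    Set.mem_prod, Set.mem_Ico, le_div_iff₀ h2, div_lt_iff₀ h2, mul_comm]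

lemma volume_preimage_idx (n : ℤ) (k : ℤ × ℤ) :
    volume (idx n ⁻¹' {k}) = ENNReal.ofReal ((4 : ℝ) ^ n) := by
  rw [preimage_idx, Measure.volume_eq_prod, Measure.prod_prod, Real.volume_Ico, Real.volume_Ico,
    ← ENNReal.ofReal_mul]
  · congr 1
    rw [show (4 : ℝ) = 2 * 2 by norm_num, mul_zpow]; ring
  · have h2 : (0 : ℝ) < (2 : ℝ) ^ n := by positivity
    nlinarith

lemma volume_cell (n : ℤ) (x : ℝ × ℝ) : volume (cell n x) = ENNReal.ofReal ((4 : ℝ) ^ n) :=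
  volume_preimage_idx n (idx n x)

lemma norm_sub_le_of_idx_eq {n : ℤ} {x y : ℝ × ℝ} (h : idx n x = idx n y) :
    ‖x - y‖ ≤ (2 : ℝ) ^ n := by
  have hx : x ∈ idx n ⁻¹' {idx n y} := h
  have hy : y ∈ idx n ⁻¹' {idx n y} := rfl
  rw [preimage_idx] at hx hy
  obtain ⟨⟨a1, a2⟩, ⟨a3, a4⟩⟩ := hx
  obtain ⟨⟨b1, b2⟩, ⟨b3, b4⟩⟩ := hy
  rw [Prod.norm_def]
  refine max_le ?_ ?_ <;> rw [Real.norm_eq_abs, abs_le] <;> constructor <;>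
    simp only [Prod.fst_sub, Prod.snd_sub] <;> nlinarith

lemma dyadicMean_congr {n : ℤ} {f : ℝ × ℝ → ℝ} {x y : ℝ × ℝ} (h : idx n x = idx n y) :
    dyadicMean n f x = dyadicMean n f y := by
  simp only [dyadicMean, cell, h]

lemma measurable_of_idx {n : ℤ} {h : ℝ × ℝ → ℝ} (hh : ∀ x y, idx n x = idx n y → h x = h y) :
    Measurable h := by
  have : h = (Function.extend (idx n) h 0) ∘ idx n := by
    ext x
    rw [Function.comp, Function.FactorsThrough.extend_apply]
    exact fun x y hxy => hh x y hxy
  rw [this]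
  exact (measurable_of_countable _).comp (measurable_idx n)

lemma abs_dyadicMean_le (n : ℤ) {f : ℝ × ℝ → ℝ} {C : ℝ} (hC : ∀ x, |f x| ≤ C) (x : ℝ × ℝ) :
    |dyadicMean n f x| ≤ C := by
  have h4 : (0 : ℝ) < (4 : ℝ) ^ n := by positivity
  have := norm_setIntegral_le_of_norm_le_const (μ := volume) (s := cell n x) (f := f) (C := C)
    (by rw [volume_cell]; exact ENNReal.ofReal_lt_top) (fun y _ => hC y)
  rw [dyadicMean, abs_mul, abs_of_pos (inv_pos.2 h4), inv_mul_le_iff₀ h4]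
  rw [Measure.real, volume_cell, ENNReal.toReal_ofReal h4.le] at this
  simpa [mul_comm] using this

lemma Nice.dyadicMean {f : ℝ × ℝ → ℝ} (hf : Nice f) (n : ℤ) : Nice (dyadicMean n f) := by
  obtain ⟨C, hC⟩ := hf.bdd
  obtain ⟨R, hR⟩ := hf.supp
  refine ⟨measurable_of_idx fun x y h => dyadicMean_congr h, ⟨C, abs_dyadicMean_le n hC⟩,
    ⟨R + (2 : ℝ) ^ n, fun x hx => ?_⟩⟩
  have : ∃ y ∈ cell n x, f y ≠ 0 := by
    by_contra! hcon
    refine hx ?_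
    rw [PlanarDyadic.dyadicMean, setIntegral_congr_fun (measurableSet_cell n x) hcon]
    simp
  obtain ⟨y, hy, hfy⟩ := this
  have h1 := norm_sub_le_of_idx_eq (hy : idx n y = idx n x)
  have h2 := hR y hfy
  calc ‖x‖ = ‖y - (y - x)‖ := by congr 1; abel
    _ ≤ ‖y‖ + ‖y - x‖ := norm_sub_le _ _
    _ ≤ _ := by linarith

lemma dyadicMean_of_idx {n : ℤ} {h : ℝ × ℝ → ℝ} (hh : ∀ x y, idx n x = idx n y → h x = h y)
    (f : ℝ × ℝ → ℝ) (x : ℝ × ℝ) : dyadicMean n (fun y => f y * h y) x = dyadicMean n f x * h x := by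
  rw [dyadicMean, dyadicMean, setIntegral_congr_fun (g := fun y => f y * h x)
    (measurableSet_cell n x), integral_mul_const, mul_assoc]
  intro y hy
  simp [hh y x hy]

lemma dyadicMean_const (n : ℤ) (c : ℝ) (x : ℝ × ℝ) : dyadicMean n (fun _ => c) x = c := by
  have h4 : (0 : ℝ) < (4 : ℝ) ^ n := by positivity
  rw [dyadicMean, setIntegral_const, Measure.real, volume_cell, ENNReal.toReal_ofReal h4.le]
  simp [h4.ne']

lemma dyadicMean_self {n : ℤ} {h : ℝ × ℝ → ℝ} (hh : ∀ x y, idx n x = idx n y → h x = h y)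
    (x : ℝ × ℝ) : dyadicMean n h x = h x := by
  have := dyadicMean_of_idx hh (fun _ => 1) x
  simpa [dyadicMean_const] using this

lemma hasSum_integral_idx (n : ℤ) {f : ℝ × ℝ → ℝ} (hf : Integrable f) :
    HasSum (fun k => ∫ x in idx n ⁻¹' {k}, f x) (∫ x, f x) := by
  have := hasSum_integral_iUnion (μ := volume) (f := f) (s := fun k => idx n ⁻¹' {k})
    (fun k => measurable_idx n (measurableSet_singleton _))
    (fun i j hij => Set.disjoint_left.2 fun x hx hx' => hij (hx.symm.trans hx'))
    hf.integrableOn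
  rwa [show (⋃ k, idx n ⁻¹' {k}) = Set.univ by ext x; simp, setIntegral_univ] at this

lemma integral_dyadicMean (n : ℤ) {f : ℝ × ℝ → ℝ} (hf : Nice f) :
    ∫ x, dyadicMean n f x = ∫ x, f x := by
  have h4 : (0 : ℝ) < (4 : ℝ) ^ n := by positivity
  refine (hasSum_integral_idx n (hf.dyadicMean n).integrable).unique ?_
  convert hasSum_integral_idx n hf.integrable using 2 with k
  have hm : MeasurableSet (idx n ⁻¹' {k}) := measurable_idx n (measurableSet_singleton _)
  rw [setIntegral_congr_fun (g := fun _ => ((4 : ℝ) ^ n)⁻¹ * ∫ y in idx n ⁻¹' {k}, f y) hm,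
    setIntegral_const, Measure.real, volume_preimage_idx, ENNReal.toReal_ofReal h4.le, smul_eq_mul,
    mul_inv_cancel_left₀ h4.ne']
  intro x hx
  have : cell n x = idx n ⁻¹' {k} := by
    ext y; simp only [cell, Set.mem_ofPred_eq, Set.mem_preimage, Set.mem_singleton_iff]; rw [hx]
  simp only [dyadicMean, this]

/-- Pairing with a function constant on dyadic squares. -/
lemma integral_dyadicMean_mul {n : ℤ} {f h : ℝ × ℝ → ℝ} (hf : Nice f)
    (hh : ∀ x y, idx n x = idx n y → h x = h y) {C : ℝ} (hC : ∀ x, |h x| ≤ C) :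
    ∫ x, dyadicMean n f x * h x = ∫ x, f x * h x := by
  rw [← integral_dyadicMean n (hf.mul_bdd (measurable_of_idx hh) hC)]
  simp only [dyadicMean_of_idx hh]

lemma dyadicMean_dyadicMean_of_le {m n : ℤ} (hmn : m ≤ n) {f : ℝ × ℝ → ℝ} (hf : Nice f)
    (x : ℝ × ℝ) : dyadicMean n (dyadicMean m f) x = dyadicMean n f x := by
  have key := integral_dyadicMean_mul (n := m) (h := (cell n x).indicator 1) hf ?_ (C := 1) ?_
  · simp only [dyadicMean] at key ⊢
    congr 1
    rw [← integral_indicator (measurableSet_cell n x),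
      ← integral_indicator (measurableSet_cell n x)]
    have hind : ∀ u : ℝ × ℝ → ℝ, (cell n x).indicator u =
        fun y => u y * (cell n x).indicator 1 y := by
      intro u; ext y; by_cases hy : y ∈ cell n x <;> simp [hy]
    rw [hind, hind f]
    exact key
  · intro a b hab
    have := idx_refine hmn hab
    have hiff : a ∈ cell n x ↔ b ∈ cell n x := by simp only [cell, Set.mem_ofPred_eq, this]
    by_cases hb : b ∈ cell n x
    · simp [hb, hiff.2 hb]
    · simp [hb, mt hiff.1 hb]
  · intro y
    by_cases hy : y ∈ cell n x <;> simp [hy]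

lemma dyadicMean_sub (n : ℤ) {f g : ℝ × ℝ → ℝ} (hf : Nice f) (hg : Nice g) (x : ℝ × ℝ) :
    dyadicMean n (fun y => f y - g y) x = dyadicMean n f x - dyadicMean n g x := by
  simp only [dyadicMean]
  rw [integral_sub hf.integrable.integrableOn hg.integrable.integrableOn, mul_sub]

lemma dyadicMean_add (n : ℤ) {f g : ℝ × ℝ → ℝ} (hf : Nice f) (hg : Nice g) (x : ℝ × ℝ) :
    dyadicMean n (fun y => f y + g y) x = dyadicMean n f x + dyadicMean n g x := by
  simp only [dyadicMean]
  rw [integral_add hf.integrable.integrableOn hg.integrable.integrableOn, mul_add]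

lemma abs_dyadicMean_le_dyadicMean_abs (n : ℤ) (f : ℝ × ℝ → ℝ) (x : ℝ × ℝ) :
    |dyadicMean n f x| ≤ dyadicMean n (fun y => |f y|) x := by
  have h4 : (0 : ℝ) < (4 : ℝ) ^ n := by positivity
  simp only [dyadicMean]
  rw [abs_mul, abs_of_pos (inv_pos.2 h4)]
  gcongr
  exact abs_integral_le_integral_abs

lemma integral_abs_dyadicMean_le (n : ℤ) {f : ℝ × ℝ → ℝ} (hf : Nice f) :
    ∫ x, |dyadicMean n f x| ≤ ∫ x, |f x| := by
  rw [← integral_dyadicMean n hf.abs]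
  exact integral_mono (hf.dyadicMean n).abs.integrable (hf.abs.dyadicMean n).integrable
    (abs_dyadicMean_le_dyadicMean_abs n f)

lemma integral_sub_sq {f g : ℝ × ℝ → ℝ} (hf : Nice f) (hg : Nice g) :
    ∫ x, (f x - g x) ^ 2 = (∫ x, f x ^ 2) + (∫ x, g x ^ 2) - 2 * ∫ x, f x * g x := by
  have h1 := hf.sq.integrable (μ := volume)
  have h2 := hg.sq.integrable (μ := volume)
  have h3 := (hf.mul hg).integrable (μ := volume)
  rw [← integral_const_mul, ← integral_add h1 h2, ← integral_sub (by exact h1.add h2)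
    (h3.const_mul 2)]
  congr 1
  ext x
  ring

/-- The martingale difference between scales `2 ^ (n - 1)` and `2 ^ n`. -/
noncomputable def dyadicDiff (n : ℤ) (f : ℝ × ℝ → ℝ) (x : ℝ × ℝ) : ℝ :=
  dyadicMean (n - 1) f x - dyadicMean n f x

lemma Nice.dyadicDiff {f : ℝ × ℝ → ℝ} (hf : Nice f) (n : ℤ) : Nice (dyadicDiff n f) :=
  (hf.dyadicMean _).sub (hf.dyadicMean _)

lemma dyadicMean_dyadicDiff (n : ℤ) {f : ℝ × ℝ → ℝ} (hf : Nice f) (x : ℝ × ℝ) :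
    dyadicMean n (dyadicDiff n f) x = 0 := by
  have := dyadicMean_sub n (hf.dyadicMean (n - 1)) (hf.dyadicMean n) x
  rw [dyadicMean_dyadicMean_of_le (by omega) hf, dyadicMean_dyadicMean_of_le le_rfl hf] at this
  rw [sub_self] at this
  exact this

lemma integral_dyadicDiff_sq (n : ℤ) {f : ℝ × ℝ → ℝ} (hf : Nice f) :
    ∫ x, dyadicDiff n f x ^ 2 =
      (∫ x, dyadicMean (n - 1) f x ^ 2) - ∫ x, dyadicMean n f x ^ 2 := by
  obtain ⟨C, hC⟩ := hf.bdd
  have hcross : ∫ x, dyadicMean (n - 1) f x * dyadicMean n f x = ∫ x, dyadicMean n f x ^ 2 := by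
    rw [integral_dyadicMean_mul (C := C) hf
      (fun x y h => dyadicMean_congr (idx_refine (by omega) h)) (abs_dyadicMean_le n hC)]
    rw [← integral_dyadicMean_mul (n := n) (C := C) hf
      (fun x y h => dyadicMean_congr h) (abs_dyadicMean_le n hC)]
    simp [pow_two]
  simp only [dyadicDiff]
  rw [integral_sub_sq (hf.dyadicMean (n - 1)) (hf.dyadicMean n), hcross]
  ring

lemma integral_dyadicMean_sq_le (n : ℤ) {f : ℝ × ℝ → ℝ} (hf : Nice f) :
    ∫ x, dyadicMean n f x ^ 2 ≤ ∫ x, f x ^ 2 := by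
  obtain ⟨C, hC⟩ := hf.bdd
  have hcross : ∫ x, dyadicMean n f x ^ 2 = ∫ x, f x * dyadicMean n f x := by
    rw [← integral_dyadicMean_mul (n := n) (C := C) hf
      (fun x y h => dyadicMean_congr h) (abs_dyadicMean_le n hC)]
    simp [pow_two]
  have h0 : 0 ≤ ∫ x, (f x - dyadicMean n f x) ^ 2 := integral_nonneg fun x => sq_nonneg _
  rw [integral_sub_sq hf (hf.dyadicMean n), ← hcross] at h0
  linarith

lemma sum_integral_dyadicDiff_sq_le (J : Finset ℤ) {f : ℝ × ℝ → ℝ} (hf : Nice f) :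
    ∑ j ∈ J, ∫ x, dyadicDiff j f x ^ 2 ≤ ∫ x, f x ^ 2 := by
  have tele : ∀ (a : ℤ) (k : ℕ), ∑ j ∈ Finset.Ioc a (a + k), ∫ x, dyadicDiff j f x ^ 2 =
      (∫ x, dyadicMean a f x ^ 2) - ∫ x, dyadicMean (a + k) f x ^ 2 := by
    intro a k
    induction k with
    | zero => simp
    | succ k ih =>
      have : Finset.Ioc a (a + ((k + 1 : ℕ) : ℤ)) =
          insert (a + k + 1) (Finset.Ioc a (a + k)) := by
        ext j; simp only [Finset.mem_Ioc, Finset.mem_insert]; omega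
      rw [this, Finset.sum_insert (by simp), ih, integral_dyadicDiff_sq _ hf]
      push_cast
      rw [show a + (k : ℤ) + 1 - 1 = a + k by ring, show a + ((k : ℤ) + 1) = a + k + 1 by ring]
      ring
  obtain ⟨a, ha⟩ := J.bddBelow
  obtain ⟨b, hb⟩ := J.bddAbove
  have hsub : J ⊆ Finset.Ioc (a - 1) (a - 1 + ((b - a + 1).toNat : ℤ)) := by
    intro j hj
    have h1 := ha hj
    have h2 := hb hj
    simp only [Finset.mem_Ioc]
    omega
  refine (Finset.sum_le_sum_of_subset_of_nonneg hsub
    fun _ _ _ => integral_nonneg fun x => sq_nonneg _).trans ?_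
  rw [tele]
  have : 0 ≤ ∫ x, dyadicMean (a - 1 + ((b - a + 1).toNat : ℤ)) f x ^ 2 :=
    integral_nonneg fun x => sq_nonneg _
  linarith [integral_dyadicMean_sq_le (a - 1) hf]

end Cells

section MeanPairing

lemma integrable_of_bdd_supp {α β : Type*} [MeasurableSpace α] [NormedAddCommGroup α]
    [ProperSpace α] {ν : Measure α} [IsFiniteMeasureOnCompacts ν] [SFinite ν]
    [MeasurableSpace β] {μ : Measure β} [IsFiniteMeasure μ]
    {F : α × β → ℝ} (hF : Measurable F) {C R : ℝ} (hC : ∀ p, |F p| ≤ C)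
    (hR : ∀ p, F p ≠ 0 → ‖p.1‖ ≤ R) : Integrable F (ν.prod μ) := by
  have : IntegrableOn F (Metric.closedBall 0 R ×ˢ Set.univ) (ν.prod μ) := by
    refine Measure.integrableOn_of_bounded (M := C) ?_ hF.aestronglyMeasurable ?_
    · rw [Measure.prod_prod]
      exact (ENNReal.mul_lt_top (isCompact_closedBall 0 R).measure_lt_top (measure_lt_top μ _)).ne
    · exact Filter.Eventually.of_forall fun x => hC x
  refine (integrableOn_iff_integrable_of_support_subset fun x hx => ?_).1 this
  simpa using hR x hx

/-- The uniform probability measure on angles. -/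
noncomputable def angle : Measure ℝ :=
  (ENNReal.ofReal (2 * Real.pi))⁻¹ • volume.restrict (Set.Ioc (-Real.pi) Real.pi)

instance : IsProbabilityMeasure angle := by
  constructor
  have h := Real.pi_pos
  rw [angle, Measure.smul_apply, Measure.restrict_apply_univ, Real.volume_Ioc, smul_eq_mul,
    show Real.pi - -Real.pi = 2 * Real.pi by ring]
  exact ENNReal.inv_mul_cancel (by simpa using h) ENNReal.ofReal_ne_top

lemma integral_angle (F : ℝ → ℝ) :
    ∫ θ, F θ ∂angle = (2 * Real.pi)⁻¹ * ∫ θ in (-Real.pi)..Real.pi, F θ := by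
  have h := Real.pi_pos
  rw [angle, integral_smul_measure, intervalIntegral.integral_of_le (by linarith),
    ENNReal.toReal_inv, ENNReal.toReal_ofReal (by linarith), smul_eq_mul]

lemma integral_angle_add {F : ℝ → ℝ} (hF : Function.Periodic F (2 * Real.pi)) (a : ℝ) :
    ∫ θ, F (θ + a) ∂angle = ∫ θ, F θ ∂angle := by
  rw [integral_angle, integral_angle, intervalIntegral.integral_comp_add_right]
  have := hF.intervalIntegral_add_eq (-Real.pi + a) (-Real.pi)
  rw [show -Real.pi + a + 2 * Real.pi = Real.pi + a by ring,
    show -Real.pi + 2 * Real.pi = Real.pi by ring] at this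
  rw [this]

/-- The point of the unit circle with a given angle. -/
noncomputable def circ (θ : ℝ) : ℝ × ℝ := (Real.cos θ, Real.sin θ)

lemma measurable_circ : Measurable circ := by unfold circ; fun_prop

lemma norm_circ_le (θ : ℝ) : ‖circ θ‖ ≤ 1 := by
  simp [circ, Prod.norm_def, Real.abs_cos_le_one, Real.abs_sin_le_one]

lemma periodic_circ : Function.Periodic circ (2 * Real.pi) := fun θ => by simp [circ]

/-- Averages over circles of radius `r`. -/
noncomputable def circMean (r : ℝ) (f : ℝ × ℝ → ℝ) (x : ℝ × ℝ) : ℝ :=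
  ∫ θ, f (x + r • circ θ) ∂angle

lemma measurable_shift (r : ℝ) :
    Measurable fun p : (ℝ × ℝ) × ℝ => p.1 + r • circ p.2 :=
  measurable_fst.add ((measurable_circ.comp measurable_snd).const_smul r)

lemma norm_smul_circ_le (r θ : ℝ) : ‖r • circ θ‖ ≤ |r| := by
  rw [norm_smul, Real.norm_eq_abs]
  exact mul_le_of_le_one_right (abs_nonneg _) (norm_circ_le θ)

namespace Nice

variable {f g : ℝ × ℝ → ℝ}

lemma integrable_shift (hf : Nice f) (r : ℝ) (x : ℝ × ℝ) :
    Integrable (fun θ => f (x + r • circ θ)) angle := by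
  obtain ⟨C, hC⟩ := hf.bdd
  refine Integrable.of_bound (C := C) ?_ (Filter.Eventually.of_forall fun θ => hC _)
  exact (hf.meas.comp ((measurable_shift r).comp
    (measurable_const.prodMk measurable_id (f := fun _ => x)))).aestronglyMeasurable

lemma integrable_shift_prod (hf : Nice f) (r : ℝ) :
    Integrable (fun p : (ℝ × ℝ) × ℝ => f (p.1 + r • circ p.2)) (volume.prod angle) := by
  obtain ⟨C, hC⟩ := hf.bdd
  obtain ⟨R, hR⟩ := hf.supp
  refine integrable_of_bdd_supp (hf.meas.comp (measurable_shift r)) (C := C) (fun p => hC _)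
    (R := R + |r|) fun p hp => ?_
  have h1 := hR _ hp
  have h2 := norm_smul_circ_le r p.2
  have h3 := norm_sub_le (p.1 + r • circ p.2) (r • circ p.2)
  rw [add_sub_cancel_right] at h3
  linarith

protected lemma circMean (hf : Nice f) (r : ℝ) : Nice (circMean r f) := by
  obtain ⟨C, hC⟩ := hf.bdd
  obtain ⟨R, hR⟩ := hf.supp
  refine ⟨?_, ⟨C, fun x => ?_⟩, ⟨R + |r|, fun x hx => ?_⟩⟩
  · exact ((hf.meas.comp (measurable_shift r)).stronglyMeasurable.integral_prod_right').measurable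
  · have := norm_integral_le_of_norm_le_const (μ := angle) (f := fun θ => f (x + r • circ θ))
      (Filter.Eventually.of_forall fun θ => hC _)
    simpa [PlanarDyadic.circMean] using this
  · by_contra hcon
    refine hx ?_
    have : ∀ θ, f (x + r • circ θ) = 0 := by
      intro θ
      by_contra h
      have h1 := hR _ h
      have h2 := norm_smul_circ_le r θ
      have h3 := norm_sub_le (x + r • circ θ) (r • circ θ)
      rw [add_sub_cancel_right] at h3
      linarith
    simp [PlanarDyadic.circMean, this]

end Nice

variable {f g : ℝ × ℝ → ℝ}

lemma circMean_add (hf : Nice f) (hg : Nice g) (r : ℝ) (x : ℝ × ℝ) :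
    circMean r (fun x => f x + g x) x = circMean r f x + circMean r g x :=
  integral_add (hf.integrable_shift r x) (hg.integrable_shift r x)

lemma circMean_sum {ι : Type*} (s : Finset ι) {F : ι → ℝ × ℝ → ℝ} (h : ∀ i ∈ s, Nice (F i))
    (r : ℝ) (x : ℝ × ℝ) :
    circMean r (fun x => ∑ i ∈ s, F i x) x = ∑ i ∈ s, circMean r (F i) x :=
  integral_finsetSum s fun i hi => (h i hi).integrable_shift r x

lemma abs_circMean_le (f : ℝ × ℝ → ℝ) (r : ℝ) (x : ℝ × ℝ) :
    |circMean r f x| ≤ circMean r (fun y => |f y|) x :=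
  abs_integral_le_integral_abs

lemma integral_circMean (hf : Nice f) (r : ℝ) : ∫ x, circMean r f x = ∫ x, f x := by
  unfold circMean
  rw [integral_integral_swap (hf.integrable_shift_prod r)]
  simp only [integral_add_right_eq_self (μ := (volume : Measure (ℝ × ℝ))) f]
  simp

lemma integral_abs_circMean_le (hf : Nice f) (r : ℝ) :
    ∫ x, |circMean r f x| ≤ ∫ x, |f x| := by
  rw [← integral_circMean hf.abs r]
  exact integral_mono (hf.circMean r).abs.integrable (hf.abs.circMean r).integrable
    fun x => abs_circMean_le f r x

lemma exists_of_lt_circMean {h r : ℝ} {x : ℝ × ℝ} (hf : ∀ x, 0 ≤ f x)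
    (hx : h < circMean r f x) : ∃ θ, h < f (x + r • circ θ) := by
  by_contra! hcon
  have := norm_integral_le_of_norm_le_const (μ := angle) (f := fun θ => f (x + r • circ θ)) (C := h)
    (Filter.Eventually.of_forall fun θ => by
      rw [Real.norm_eq_abs, abs_of_nonneg (hf _)]; exact hcon θ)
  simp at this
  exact absurd ((le_abs_self _).trans this) (not_le.2 hx)

lemma circMean_eq_zero {r : ℝ} {x : ℝ × ℝ} (h : ∀ θ, f (x + r • circ θ) = 0) :
    circMean r f x = 0 := by simp [circMean, h]

lemma circMean_comp_smul (c : ℝ) (r : ℝ) (x : ℝ × ℝ) :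
    circMean r (fun y => f (c • y)) x = circMean (c * r) f (c • x) := by
  simp [circMean, smul_add, smul_smul]

end MeanPairing

section Correlation

variable {f g : ℝ × ℝ → ℝ}

/-- The autocorrelation of a function. -/
noncomputable def corr (g : ℝ × ℝ → ℝ) (w : ℝ × ℝ) : ℝ := ∫ y, g y * g (y + w)

lemma measurable_corr (hg : Nice g) : Measurable (corr g) := by
  unfold corr
  have : Measurable fun p : (ℝ × ℝ) × (ℝ × ℝ) => g p.2 * g (p.2 + p.1) :=
    (hg.meas.comp measurable_snd).mul (hg.meas.comp (measurable_snd.add measurable_fst))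
  exact this.stronglyMeasurable.integral_prod_right'.measurable

lemma Nice.comp_add (hg : Nice g) (w : ℝ × ℝ) : Nice (fun y => g (y + w)) := by
  obtain ⟨C, hC⟩ := hg.bdd
  obtain ⟨R, hR⟩ := hg.supp
  refine ⟨hg.meas.comp (by fun_prop), ⟨C, fun _ => hC _⟩, ⟨R + ‖w‖, fun y hy => ?_⟩⟩
  have h1 := hR _ hy
  have h3 := norm_sub_le (y + w) w
  rw [add_sub_cancel_right] at h3
  linarith

lemma abs_corr_le (hg : Nice g) (w : ℝ × ℝ) : |corr g w| ≤ ∫ y, g y ^ 2 := by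
  have h1 : ∫ y, g (y + w) ^ 2 = ∫ y, g y ^ 2 :=
    integral_add_right_eq_self (μ := (volume : Measure (ℝ × ℝ))) (fun y => g y ^ 2) w
  have h2 : ∫ y, (g y ^ 2 + g (y + w) ^ 2) / 2 = ∫ y, g y ^ 2 := by
    rw [integral_div, integral_add hg.sq.integrable (hg.comp_add w).sq.integrable, h1]
    ring
  rw [← h2]
  refine (abs_integral_le_integral_abs).trans (integral_mono (hg.mul (hg.comp_add w)).abs.integrable
    ((hg.sq.add (hg.comp_add w).sq).integrable.div_const 2) fun y => ?_)
  simp only [abs_mul]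
  nlinarith [sq_nonneg (|g y| - |g (y + w)|), sq_abs (g y), sq_abs (g (y + w))]

/-- The circular means of the autocorrelation around the origin. -/
noncomputable def radCorr (g : ℝ × ℝ → ℝ) (r : ℝ) : ℝ := ∫ θ, corr g (r • circ θ) ∂angle

lemma measurable_radCorr (hg : Nice g) : Measurable (radCorr g) := by
  unfold radCorr
  have : Measurable fun p : ℝ × ℝ => corr g (p.1 • circ p.2) :=
    (measurable_corr hg).comp (measurable_fst.smul (measurable_circ.comp measurable_snd))
  exact this.stronglyMeasurable.integral_prod_right'.measurable

lemma abs_radCorr_le (hg : Nice g) (r : ℝ) : |radCorr g r| ≤ ∫ y, g y ^ 2 := by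
  have := norm_integral_le_of_norm_le_const (μ := angle) (f := fun θ => corr g (r • circ θ))
      (Filter.Eventually.of_forall fun θ => abs_corr_le hg _)
  simpa [radCorr] using this

lemma radCorr_neg (r : ℝ) : radCorr g (-r) = radCorr g r := by
  unfold radCorr
  rw [← integral_angle_add (F := fun θ => corr g (r • circ θ)) (fun θ => by
    simp only [periodic_circ θ]) Real.pi]
  congr 1; ext θ; congr 1
  simp [circ]

lemma circ_add_sub (θ ψ : ℝ) :
    circ (ψ + θ) - circ θ = (2 * Real.sin (ψ / 2)) • circ (θ + (ψ / 2 + Real.pi / 2)) := by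
  ext
  · simp only [circ, Prod.fst_sub, Prod.smul_fst, smul_eq_mul]
    rw [Real.cos_sub_cos, ← add_assoc, Real.cos_add_pi_div_two]
    ring_nf
  · simp only [circ, Prod.snd_sub, Prod.smul_snd, smul_eq_mul]
    rw [Real.sin_sub_sin, ← add_assoc, Real.sin_add_pi_div_two]
    ring_nf

lemma integral_circMean_sq (hg : Nice g) :
    ∫ x, circMean 1 g x ^ 2 = ∫ ψ, radCorr g (2 * Real.sin (ψ / 2)) ∂angle := by
  obtain ⟨C, hC⟩ := hg.bdd
  obtain ⟨R, hR⟩ := hg.supp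
  have e1 : ∀ x, circMean 1 g x ^ 2 =
      ∫ q, g (x + circ q.1) * g (x + circ q.2) ∂(angle.prod angle) := by
    intro x
    rw [integral_prod_mul (fun θ => g (x + circ θ)) (fun θ => g (x + circ θ)), pow_two]
    simp [circMean]
  have hm : Measurable fun p : (ℝ × ℝ) × (ℝ × ℝ) => g (p.1 + circ p.2.1) * g (p.1 + circ p.2.2) :=
    (hg.meas.comp (measurable_fst.add (measurable_circ.comp (by fun_prop)))).mul
      (hg.meas.comp (measurable_fst.add (measurable_circ.comp (by fun_prop))))
  have hFint : Integrable (fun p : (ℝ × ℝ) × (ℝ × ℝ) =>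
      g (p.1 + circ p.2.1) * g (p.1 + circ p.2.2)) (volume.prod (angle.prod angle)) := by
    refine integrable_of_bdd_supp hm (C := C * C) (R := R + 1) (fun p => ?_) fun p hp => ?_
    · rw [abs_mul]
      exact mul_le_mul (hC _) (hC _) (abs_nonneg _) ((abs_nonneg _).trans (hC 0))
    · have h1 := hR _ (left_ne_zero_of_mul hp)
      have h2 := norm_circ_le p.2.1
      have h3 := norm_sub_le (p.1 + circ p.2.1) (circ p.2.1)
      rw [add_sub_cancel_right] at h3
      linarith
  have e2 : ∀ q : ℝ × ℝ, ∫ x, g (x + circ q.1) * g (x + circ q.2) =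
      corr g (circ q.2 - circ q.1) := by
    intro q
    rw [corr, ← integral_add_right_eq_self (μ := (volume : Measure (ℝ × ℝ)))
      (fun y => g y * g (y + (circ q.2 - circ q.1))) (circ q.1)]
    congr 1; ext x
    rw [show x + circ q.1 + (circ q.2 - circ q.1) = x + circ q.2 by abel]
  have hb : ∀ w, ‖corr g w‖ ≤ ∫ y, g y ^ 2 := abs_corr_le hg
  have e3 : ∫ q, corr g (circ q.2 - circ q.1) ∂(angle.prod angle) =
      ∫ θ, ∫ φ, corr g (circ φ - circ θ) ∂angle ∂angle := by
    refine integral_prod (fun q : ℝ × ℝ => corr g (circ q.2 - circ q.1))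
      (Integrable.of_bound (C := ∫ y, g y ^ 2)
      ?_ (Filter.Eventually.of_forall fun q => hb _))
    exact ((measurable_corr hg).comp ((measurable_circ.comp measurable_snd).sub
      (measurable_circ.comp measurable_fst))).aestronglyMeasurable
  simp_rw [e1]
  rw [integral_integral_swap hFint]
  simp_rw [e2]
  rw [e3]
  have e4 : ∀ θ, ∫ φ, corr g (circ φ - circ θ) ∂angle =
      ∫ ψ, corr g (circ (ψ + θ) - circ θ) ∂angle := fun θ =>
    (integral_angle_add (F := fun φ => corr g (circ φ - circ θ)) (fun φ => by
      simp only [periodic_circ φ]) θ).symm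
  simp_rw [e4]
  rw [integral_integral_swap]
  · congr 1; ext ψ
    simp_rw [circ_add_sub]
    exact integral_angle_add (F := fun θ => corr g ((2 * Real.sin (ψ / 2)) • circ θ)) (fun θ => by
      simp only [periodic_circ θ]) _
  · refine Integrable.of_bound (C := ∫ y, g y ^ 2)
      ?_ (Filter.Eventually.of_forall fun q => hb _)
    exact ((measurable_corr hg).comp ((measurable_circ.comp (measurable_snd.add measurable_fst)).sub
      (measurable_circ.comp measurable_fst))).aestronglyMeasurable

lemma integral_angle_radCorr (hg : Nice g) :
    ∫ ψ, radCorr g (2 * Real.sin (ψ / 2)) ∂angle =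
      2 / Real.pi * ∫ α in (0 : ℝ)..(Real.pi / 2), radCorr g (2 * Real.sin α) := by
  have hpi := Real.pi_pos
  rw [integral_angle]
  have hii : ∀ a b, IntervalIntegrable (fun α => radCorr g (2 * Real.sin α)) volume a b := by
    intro a b
    rw [intervalIntegrable_iff]
    refine Measure.integrableOn_of_bounded (M := ∫ y, g y ^ 2) (by simp)
      ((measurable_radCorr hg).comp (by fun_prop)).aestronglyMeasurable
      (Filter.Eventually.of_forall fun _ => abs_radCorr_le hg _)
  rw [intervalIntegral.integral_comp_div (fun α => radCorr g (2 * Real.sin α)) two_ne_zero,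
    ← intervalIntegral.integral_add_adjacent_intervals (hii (-Real.pi / 2) 0) (hii 0 (Real.pi / 2))]
  have : ∫ α in (-Real.pi / 2)..0, radCorr g (2 * Real.sin α) =
      ∫ α in (0 : ℝ)..(Real.pi / 2), radCorr g (2 * Real.sin α) := by
    rw [show -Real.pi / 2 = -(Real.pi / 2) by ring, ← neg_zero,
      ← intervalIntegral.integral_comp_neg]
    simp [radCorr_neg]
  rw [this, smul_eq_mul]
  field_simp
  ring

end Correlation

section JacobianKernel

variable {f g : ℝ × ℝ → ℝ}

/-- A regularised Jacobian factor for the difference map on the circle. -/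
noncomputable def jacProfile (η u : ℝ) : ℝ := √u / (√u ^ 2 + η)

/-- The radial kernel built from `jacProfile`. -/
noncomputable def jacKernel (η : ℝ) (w : ℝ × ℝ) : ℝ :=
  jacProfile η ((w.1 ^ 2 + w.2 ^ 2) * (4 - (w.1 ^ 2 + w.2 ^ 2)))

lemma jacProfile_nonneg {η : ℝ} (hη : 0 < η) (u : ℝ) : 0 ≤ jacProfile η u := by
  unfold jacProfile; positivity

lemma jacProfile_of_nonpos {η u : ℝ} (hu : u ≤ 0) : jacProfile η u = 0 := by
  simp [jacProfile, Real.sqrt_eq_zero_of_nonpos hu]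

lemma abs_jacProfile_sub_le {η : ℝ} (hη : 0 < η) (a b : ℝ) :
    |jacProfile η a - jacProfile η b| ≤ √|a - b| / η := by
  have key : ∀ u v : ℝ, 0 ≤ u → 0 ≤ v → |u / (u ^ 2 + η) - v / (v ^ 2 + η)| ≤ |u - v| / η := by
    intro u v hu hv
    have h1 : u / (u ^ 2 + η) - v / (v ^ 2 + η) =
        (u - v) * ((η - u * v) / ((u ^ 2 + η) * (v ^ 2 + η))) := by
      field_simp; ring
    rw [h1, abs_mul, div_eq_mul_one_div |u - v|]
    refine mul_le_mul_of_nonneg_left ?_ (abs_nonneg _)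
    rw [abs_div, abs_of_pos (show 0 < (u ^ 2 + η) * (v ^ 2 + η) by positivity),
      div_le_div_iff₀ (by positivity) hη]
    have h2 := mul_nonneg hu hv
    have h3 : |η - u * v| ≤ η + u * v := by
      rw [abs_le]; constructor <;> linarith
    nlinarith [mul_le_mul_of_nonneg_right h3 hη.le, mul_nonneg hη.le (sq_nonneg (u - v)),
      mul_nonneg (sq_nonneg u) (sq_nonneg v), mul_nonneg hη.le (sq_nonneg u),
      mul_nonneg hη.le (sq_nonneg v)]
  have hs : |√a - √b| ≤ √|a - b| := by
    have hw : ∀ c d : ℝ, √c - √d ≤ √|c - d| := by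
      intro c d
      have : √c ≤ √(|c - d| + d ⊔ 0) := by
        apply Real.sqrt_le_sqrt
        have := le_abs_self (c - d)
        have := le_max_left d 0
        linarith
      have h2 : √(|c - d| + d ⊔ 0) ≤ √|c - d| + √(d ⊔ 0) := by
        refine Real.sqrt_le_iff.2 ⟨by positivity, ?_⟩
        have e1 := Real.sq_sqrt (abs_nonneg (c - d))
        have e2 := Real.sq_sqrt (le_max_right d 0)
        nlinarith [mul_nonneg (Real.sqrt_nonneg |c - d|) (Real.sqrt_nonneg (d ⊔ 0))]
      have h3 : √(d ⊔ 0) = √d := by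
        rcases le_total d 0 with h | h
        · rw [max_eq_right h, Real.sqrt_zero, Real.sqrt_eq_zero_of_nonpos h]
        · rw [max_eq_left h]
      linarith
    rw [abs_le]
    have := hw b a
    rw [abs_sub_comm] at this
    constructor <;> linarith [hw a b]
  exact (key _ _ (Real.sqrt_nonneg _) (Real.sqrt_nonneg _)).trans (by gcongr)

lemma jacProfile_le {η : ℝ} (hη : 0 < η) (a : ℝ) : jacProfile η a ≤ √|a| / η := by
  have := abs_jacProfile_sub_le hη a 0
  rw [jacProfile_of_nonpos (η := η) le_rfl, sub_zero, sub_zero] at this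
  exact (le_abs_self _).trans this

lemma jacKernel_supp {η : ℝ} {w : ℝ × ℝ} (h : jacKernel η w ≠ 0) : ‖w‖ ≤ 2 := by
  have h1 : 0 < (w.1 ^ 2 + w.2 ^ 2) * (4 - (w.1 ^ 2 + w.2 ^ 2)) := by
    by_contra! hcon
    exact h (jacProfile_of_nonpos hcon)
  have h2 : 0 < 4 - (w.1 ^ 2 + w.2 ^ 2) := by
    by_contra! hcon
    nlinarith [sq_nonneg w.1, sq_nonneg w.2]
  rw [Prod.norm_def]
  refine max_le ?_ ?_ <;> rw [Real.norm_eq_abs] <;> apply abs_le_of_sq_le_sq _ (by norm_num) <;>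
    nlinarith [sq_nonneg w.1, sq_nonneg w.2]

lemma nice_jacKernel {η : ℝ} (hη : 0 < η) : Nice (jacKernel η) := by
  refine ⟨?_, ⟨√4 / η, fun w => ?_⟩, ⟨2, fun w => jacKernel_supp⟩⟩
  · unfold jacKernel jacProfile; fun_prop
  · rw [jacKernel, abs_of_nonneg (jacProfile_nonneg hη _)]
    set t := w.1 ^ 2 + w.2 ^ 2
    rcases le_total (t * (4 - t)) 0 with h | h
    · rw [jacProfile_of_nonpos h]; positivity
    · refine (jacProfile_le hη _).trans ?_
      rw [abs_of_nonneg h]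
      gcongr
      nlinarith [sq_nonneg (t - 2)]

lemma abs_jacKernel_sub_le {η ε : ℝ} (hη : 0 < η) (hε : 0 ≤ ε) (hε1 : ε ≤ 1) {w w' : ℝ × ℝ}
    (h : ‖w - w'‖ ≤ ε) : |jacKernel η w - jacKernel η w'| ≤ √(220 * ε) / η := by
  wlog hw : jacKernel η w ≠ 0 generalizing w w' with H
  · push Not at hw
    by_cases hw' : jacKernel η w' = 0
    · rw [hw, hw', sub_self, abs_zero]; positivity
    · rw [abs_sub_comm]
      exact H (by rwa [norm_sub_rev]) hw'
  have hw2 := jacKernel_supp hw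
  refine (abs_jacProfile_sub_le hη _ _).trans ?_
  gcongr
  rw [Prod.norm_def, max_le_iff] at hw2 h
  simp only [Real.norm_eq_abs, Prod.fst_sub, Prod.snd_sub] at hw2 h
  obtain ⟨a1, a2⟩ := abs_le.1 hw2.1
  obtain ⟨b1, b2⟩ := abs_le.1 hw2.2
  obtain ⟨c1, c2⟩ := abs_le.1 h.1
  obtain ⟨d1, d2⟩ := abs_le.1 h.2
  set s := w.1 ^ 2 + w.2 ^ 2 with hs
  set t := w'.1 ^ 2 + w'.2 ^ 2 with ht
  have hst : |s - t| ≤ 10 * ε := by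
    have : s - t = (w.1 - w'.1) * (w.1 + w'.1) + (w.2 - w'.2) * (w.2 + w'.2) := by
      rw [hs, ht]; ring
    rw [this]
    refine (abs_add_le _ _).trans ?_
    rw [abs_mul, abs_mul]
    have e1 : |w.1 + w'.1| ≤ 5 := abs_le.2 ⟨by linarith, by linarith⟩
    have e2 : |w.2 + w'.2| ≤ 5 := abs_le.2 ⟨by linarith, by linarith⟩
    have := mul_le_mul h.1 e1 (abs_nonneg _) hε
    have := mul_le_mul h.2 e2 (abs_nonneg _) hε
    linarith
  have hs8 : s ≤ 8 := by nlinarith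
  have hs0 : 0 ≤ s := by positivity
  have ht0 : 0 ≤ t := by positivity
  have hq : s * (4 - s) - t * (4 - t) = (s - t) * (4 - s - t) := by ring
  have ht18 : t ≤ 18 := by
    have := (abs_le.1 hst).1
    linarith
  rw [hq, abs_mul]
  have : |4 - s - t| ≤ 22 := abs_le.2 ⟨by linarith, by linarith⟩
  have := mul_le_mul hst this (abs_nonneg _) (by positivity)
  linarith

end JacobianKernel

section CircleDifference

variable {f g : ℝ × ℝ → ℝ}

lemma jacKernel_smul_circ (η r θ : ℝ) :
    jacKernel η (r • circ θ) = jacProfile η (r ^ 2 * (4 - r ^ 2)) := by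
  have : (r • circ θ).1 ^ 2 + (r • circ θ).2 ^ 2 = r ^ 2 := by
    simp only [circ, Prod.smul_fst, Prod.smul_snd, smul_eq_mul]
    nlinarith [Real.sin_sq_add_cos_sq θ]
  rw [jacKernel, this]

/-- The fraction of the difference measure captured by `jacKernel`. -/
noncomputable def jacRatio (η α : ℝ) : ℝ :=
  (4 * Real.sin α * Real.cos α) ^ 2 / ((4 * Real.sin α * Real.cos α) ^ 2 + η)

lemma integral_polar {F : ℝ × ℝ → ℝ} (hF : Nice F) :
    ∫ w, F w = 2 * Real.pi * ∫ r in Set.Ioi (0 : ℝ), r * ∫ θ, F (r • circ θ) ∂angle := by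
  have hpi := Real.pi_pos
  obtain ⟨C, hC⟩ := hF.bdd
  obtain ⟨R, hR⟩ := hF.supp
  have hC0 : 0 ≤ C := (abs_nonneg _).trans (hC 0)
  rw [← integral_comp_polarCoord_symm]
  have e1 : ∀ p : ℝ × ℝ, p.1 • F (polarCoord.symm p) = p.1 * F (p.1 • circ p.2) := by
    intro p
    simp [circ, polarCoord]
  simp_rw [e1]
  rw [polarCoord_target]
  have hm : Measurable fun p : ℝ × ℝ => p.1 * F (p.1 • circ p.2) :=
    measurable_fst.mul (hF.meas.comp (measurable_fst.smul (measurable_circ.comp measurable_snd)))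
  have hcs : ∀ r θ : ℝ, F (r • circ θ) ≠ 0 → |r| ≤ 2 * R := by
    intro r θ h
    have h1 := hR _ h
    rw [Prod.norm_def, max_le_iff] at h1
    simp only [circ, Prod.smul_fst, Prod.smul_snd, smul_eq_mul, Real.norm_eq_abs] at h1
    have hR0 : 0 ≤ R := (abs_nonneg _).trans h1.1
    have h2 := sq_le_sq' (abs_le.1 h1.1).1 (abs_le.1 h1.1).2
    have h3 := sq_le_sq' (abs_le.1 h1.2).1 (abs_le.1 h1.2).2
    refine abs_le_of_sq_le_sq ?_ (by positivity)
    nlinarith [Real.sin_sq_add_cos_sq θ]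
  rw [Measure.volume_eq_prod, setIntegral_prod]
  · rw [← integral_const_mul]
    refine setIntegral_congr_fun measurableSet_Ioi fun r hr => ?_
    simp only
    rw [integral_const_mul, integral_angle, intervalIntegral.integral_of_le (by linarith),
      integral_Ioc_eq_integral_Ioo]
    field_simp
  · rw [IntegrableOn, ← Measure.prod_restrict]
    have : IsFiniteMeasure (volume.restrict (Set.Ioo (-Real.pi) Real.pi)) :=
      ⟨by simp⟩
    refine integrable_of_bdd_supp hm (C := 2 * R * C ⊔ 0) (R := 2 * R) (fun p => ?_) fun p hp => ?_
    · by_cases h : F (p.1 • circ p.2) = 0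
      · simp [h]
      · rw [abs_mul]
        exact (mul_le_mul (hcs _ _ h) (hC _) (abs_nonneg _) ((abs_nonneg _).trans (hcs _ _ h))).trans
          (le_max_left _ _)
    · exact hcs _ _ (right_ne_zero_of_mul hp)

lemma integral_jacKernel_mul_corr (hg : Nice g) {η : ℝ} (hη : 0 < η) :
    ∫ w, jacKernel η w * corr g w =
      2 * Real.pi * ∫ α in (0 : ℝ)..(Real.pi / 2), jacRatio η α * radCorr g (2 * Real.sin α) := by
  have hpi := Real.pi_pos
  rw [integral_polar ((nice_jacKernel hη).mul_bdd (measurable_corr hg) (abs_corr_le hg))]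
  simp_rw [jacKernel_smul_circ, integral_const_mul]
  congr 1
  change ∫ r in Set.Ioi 0, r * (jacProfile η (r ^ 2 * (4 - r ^ 2)) * radCorr g r) = _
  have h1 : ∫ r in Set.Ioi 0, r * (jacProfile η (r ^ 2 * (4 - r ^ 2)) * radCorr g r) =
      ∫ r in Set.Ioo 0 2, r * (jacProfile η (r ^ 2 * (4 - r ^ 2)) * radCorr g r) := by
    refine setIntegral_eq_of_subset_of_forall_sdiff_eq_zero measurableSet_Ioi
      Set.Ioo_subset_Ioi_self fun r hr => ?_
    have h0 : 0 < r := hr.1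
    have h2 : 2 ≤ r := by
      by_contra! h
      exact hr.2 ⟨h0, h⟩
    rw [jacProfile_of_nonpos (mul_nonpos_of_nonneg_of_nonpos (by positivity) (by nlinarith))]
    ring
  have himg : (fun α => 2 * Real.sin α) '' Set.Ioo 0 (Real.pi / 2) = Set.Ioo 0 2 := by
    ext r
    constructor
    · rintro ⟨α, ⟨ha, hb⟩, rfl⟩
      have h1 := Real.sin_pos_of_pos_of_lt_pi ha (by linarith)
      have h2 := Real.sin_lt_sin_of_lt_of_le_pi_div_two (by linarith) le_rfl hb
      rw [Real.sin_pi_div_two] at h2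
      exact ⟨by simpa using h1, by simpa using by linarith⟩
    · rintro ⟨h1, h2⟩
      refine ⟨Real.arcsin (r / 2), ⟨Real.arcsin_pos.2 (by linarith), ?_⟩, ?_⟩
      · rw [Real.arcsin_lt_pi_div_two]; linarith
      · simp only
        rw [Real.sin_arcsin (by linarith) (by linarith)]; ring
  have hinj : Set.InjOn (fun α => 2 * Real.sin α) (Set.Ioo 0 (Real.pi / 2)) := by
    intro a ha b hb hab
    refine Real.injOn_sin ⟨?_, ha.2.le⟩ ⟨?_, hb.2.le⟩ (by simpa using hab)
    · linarith [ha.1]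
    · linarith [hb.1]
  have h2 := integral_image_eq_integral_abs_deriv_smul (f := fun α => 2 * Real.sin α)
    (f' := fun α => 2 * Real.cos α) (s := Set.Ioo 0 (Real.pi / 2)) measurableSet_Ioo
    (fun α _ => ((Real.hasDerivAt_sin α).const_mul 2).hasDerivWithinAt) hinj
    (fun r => r * (jacProfile η (r ^ 2 * (4 - r ^ 2)) * radCorr g r))
  rw [himg] at h2
  rw [h1, h2, intervalIntegral.integral_of_le (by linarith), integral_Ioc_eq_integral_Ioo]
  refine setIntegral_congr_fun measurableSet_Ioo fun α hα => ?_
  have hs := Real.sin_pos_of_pos_of_lt_pi hα.1 (by linarith [hα.2])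
  have hc := Real.cos_pos_of_mem_Ioo ⟨by linarith [hα.1], hα.2⟩
  have hq : (2 * Real.sin α) ^ 2 * (4 - (2 * Real.sin α) ^ 2) =
      (4 * Real.sin α * Real.cos α) ^ 2 := by
    have := Real.sin_sq_add_cos_sq α
    have h3 : Real.cos α ^ 2 = 1 - Real.sin α ^ 2 := by linarith
    rw [mul_pow (4 * Real.sin α), h3]; ring
  simp only [smul_eq_mul]
  rw [abs_of_pos (by positivity), jacProfile, hq, Real.sqrt_sq (by positivity), jacRatio]
  ring

lemma integral_one_sub_jacRatio_le {t : ℝ} (ht : 0 < t) (ht1 : t ≤ 1 / 2) :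
    ∫ α in (0 : ℝ)..(Real.pi / 2), |1 - jacRatio (t ^ 3) α| ≤ 4 * t := by
  have hpi := Real.pi_pos
  have hpi3 := Real.pi_gt_three
  have hpi4 := Real.pi_le_four
  have hnn : ∀ α, |1 - jacRatio (t ^ 3) α| =
      t ^ 3 / ((4 * Real.sin α * Real.cos α) ^ 2 + t ^ 3) := by
    intro α
    rw [jacRatio, one_sub_div (by positivity), add_sub_cancel_left, abs_of_nonneg (by positivity)]
  have hle1 : ∀ α, |1 - jacRatio (t ^ 3) α| ≤ 1 := by
    intro α
    rw [hnn]
    exact div_le_one_of_le₀ (by nlinarith [sq_nonneg (4 * Real.sin α * Real.cos α)]) (by positivity)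
  have hm : Measurable fun α => |1 - jacRatio (t ^ 3) α| := by
    unfold jacRatio; fun_prop
  have hii : ∀ a b, IntervalIntegrable (fun α => |1 - jacRatio (t ^ 3) α|) volume a b := by
    intro a b
    rw [intervalIntegrable_iff]
    refine Measure.integrableOn_of_bounded (M := 1) (by simp) hm.aestronglyMeasurable
      (Filter.Eventually.of_forall fun _ => ?_)
    rw [Real.norm_eq_abs, abs_abs]
    exact hle1 _
  have hbd : ∀ a b c : ℝ, a ≤ b → (∀ α ∈ Set.Icc a b, |1 - jacRatio (t ^ 3) α| ≤ c) →
      ∫ α in a..b, |1 - jacRatio (t ^ 3) α| ≤ (b - a) * c := by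
    intro a b c hab h
    have := intervalIntegral.integral_mono_on hab (hii a b) (intervalIntegrable_const (c := c)) h
    simpa using this
  rw [← intervalIntegral.integral_add_adjacent_intervals (hii 0 t) (hii t _),
    ← intervalIntegral.integral_add_adjacent_intervals (hii t (Real.pi / 2 - t)) (hii _ _)]
  have h1 := hbd 0 t 1 ht.le fun α _ => hle1 α
  have h2 := hbd (Real.pi / 2 - t) (Real.pi / 2) 1 (by linarith) fun α _ => hle1 α
  have h3 := hbd t (Real.pi / 2 - t) (t / 2) (by linarith) fun α hα => by
    rw [hnn]
    have h4 : t ≤ Real.sin (2 * α) := by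
      have key : ∀ x, t ≤ x → x ≤ Real.pi / 4 → t ≤ Real.sin (2 * x) := by
        intro x hx hx2
        have := Real.mul_le_sin (x := 2 * x) (by linarith) (by linarith)
        refine le_trans ?_ this
        rw [div_mul_eq_mul_div, le_div_iff₀ hpi]
        nlinarith
      rcases le_total α (Real.pi / 4) with h | h
      · exact key α hα.1 h
      · have := key (Real.pi / 2 - α) (by linarith [hα.2]) (by linarith)
        rwa [show 2 * (Real.pi / 2 - α) = Real.pi - 2 * α by ring, Real.sin_pi_sub] at this
    rw [show 4 * Real.sin α * Real.cos α = 2 * Real.sin (2 * α) by rw [Real.sin_two_mul]; ring,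
      div_le_div_iff₀ (by positivity) (by norm_num)]
    have : t ^ 2 ≤ Real.sin (2 * α) ^ 2 := by gcongr
    nlinarith [mul_le_mul_of_nonneg_left this ht.le, pow_pos ht 3, pow_pos ht 4]
  nlinarith

end CircleDifference

section Martingale

variable {f g K : ℝ × ℝ → ℝ}

lemma abs_dyadicMean_sub_le {n : ℤ} {x : ℝ × ℝ} {c δ : ℝ} (hf : Nice f)
    (h : ∀ y ∈ cell n x, |f y - c| ≤ δ) : |dyadicMean n f x - c| ≤ δ := by
  have h4 : (0 : ℝ) < (4 : ℝ) ^ n := by positivity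
  have hfin : volume (cell n x) < ∞ := by rw [volume_cell]; exact ENNReal.ofReal_lt_top
  have hr : volume.real (cell n x) = 4 ^ n := by
    rw [Measure.real, volume_cell, ENNReal.toReal_ofReal h4.le]
  have := norm_setIntegral_le_of_norm_le_const (μ := volume) (s := cell n x)
    (f := fun y => f y - c) (C := δ) hfin h
  rw [integral_sub hf.integrable.integrableOn (integrableOn_const (hs := hfin.ne)),
    setIntegral_const, hr, Real.norm_eq_abs, smul_eq_mul] at this
  have e : dyadicMean n f x - c = (4 ^ n)⁻¹ * ((∫ y in cell n x, f y) - 4 ^ n * c) := by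
    rw [dyadicMean]; field_simp
  rw [e, abs_mul, abs_of_pos (inv_pos.2 h4), inv_mul_le_iff₀ h4, mul_comm ((4 : ℝ) ^ n) δ]
  exact this

lemma integral_mul_corr (hK : Nice K) (hg : Nice g) :
    ∫ w, K w * corr g w = ∫ y, g y * ∫ z, K (z - y) * g z := by
  obtain ⟨C, hC⟩ := hg.bdd
  have hFint : Integrable (fun p : (ℝ × ℝ) × (ℝ × ℝ) => g (p.2 + p.1) * (K p.1 * g p.2))
      (volume.prod volume) :=
    (hK.integrable.mul_prod hg.integrable).bdd_mul (c := C)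
      (hg.meas.comp (measurable_snd.add measurable_fst)).aestronglyMeasurable
      (Filter.Eventually.of_forall fun _ => hC _)
  calc ∫ w, K w * corr g w = ∫ w, ∫ y, g (y + w) * (K w * g y) := by
        congr 1; ext w
        rw [corr, ← integral_const_mul]
        congr 1; ext y; ring
    _ = ∫ y, ∫ w, g (y + w) * (K w * g y) := integral_integral_swap hFint
    _ = ∫ y, g y * ∫ z, K (z - y) * g z := by
        congr 1; ext y
        rw [← integral_const_mul,
          ← integral_add_right_eq_self (μ := (volume : Measure (ℝ × ℝ)))
            (fun z => g y * (K (z - y) * g z)) y]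
        congr 1; ext w
        rw [add_sub_cancel_right, add_comm w y]; ring

lemma measurable_conv (hK : Nice K) (hg : Nice g) :
    Measurable fun y => ∫ z, K (z - y) * g z := by
  have : Measurable fun p : (ℝ × ℝ) × (ℝ × ℝ) => K (p.2 - p.1) * g p.2 :=
    (hK.meas.comp (measurable_snd.sub measurable_fst)).mul (hg.meas.comp measurable_snd)
  exact this.stronglyMeasurable.integral_prod_right'.measurable

lemma exists_abs_conv_le (hK : Nice K) (hg : Nice g) :
    ∃ C, ∀ y, |∫ z, K (z - y) * g z| ≤ C := by
  obtain ⟨C, hC⟩ := hK.bdd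
  refine ⟨∫ z, C * |g z|, fun y => (abs_integral_le_integral_abs).trans ?_⟩
  have hn := hg.mul_bdd (g := fun z => K (z - y)) (hK.meas.comp (by fun_prop)) (fun _ => hC _)
  refine integral_mono (by simpa [mul_comm] using hn.abs.integrable)
    (hg.abs.integrable.const_mul C) fun z => ?_
  simp only [abs_mul]
  exact mul_le_mul_of_nonneg_right (hC _) (abs_nonneg _)

lemma abs_integral_jacKernel_mul_corr_le (hg : Nice g) {η : ℝ} (hη : 0 < η) {n : ℤ}
    (hn : (2 : ℝ) ^ n ≤ 1) (hg0 : ∀ x, dyadicMean n g x = 0) :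
    |∫ w, jacKernel η w * corr g w| ≤ √(220 * 2 ^ n) / η * (36 * ∫ y, g y ^ 2) := by
  set δ := √(220 * 2 ^ n) / η with hδ
  have hδ0 : 0 ≤ δ := by positivity
  have hK := nice_jacKernel hη
  set B : Set (ℝ × ℝ) := Metric.closedBall 0 3 with hB
  have hBm : MeasurableSet B := Metric.isClosed_closedBall.measurableSet
  have hBv : volume.real B = 36 := by
    have h36 : (3 : ℝ) + 3 = 6 := by norm_num
    rw [hB, ← Prod.mk_zero_zero, ← closedBall_prod_same, Measure.volume_eq_prod, measureReal_def,
      Measure.prod_prod, Real.volume_closedBall, ← ENNReal.ofReal_mul (by norm_num)]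
    norm_num
  have hL : Nice (B.indicator fun _ => (1 : ℝ)) := by
    refine ⟨measurable_const.indicator hBm, ⟨1, fun x => ?_⟩, ⟨3, fun x hx => ?_⟩⟩
    · by_cases h : x ∈ B <;> simp [h]
    · by_contra hc
      exact hx (Set.indicator_of_notMem (by simpa [hB] using hc) _)
  have hV : ∀ y, |∫ z, jacKernel η (z - y) * g z| ≤
      δ * ∫ z, B.indicator (fun _ => (1 : ℝ)) (z - y) * |g z| := by
    intro y
    have hKy : Nice fun z => jacKernel η (z - y) := by
      simpa [sub_eq_add_neg] using hK.comp_add (-y)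
    have hLy : Nice fun z => B.indicator (fun _ => (1 : ℝ)) (z - y) := by
      simpa [sub_eq_add_neg] using hL.comp_add (-y)
    have hE := hKy.dyadicMean n
    have h0 : ∫ z, dyadicMean n (fun z => jacKernel η (z - y)) z * g z = 0 := by
      obtain ⟨C, hC⟩ := hE.bdd
      have := integral_dyadicMean_mul (n := n) (f := g)
        (h := dyadicMean n (fun z => jacKernel η (z - y))) hg
        (fun a b hab => dyadicMean_congr hab) hC
      simp only [hg0, zero_mul, integral_zero] at this
      rw [this]
      congr 1; ext z; ring
    have h1 : ∫ z, jacKernel η (z - y) * g z =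
        ∫ z, (jacKernel η (z - y) - dyadicMean n (fun z => jacKernel η (z - y)) z) * g z := by
      simp_rw [sub_mul]
      rw [integral_sub (hKy.mul hg).integrable (hE.mul hg).integrable, h0, sub_zero]
    rw [h1, ← integral_const_mul]
    refine (abs_integral_le_integral_abs).trans (integral_mono
      ((hKy.sub hE).mul hg).abs.integrable ((hLy.mul hg.abs).integrable.const_mul δ) fun z => ?_)
    simp only [abs_mul]
    rw [← mul_assoc]
    refine mul_le_mul_of_nonneg_right ?_ (abs_nonneg _)
    have hdiff : ∀ u, idx n u = idx n z →
        |jacKernel η (u - y) - jacKernel η (z - y)| ≤ δ := by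
      intro u hu
      refine abs_jacKernel_sub_le hη (by positivity) hn ?_
      rw [sub_sub_sub_cancel_right]
      exact norm_sub_le_of_idx_eq hu
    by_cases hz : z - y ∈ B
    · rw [Set.indicator_of_mem hz, mul_one, abs_sub_comm]
      exact abs_dyadicMean_sub_le hKy fun u hu => hdiff u hu
    · have hz3 : 3 < ‖z - y‖ := by simpa [hB] using hz
      have hzero : ∀ u, idx n u = idx n z → jacKernel η (u - y) = 0 := by
        intro u hu
        by_contra hne
        have h2 := jacKernel_supp hne
        have h3 := norm_sub_le_of_idx_eq hu.symm
        have h4 := norm_add_le (z - u) (u - y)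
        rw [sub_add_sub_cancel] at h4
        linarith
      rw [Set.indicator_of_notMem hz, mul_zero, hzero z rfl, zero_sub, abs_neg]
      have := abs_dyadicMean_sub_le (n := n) (x := z) (c := 0) (δ := 0) hKy fun u hu => by
        rw [hzero u hu, sub_zero, abs_zero]
      simpa using this
  obtain ⟨C1, hC1⟩ := exists_abs_conv_le hK hg
  obtain ⟨C2, hC2⟩ := exists_abs_conv_le hL hg.abs
  rw [integral_mul_corr hK hg]
  calc |∫ y, g y * ∫ z, jacKernel η (z - y) * g z|
      ≤ ∫ y, |g y * ∫ z, jacKernel η (z - y) * g z| := abs_integral_le_integral_abs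
    _ ≤ ∫ y, δ * (|g y| * ∫ z, B.indicator (fun _ => (1 : ℝ)) (z - y) * |g z|) := by
        refine integral_mono (hg.mul_bdd (measurable_conv hK hg) hC1).abs.integrable
          ((hg.abs.mul_bdd (measurable_conv hL hg.abs) hC2).integrable.const_mul δ) fun y => ?_
        simp only [abs_mul]
        nlinarith [mul_le_mul_of_nonneg_left (hV y) (abs_nonneg (g y))]
    _ = δ * ∫ w, B.indicator (fun _ => (1 : ℝ)) w * corr (fun y => |g y|) w := by
        rw [integral_const_mul, integral_mul_corr hL hg.abs]
    _ ≤ δ * ∫ w, B.indicator (fun _ => ∫ y, g y ^ 2) w := by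
        refine mul_le_mul_of_nonneg_left (integral_mono ?_ ?_ fun w => ?_) hδ0
        · exact (hL.mul_bdd (measurable_corr hg.abs) (abs_corr_le hg.abs)).integrable
        · exact (integrable_indicator_iff hBm).2
            (integrableOn_const (hs := (isCompact_closedBall _ _).measure_lt_top.ne))
        · by_cases hw : w ∈ B
          · have := (le_abs_self _).trans (abs_corr_le hg.abs w)
            simpa [hw] using this
          · simp [hw]
    _ = δ * (36 * ∫ y, g y ^ 2) := by
        rw [integral_indicator hBm, setIntegral_const, hBv, smul_eq_mul]

/-- Quantitative smoothing of circular means at unit scale. -/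
lemma integral_circMean_one_sq_le (hg : Nice g) {s : ℕ} {t : ℝ} (ht : 0 < t) (ht1 : t ≤ 1 / 2)
    (hts : (2 : ℝ) ^ (-(s : ℤ)) ≤ t ^ 8) (hg0 : ∀ x, dyadicMean (-(s : ℤ)) g x = 0) :
    ∫ x, circMean 1 g x ^ 2 ≤ 200 * t * ∫ x, g x ^ 2 := by
  have hpi := Real.pi_pos
  have hpi3 := Real.pi_gt_three
  set N := ∫ x, g x ^ 2 with hN
  have hN0 : 0 ≤ N := integral_nonneg fun x => sq_nonneg _
  have hη : 0 < t ^ 3 := by positivity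
  rw [integral_circMean_sq hg, integral_angle_radCorr hg]
  have hmR : Measurable fun α => radCorr g (2 * Real.sin α) :=
    (measurable_radCorr hg).comp (by fun_prop)
  have hmJ : Measurable (jacRatio (t ^ 3)) := by unfold jacRatio; fun_prop
  have hJ : ∀ α, 0 ≤ jacRatio (t ^ 3) α ∧ jacRatio (t ^ 3) α ≤ 1 := by
    intro α
    unfold jacRatio
    exact ⟨by positivity, div_le_one_of_le₀ (by linarith) (by positivity)⟩
  have hJ' : ∀ α, |1 - jacRatio (t ^ 3) α| ≤ 1 := fun α =>
    abs_le.2 ⟨by linarith [(hJ α).2], by linarith [(hJ α).1]⟩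
  have hii : ∀ F : ℝ → ℝ, Measurable F → (∃ C, ∀ x, |F x| ≤ C) →
      IntervalIntegrable F volume 0 (Real.pi / 2) := by
    rintro F hF ⟨C, hC⟩
    rw [intervalIntegrable_iff]
    exact Measure.integrableOn_of_bounded (M := C) (by simp) hF.aestronglyMeasurable
      (Filter.Eventually.of_forall fun _ => hC _)
  have hR : ∀ α, |radCorr g (2 * Real.sin α)| ≤ N := fun α => abs_radCorr_le hg _
  have i1 := hii (fun α => jacRatio (t ^ 3) α * radCorr g (2 * Real.sin α)) (hmJ.mul hmR)
    ⟨1 * N, fun α => by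
      rw [abs_mul, abs_of_nonneg (hJ α).1]
      exact mul_le_mul (hJ α).2 (hR α) (abs_nonneg _) zero_le_one⟩
  have i2 := hii (fun α => (1 - jacRatio (t ^ 3) α) * radCorr g (2 * Real.sin α))
    ((measurable_const.sub hmJ).mul hmR)
    ⟨1 * N, fun α => by
      rw [abs_mul]
      exact mul_le_mul (hJ' α) (hR α) (abs_nonneg _) zero_le_one⟩
  have i3 := hii (fun α => |1 - jacRatio (t ^ 3) α| * N)
    ((measurable_const.sub hmJ).abs.mul_const _)
    ⟨1 * N, fun α => by
      rw [abs_mul, abs_abs, abs_of_nonneg hN0]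
      exact mul_le_mul_of_nonneg_right (hJ' α) hN0⟩
  have hsplit : ∫ α in (0 : ℝ)..(Real.pi / 2), radCorr g (2 * Real.sin α) =
      (∫ α in (0 : ℝ)..(Real.pi / 2), jacRatio (t ^ 3) α * radCorr g (2 * Real.sin α)) +
      ∫ α in (0 : ℝ)..(Real.pi / 2), (1 - jacRatio (t ^ 3) α) * radCorr g (2 * Real.sin α) := by
    rw [← intervalIntegral.integral_add i1 i2]
    congr 1; ext α; ring
  have hB : ∫ α in (0 : ℝ)..(Real.pi / 2), (1 - jacRatio (t ^ 3) α) * radCorr g (2 * Real.sin α) ≤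
      4 * t * N := by
    calc _ ≤ ∫ α in (0 : ℝ)..(Real.pi / 2), |1 - jacRatio (t ^ 3) α| * N := by
          refine intervalIntegral.integral_mono_on (by linarith) i2 i3 fun α _ => ?_
          refine (le_abs_self _).trans ?_
          rw [abs_mul]
          exact mul_le_mul_of_nonneg_left (hR α) (abs_nonneg _)
      _ = (∫ α in (0 : ℝ)..(Real.pi / 2), |1 - jacRatio (t ^ 3) α|) * N :=
          intervalIntegral.integral_mul_const _ _
      _ ≤ 4 * t * N := mul_le_mul_of_nonneg_right (integral_one_sub_jacRatio_le ht ht1) hN0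
  have hA := abs_integral_jacKernel_mul_corr_le hg hη
    (n := -(s : ℤ)) (hts.trans (pow_le_one₀ ht.le (by linarith))) hg0
  rw [integral_jacKernel_mul_corr hg hη] at hA
  have hsq : √(220 * 2 ^ (-(s : ℤ))) / t ^ 3 ≤ 15 * t := by
    rw [div_le_iff₀ hη, Real.sqrt_le_left (by positivity)]
    nlinarith
  set I := ∫ α in (0 : ℝ)..(Real.pi / 2), jacRatio (t ^ 3) α * radCorr g (2 * Real.sin α)
  have hA2 : 2 * Real.pi * I ≤ 15 * t * (36 * N) :=
    ((le_abs_self _).trans hA).trans (mul_le_mul_of_nonneg_right hsq (by positivity))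
  rw [hsplit, div_mul_eq_mul_div, div_le_iff₀ hpi]
  have hI : 6 * I ≤ 15 * t * (36 * N) := by
    rcases le_total 0 I with h | h
    · nlinarith
    · have : 0 ≤ 15 * t * (36 * N) := by positivity
      linarith
  have htN : 0 ≤ t * N := by positivity
  nlinarith

end Martingale

section Dilation

variable {f g : ℝ × ℝ → ℝ}

lemma Nice.comp_smul (hg : Nice g) {c : ℝ} (hc : 0 < c) : Nice (fun y => g (c • y)) := by
  obtain ⟨C, hC⟩ := hg.bdd
  obtain ⟨R, hR⟩ := hg.supp
  refine ⟨hg.meas.comp (by fun_prop), ⟨C, fun _ => hC _⟩, ⟨R / c, fun y hy => ?_⟩⟩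
  have h1 := hR _ hy
  rw [norm_smul, Real.norm_eq_abs, abs_of_pos hc] at h1
  rwa [le_div_iff₀ hc, mul_comm]

lemma integral_comp_smul_plane (f : ℝ × ℝ → ℝ) {c : ℝ} (hc : 0 < c) :
    ∫ x, f (c • x) = (c ^ 2)⁻¹ * ∫ x, f x := by
  have := Measure.integral_comp_smul (volume : Measure (ℝ × ℝ)) f c
  rw [this, Module.finrank_prod, Module.finrank_self, abs_of_pos (by positivity), smul_eq_mul]

lemma idx_smul (n j : ℤ) (x : ℝ × ℝ) : idx n ((2 : ℝ) ^ j • x) = idx (n - j) x := by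
  have h2 : (2 : ℝ) ≠ 0 := two_ne_zero
  simp only [idx, Prod.smul_fst, Prod.smul_snd, smul_eq_mul]
  rw [zpow_sub₀ h2]
  congr 2 <;> field_simp

lemma dyadicMean_comp_smul (n j : ℤ) (f : ℝ × ℝ → ℝ) (x : ℝ × ℝ) :
    dyadicMean (n - j) (fun y => f ((2 : ℝ) ^ j • y)) x = dyadicMean n f ((2 : ℝ) ^ j • x) := by
  have h2 : (0 : ℝ) < (2 : ℝ) ^ j := by positivity
  rw [dyadicMean, dyadicMean, ← integral_indicator (measurableSet_cell _ _),
    ← integral_indicator (measurableSet_cell _ _)]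
  have : (cell (n - j) x).indicator (fun y => f ((2 : ℝ) ^ j • y)) =
      fun y => (cell n ((2 : ℝ) ^ j • x)).indicator f ((2 : ℝ) ^ j • y) := by
    ext y
    simp only [Set.indicator, cell, Set.mem_ofPred_eq, idx_smul]
    congr
  rw [this, integral_comp_smul_plane _ h2, ← mul_assoc]
  congr 1
  rw [zpow_sub₀ (by norm_num), ← zpow_natCast, ← zpow_mul, mul_comm j, zpow_mul]
  norm_num
  field_simp

/-- Quantitative smoothing of circular means at dyadic scales. -/
lemma integral_circMean_sq_le (hg : Nice g) (j : ℤ) {s : ℕ} {t : ℝ} (ht : 0 < t) (ht1 : t ≤ 1 / 2)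
    (hts : (2 : ℝ) ^ (-(s : ℤ)) ≤ t ^ 8) (hg0 : ∀ x, dyadicMean (j - s) g x = 0) :
    ∫ x, circMean (2 ^ j) g x ^ 2 ≤ 200 * t * ∫ x, g x ^ 2 := by
  have h2 : (0 : ℝ) < (2 : ℝ) ^ j := by positivity
  have := integral_circMean_one_sq_le (hg.comp_smul h2) ht ht1 hts fun x => by
    have h := dyadicMean_comp_smul (j - s) j g x
    rw [sub_sub_cancel_left] at h
    rw [h, hg0]
  simp_rw [circMean_comp_smul, mul_one] at this
  rw [integral_comp_smul_plane (fun x => circMean (2 ^ j) g x ^ 2) h2,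
    integral_comp_smul_plane (fun x => g x ^ 2) h2, mul_left_comm] at this
  exact le_of_mul_le_mul_left this (by positivity)

end Dilation

section StoppingSets

variable {f g : ℝ × ℝ → ℝ}

lemma Nice.rpow (hf : Nice f) (hf0 : ∀ x, 0 ≤ f x) {q : ℝ} (hq : 0 < q) :
    Nice (fun x => f x ^ q) := by
  obtain ⟨C, hC⟩ := hf.bdd
  obtain ⟨R, hR⟩ := hf.supp
  refine ⟨hf.meas.pow_const q, ⟨C ^ q, fun x => ?_⟩, ⟨R, fun x hx => hR x fun h => hx ?_⟩⟩
  · rw [abs_of_nonneg (Real.rpow_nonneg (hf0 x) q)]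
    exact Real.rpow_le_rpow (hf0 x) ((le_abs_self _).trans (hC x)) hq.le
  · rw [h, Real.zero_rpow hq.ne']

lemma dyadicMean_nonneg (hf0 : ∀ x, 0 ≤ f x) (n : ℤ) (x : ℝ × ℝ) : 0 ≤ dyadicMean n f x :=
  mul_nonneg (by positivity) (integral_nonneg hf0)

lemma dyadicMean_le_integral (hf : Nice f) (hf0 : ∀ x, 0 ≤ f x) (n : ℤ) (x : ℝ × ℝ) :
    dyadicMean n f x ≤ ((4 : ℝ) ^ n)⁻¹ * ∫ x, f x :=
  mul_le_mul_of_nonneg_left (setIntegral_le_integral hf.integrable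
    (Filter.Eventually.of_forall hf0)) (by positivity)

lemma dyadicMean_le_four_mul (hf : Nice f) (hf0 : ∀ x, 0 ≤ f x) (n : ℤ) (x : ℝ × ℝ) :
    dyadicMean n f x ≤ 4 * dyadicMean (n + 1) f x := by
  have h : ∫ y in cell n x, f y ≤ ∫ y in cell (n + 1) x, f y :=
    setIntegral_mono_set hf.integrable.integrableOn
      (Filter.Eventually.of_forall hf0)
      (Filter.Eventually.of_forall fun y hy => idx_refine (by omega) hy)
  rw [dyadicMean, dyadicMean, zpow_add₀ (by norm_num), zpow_one, mul_inv, ← mul_assoc, mul_comm 4,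
    mul_assoc _ _ (4 : ℝ), inv_mul_cancel₀ (by norm_num), mul_one]
  exact mul_le_mul_of_nonneg_left h (by positivity)

/-- The union of the stopping squares of side `2 ^ n` at height `h`. -/
def stopSet (f : ℝ × ℝ → ℝ) (h : ℝ) (n : ℤ) : Set (ℝ × ℝ) :=
  {x | h < dyadicMean n f x ∧ ∀ m, n < m → dyadicMean m f x ≤ h}

lemma mem_stopSet_congr {h : ℝ} {n : ℤ} {x y : ℝ × ℝ} (hxy : idx n x = idx n y) :
    x ∈ stopSet f h n ↔ y ∈ stopSet f h n := by
  have : ∀ m, n ≤ m → dyadicMean m f x = dyadicMean m f y := fun m hm =>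
    dyadicMean_congr (idx_refine hm hxy)
  constructor
  · rintro ⟨h1, h2⟩
    exact ⟨by rwa [← this n le_rfl], fun m hm => by rw [← this m hm.le]; exact h2 m hm⟩
  · rintro ⟨h1, h2⟩
    exact ⟨by rwa [this n le_rfl], fun m hm => by rw [this m hm.le]; exact h2 m hm⟩

lemma indicator_stopSet_congr {h : ℝ} {n : ℤ} (x y : ℝ × ℝ) (hxy : idx n x = idx n y) :
    (stopSet f h n).indicator (fun _ => (1 : ℝ)) x =
      (stopSet f h n).indicator (fun _ => (1 : ℝ)) y := by
  have := mem_stopSet_congr (f := f) (h := h) hxy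
  by_cases hx : x ∈ stopSet f h n
  · rw [Set.indicator_of_mem hx, Set.indicator_of_mem (this.1 hx)]
  · rw [Set.indicator_of_notMem hx, Set.indicator_of_notMem (fun hy => hx (this.2 hy))]

lemma measurableSet_stopSet (h : ℝ) (n : ℤ) : MeasurableSet (stopSet f h n) := by
  have := measurable_of_idx (indicator_stopSet_congr (f := f) (h := h) (n := n))
  exact (measurable_indicator_const_iff (1 : ℝ)).1 this

lemma stopSet_disjoint {h : ℝ} {m n : ℤ} {x : ℝ × ℝ} (hm : x ∈ stopSet f h m)
    (hn : x ∈ stopSet f h n) : m = n := by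
  rcases lt_trichotomy m n with h1 | h1 | h1
  · exact absurd hn.1 (not_lt.2 (hm.2 n h1))
  · exact h1
  · exact absurd hm.1 (not_lt.2 (hn.2 m h1))

lemma nice_indicator_stopSet (hf : Nice f) {h : ℝ} (hh : 0 < h) (n : ℤ) :
    Nice ((stopSet f h n).indicator fun _ => (1 : ℝ)) := by
  obtain ⟨R, hR⟩ := (hf.dyadicMean n).supp
  refine ⟨measurable_const.indicator (measurableSet_stopSet h n), ⟨1, fun x => ?_⟩,
    ⟨R, fun x hx => ?_⟩⟩
  · by_cases hx : x ∈ stopSet f h n <;> simp [hx]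
  · have hx' : x ∈ stopSet f h n := by
      by_contra hc
      exact hx (Set.indicator_of_notMem hc _)
    exact hR x (hh.trans hx'.1).ne'

lemma integral_indicator_stopSet (h : ℝ) (n : ℤ) :
    ∫ x, (stopSet f h n).indicator (fun _ => (1 : ℝ)) x = volume.real (stopSet f h n) := by
  rw [integral_indicator (measurableSet_stopSet h n), setIntegral_const, smul_eq_mul, mul_one]

lemma volume_stopSet_lt_top (hf : Nice f) {h : ℝ} (hh : 0 < h) (n : ℤ) :
    volume (stopSet f h n) < ∞ := by
  obtain ⟨R, hR⟩ := (nice_indicator_stopSet hf hh n).supp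
  refine (measure_mono (fun x hx => ?_)).trans_lt
    (isCompact_closedBall (0 : ℝ × ℝ) R).measure_lt_top
  have := hR x (by simp [hx])
  simpa using this

lemma exists_scale (hf : Nice f) (hf0 : ∀ x, 0 ≤ f x) {h : ℝ} (hh : 0 < h) :
    ∃ n₁ : ℤ, ∀ m, n₁ ≤ m → ∀ x, dyadicMean m f x ≤ h := by
  obtain ⟨k, hk⟩ := pow_unbounded_of_one_lt ((∫ x, f x) / h) (show (1 : ℝ) < 4 by norm_num)
  refine ⟨k, fun m hm x => (dyadicMean_le_integral hf hf0 m x).trans ?_⟩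
  rw [inv_mul_le_iff₀ (by positivity)]
  rw [div_lt_iff₀ hh, ← zpow_natCast] at hk
  have : (4 : ℝ) ^ (k : ℤ) ≤ 4 ^ m := zpow_le_zpow_right₀ (by norm_num) hm
  nlinarith

lemma exists_mem_stopSet {h : ℝ} {n₁ : ℤ} (hn₁ : ∀ m, n₁ ≤ m → ∀ x, dyadicMean m f x ≤ h)
    {m : ℤ} {x : ℝ × ℝ} (hx : h < dyadicMean m f x) :
    ∃ n, m ≤ n ∧ n < n₁ ∧ x ∈ stopSet f h n := by
  have hlt : ∀ k, h < dyadicMean k f x → k < n₁ := fun k hk => by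
    by_contra! hc
    exact absurd hk (not_lt.2 (hn₁ k hc x))
  obtain ⟨n, hn, hmax⟩ := Int.exists_greatest_of_bdd (P := fun k => h < dyadicMean k f x)
    ⟨n₁, fun k hk => (hlt k hk).le⟩ ⟨m, hx⟩
  exact ⟨n, hmax m hx, hlt n hn, hn, fun k hk => by
    by_contra! hc
    exact absurd (hmax k hc) (not_le.2 hk)⟩

lemma dyadicMean_le_of_mem_stopSet (hf : Nice f) (hf0 : ∀ x, 0 ≤ f x) {h : ℝ} {n : ℤ} {x : ℝ × ℝ}
    (hx : x ∈ stopSet f h n) : dyadicMean n f x ≤ 4 * h := by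
  have := dyadicMean_le_four_mul hf hf0 n x
  linarith [hx.2 (n + 1) (by omega)]

lemma sum_indicator_stopSet_le (I : Finset ℤ) (h : ℝ) {φ : ℝ × ℝ → ℝ} (hφ : ∀ x, 0 ≤ φ x)
    (x : ℝ × ℝ) :
    ∑ n ∈ I, (stopSet f h n).indicator (fun _ => (1 : ℝ)) x * φ x ≤ φ x := by
  by_cases hx : ∃ n ∈ I, x ∈ stopSet f h n
  · obtain ⟨n, hn, hx⟩ := hx
    rw [Finset.sum_eq_single_of_mem n hn fun m _ hmn => by
      rw [Set.indicator_of_notMem (fun hm => hmn (stopSet_disjoint hm hx)), zero_mul]]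
    simp [hx]
  · push Not at hx
    rw [Finset.sum_eq_zero fun n hn => by rw [Set.indicator_of_notMem (hx n hn), zero_mul]]
    exact hφ x

/-- Chebyshev-type estimate for the stopping squares. -/
lemma sum_volume_stopSet_le (hf : Nice f) (hf0 : ∀ x, 0 ≤ f x) {h : ℝ} (hh : 0 < h) (I : Finset ℤ)
    {q : ℝ} (hq : 1 < q) (hq2 : q ≤ 2) :
    ∑ n ∈ I, volume.real (stopSet f h n) ≤ 4 * h ^ (-q) * ∫ x, f x ^ q := by
  have hfq := hf.rpow hf0 (show 0 < q by linarith)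
  have hpt : ∀ x, f x ≤ h / 2 + (h / 2) ^ (1 - q) * f x ^ q := by
    intro x
    have h2 : 0 < h / 2 := by linarith
    rcases le_total (f x) (h / 2) with hle | hle
    · have : 0 ≤ (h / 2) ^ (1 - q) * f x ^ q := by
        have := hf0 x
        positivity
      linarith
    · have hfx : 0 < f x := lt_of_lt_of_le h2 hle
      have h3 : f x ^ (1 - q) ≤ (h / 2) ^ (1 - q) :=
        Real.rpow_le_rpow_of_nonpos h2 hle (by linarith)
      have h4 : f x = f x ^ (1 - q) * f x ^ q := by
        rw [← Real.rpow_add hfx]; simp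
      have := mul_le_mul_of_nonneg_right h3 (Real.rpow_nonneg hfx.le q)
      rw [← h4] at this
      linarith
  have hind := fun n => nice_indicator_stopSet hf hh n
  have h1 : ∀ n, h * volume.real (stopSet f h n) ≤ h / 2 * volume.real (stopSet f h n) +
      (h / 2) ^ (1 - q) * ∫ x, (stopSet f h n).indicator (fun _ => (1 : ℝ)) x * f x ^ q := by
    intro n
    rw [← integral_indicator_stopSet, ← integral_const_mul]
    calc ∫ x, h * (stopSet f h n).indicator (fun _ => (1 : ℝ)) x
        ≤ ∫ x, dyadicMean n f x * (stopSet f h n).indicator (fun _ => (1 : ℝ)) x := by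
          refine integral_mono ((hind n).integrable.const_mul h)
            ((hf.dyadicMean n).mul (hind n)).integrable fun x => ?_
          by_cases hx : x ∈ stopSet f h n
          · simpa [hx] using hx.1.le
          · simp [hx]
      _ = ∫ x, f x * (stopSet f h n).indicator (fun _ => (1 : ℝ)) x := by
          obtain ⟨C, hC⟩ := (hind n).bdd
          exact integral_dyadicMean_mul hf indicator_stopSet_congr hC
      _ ≤ ∫ x, (h / 2 * (stopSet f h n).indicator (fun _ => (1 : ℝ)) x +
          (h / 2) ^ (1 - q) * ((stopSet f h n).indicator (fun _ => (1 : ℝ)) x * f x ^ q)) := by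
          refine integral_mono (hf.mul (hind n)).integrable
            (((hind n).integrable.const_mul _).add
              (((hind n).mul hfq).integrable.const_mul _)) fun x => ?_
          by_cases hx : x ∈ stopSet f h n
          · simpa [hx] using hpt x
          · simp [hx]
      _ = _ := by
          rw [integral_add ((hind n).integrable.const_mul _)
              (((hind n).mul hfq).integrable.const_mul _), integral_const_mul, integral_const_mul]
  have h2 : ∑ n ∈ I, ∫ x, (stopSet f h n).indicator (fun _ => (1 : ℝ)) x * f x ^ q ≤
      ∫ x, f x ^ q := by
    rw [← integral_finsetSum _ fun n _ => ((hind n).mul hfq).integrable]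
    exact integral_mono (Nice.sum I fun n _ => (hind n).mul hfq).integrable hfq.integrable
      fun x => sum_indicator_stopSet_le I h (fun x => Real.rpow_nonneg (hf0 x) q) x
  have h3 := Finset.sum_le_sum fun n (_ : n ∈ I) => h1 n
  rw [Finset.sum_add_distrib, ← Finset.mul_sum, ← Finset.mul_sum, ← Finset.mul_sum] at h3
  have h4 := mul_le_mul_of_nonneg_left h2 (show 0 ≤ (h / 2) ^ (1 - q) by positivity)
  set V := ∑ n ∈ I, volume.real (stopSet f h n)
  have h5 : h / 2 * V ≤ (h / 2) ^ (1 - q) * ∫ x, f x ^ q := by linarith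
  have h6 : (h / 2) ^ (1 - q) = h / 2 * (2 ^ q * h ^ (-q)) := by
    rw [Real.rpow_sub (by positivity), Real.rpow_one, Real.div_rpow hh.le (by norm_num),
      Real.rpow_neg hh.le]
    field_simp
  rw [h6, mul_assoc] at h5
  have h7 := le_of_mul_le_mul_left h5 (by positivity)
  refine h7.trans (mul_le_mul_of_nonneg_right ?_
    (integral_nonneg fun x => Real.rpow_nonneg (hf0 x) q))
  refine mul_le_mul_of_nonneg_right ?_ (by positivity)
  calc (2 : ℝ) ^ q ≤ 2 ^ (2 : ℝ) := Real.rpow_le_rpow_of_exponent_le (by norm_num) hq2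
    _ = 4 := by norm_num

end StoppingSets

section StoppingParts

variable {f g : ℝ × ℝ → ℝ}

/-- The part of `f` carried by the stopping squares of side `2 ^ n`, with mean removed. -/
noncomputable def stopPart (f : ℝ × ℝ → ℝ) (h : ℝ) (n : ℤ) (x : ℝ × ℝ) : ℝ :=
  (f x - dyadicMean n f x) * (stopSet f h n).indicator (fun _ => (1 : ℝ)) x

/-- The good part of the Calderón–Zygmund decomposition. -/
noncomputable def goodPart (f : ℝ × ℝ → ℝ) (h : ℝ) (I : Finset ℤ) (x : ℝ × ℝ) : ℝ :=
  f x - ∑ n ∈ I, stopPart f h n x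

/-- The enlarged stopping set. -/
def stopNhd (f : ℝ × ℝ → ℝ) (h : ℝ) (I : Finset ℤ) : Set (ℝ × ℝ) :=
  {x | ∃ n ∈ I, ∃ y ∈ stopSet f h n, ‖x - y‖ ≤ (2 : ℝ) ^ n}

lemma nice_stopPart (hf : Nice f) {h : ℝ} (hh : 0 < h) (n : ℤ) : Nice (stopPart f h n) :=
  (hf.sub (hf.dyadicMean n)).mul (nice_indicator_stopSet hf hh n)

lemma nice_goodPart (hf : Nice f) {h : ℝ} (hh : 0 < h) (I : Finset ℤ) : Nice (goodPart f h I) :=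
  hf.sub (Nice.sum I fun n _ => nice_stopPart hf hh n)

lemma dyadicMean_stopPart (hf : Nice f) (h : ℝ) (n : ℤ) (x : ℝ × ℝ) :
    dyadicMean n (stopPart f h n) x = 0 := by
  have := dyadicMean_of_idx (indicator_stopSet_congr (f := f) (h := h) (n := n))
    (fun y => f y - dyadicMean n f y) x
  rw [dyadicMean_sub n hf (hf.dyadicMean n), dyadicMean_dyadicMean_of_le le_rfl hf, sub_self,
    zero_mul] at this
  exact this

lemma stopPart_eq_zero {h : ℝ} {n : ℤ} {x : ℝ × ℝ} (hx : x ∉ stopSet f h n) :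
    stopPart f h n x = 0 := by
  rw [stopPart, Set.indicator_of_notMem hx, mul_zero]

lemma integral_abs_stopPart_le (hf : Nice f) (hf0 : ∀ x, 0 ≤ f x) {h : ℝ} (hh : 0 < h) (n : ℤ) :
    ∫ x, |stopPart f h n x| ≤ 8 * h * volume.real (stopSet f h n) := by
  have hind := nice_indicator_stopSet hf hh n
  obtain ⟨C, hC⟩ := hind.bdd
  have hE := hf.dyadicMean n
  have h1 := integral_dyadicMean_mul hf (indicator_stopSet_congr (f := f) (h := h) (n := n)) hC
  have h2 : ∫ x, dyadicMean n f x * (stopSet f h n).indicator (fun _ => (1 : ℝ)) x ≤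
      4 * h * volume.real (stopSet f h n) := by
    rw [← integral_indicator_stopSet, ← integral_const_mul]
    refine integral_mono (hE.mul hind).integrable (hind.integrable.const_mul _) fun x => ?_
    by_cases hx : x ∈ stopSet f h n
    · simpa [hx] using dyadicMean_le_of_mem_stopSet hf hf0 hx
    · simp [hx]
  calc ∫ x, |stopPart f h n x|
      ≤ ∫ x, (f x * (stopSet f h n).indicator (fun _ => (1 : ℝ)) x +
          dyadicMean n f x * (stopSet f h n).indicator (fun _ => (1 : ℝ)) x) := by
        refine integral_mono (nice_stopPart hf hh n).abs.integrable
          ((hf.mul hind).add (hE.mul hind)).integrable fun x => ?_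
        by_cases hx : x ∈ stopSet f h n
        · simp only [stopPart, hx, Set.indicator_of_mem, mul_one]
          have := hf0 x
          have := dyadicMean_nonneg hf0 n x
          rw [abs_le]; constructor <;> linarith
        · simp [stopPart, hx]
    _ ≤ 8 * h * volume.real (stopSet f h n) := by
        rw [integral_add (hf.mul hind).integrable (hE.mul hind).integrable, ← h1]
        linarith

lemma goodPart_of_mem {h : ℝ} {I : Finset ℤ} {n : ℤ} (hn : n ∈ I) {x : ℝ × ℝ}
    (hx : x ∈ stopSet f h n) : goodPart f h I x = dyadicMean n f x := by
  rw [goodPart, Finset.sum_eq_single_of_mem n hn fun m _ hmn =>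
    stopPart_eq_zero fun hm => hmn (stopSet_disjoint hm hx)]
  simp [stopPart, hx]

lemma goodPart_of_forall_notMem {h : ℝ} {I : Finset ℤ} {x : ℝ × ℝ}
    (hx : ∀ n ∈ I, x ∉ stopSet f h n) : goodPart f h I x = f x := by
  rw [goodPart, Finset.sum_eq_zero fun n hn => stopPart_eq_zero (hx n hn), sub_zero]

lemma integral_goodPart_sq_le (hf : Nice f) (hf0 : ∀ x, 0 ≤ f x) {h : ℝ} (hh : 0 < h)
    {I : Finset ℤ} (hI : ∀ x, (∀ n ∈ I, x ∉ stopSet f h n) → f x ≤ h)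
    {q : ℝ} (hq : 1 < q) (hq2 : q ≤ 2) :
    ∫ x, goodPart f h I x ^ 2 ≤ 65 * h ^ (2 - q) * ∫ x, f x ^ q := by
  have hfq := hf.rpow hf0 (show 0 < q by linarith)
  have hind := fun n => nice_indicator_stopSet hf hh n
  have hsum := Nice.sum I fun n _ => hind n
  have hpt : ∀ x, goodPart f h I x ^ 2 ≤ h ^ (2 - q) * f x ^ q +
      16 * h ^ 2 * ∑ n ∈ I, (stopSet f h n).indicator (fun _ => (1 : ℝ)) x := by
    intro x
    have hfx := hf0 x
    have hs0 : ∀ n, 0 ≤ (stopSet f h n).indicator (fun _ => (1 : ℝ)) x := fun n =>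
      Set.indicator_nonneg (fun _ _ => zero_le_one) x
    by_cases hx : ∃ n ∈ I, x ∈ stopSet f h n
    · obtain ⟨n, hn, hx⟩ := hx
      rw [goodPart_of_mem hn hx]
      have h1 : (1 : ℝ) ≤ ∑ n ∈ I, (stopSet f h n).indicator (fun _ => (1 : ℝ)) x := by
        refine le_trans ?_ (Finset.single_le_sum (fun m _ => hs0 m) hn)
        simp [hx]
      have h2 : dyadicMean n f x ^ 2 ≤ (4 * h) ^ 2 := by
        have := dyadicMean_nonneg hf0 n x
        have := dyadicMean_le_of_mem_stopSet hf hf0 hx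
        gcongr
      have h3 : 0 ≤ h ^ (2 - q) * f x ^ q := by positivity
      nlinarith [sq_nonneg h]
    · push Not at hx
      rw [goodPart_of_forall_notMem hx]
      have h3 : f x ^ 2 ≤ h ^ (2 - q) * f x ^ q := by
        rcases hfx.eq_or_lt with h0 | h0
        · rw [← h0]; simp; positivity
        · have : f x ^ 2 = f x ^ (2 - q) * f x ^ q := by
            rw [← Real.rpow_add h0]; norm_num
          rw [this]
          exact mul_le_mul_of_nonneg_right
            (Real.rpow_le_rpow hfx (hI x hx) (by linarith)) (by positivity)
      have h4 := Finset.sum_nonneg fun n (_ : n ∈ I) => hs0 n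
      have h5 : 0 ≤ 16 * h ^ 2 * ∑ n ∈ I, (stopSet f h n).indicator (fun _ => (1 : ℝ)) x := by
        positivity
      linarith
  have h1 := integral_mono (μ := volume) (nice_goodPart hf hh I).sq.integrable
    ((hfq.const_mul (h ^ (2 - q))).add (hsum.const_mul (16 * h ^ 2))).integrable hpt
  rw [integral_add (hfq.const_mul (h ^ (2 - q))).integrable
      (hsum.const_mul (16 * h ^ 2)).integrable,
    integral_const_mul, integral_const_mul,
    integral_finsetSum _ fun n _ => (hind n).integrable] at h1
  simp_rw [integral_indicator_stopSet] at h1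
  have h2 := mul_le_mul_of_nonneg_left (sum_volume_stopSet_le hf hf0 hh I hq hq2)
    (show 0 ≤ 16 * h ^ 2 by positivity)
  have h3 : h ^ (2 - q) = h ^ 2 * h ^ (-q) := by
    rw [sub_eq_add_neg, Real.rpow_add hh, Real.rpow_two]
  rw [h3] at h1 ⊢
  nlinarith

lemma integral_circMean_sq_le_integral_sq (hg : Nice g) (r : ℝ) :
    ∫ x, circMean r g x ^ 2 ≤ ∫ x, g x ^ 2 := by
  rw [← integral_circMean hg.sq r]
  refine integral_mono (hg.circMean r).sq.integrable (hg.sq.circMean r).integrable fun x => ?_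
  have h0 : 0 ≤ circMean r (fun y => (g y - circMean r g x) ^ 2) x :=
    integral_nonneg fun _ => sq_nonneg _
  have h1 : circMean r (fun y => (g y - circMean r g x) ^ 2) x =
      circMean r (fun y => g y ^ 2) x - circMean r g x ^ 2 := by
    set c := circMean r g x with hc
    have e : ∀ y, (g y - c) ^ 2 = g y ^ 2 - (2 * c * g y - c ^ 2) := fun y => by ring
    simp_rw [circMean, e]
    have i1 := hg.integrable_shift r x
    have i2 : Integrable (fun θ => 2 * c * g (x + r • circ θ)) angle := i1.const_mul _
    have i3 : Integrable (fun θ => 2 * c * g (x + r • circ θ) - c ^ 2) angle :=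
      i2.sub (integrable_const _)
    rw [integral_sub (hg.sq.integrable_shift r x) i3, integral_sub i2 (integrable_const _),
      integral_const_mul]
    simp only [integral_const, probReal_univ, smul_eq_mul, one_mul]
    change _ - (2 * c * c - c ^ 2) = _
    ring
  simp only
  linarith

/-- The decay base of the circular means. -/
noncomputable def decay : ℝ := 2 ^ (-(1 / 8) : ℝ)

lemma decay_pos : 0 < decay := by unfold decay; positivity

lemma decay_pow_eight : decay ^ 8 = 1 / 2 := by
  rw [decay, ← Real.rpow_natCast, ← Real.rpow_mul (by norm_num)]
  norm_num

lemma decay_lt_one : decay < 1 := by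
  by_contra! h
  have := one_le_pow₀ h (n := 8)
  rw [decay_pow_eight] at this
  norm_num at this

lemma integral_circMean_dyadicDiff_sq_le (hg : Nice g) (j : ℤ) (s : ℕ) :
    ∫ x, circMean (2 ^ j) (dyadicDiff (j - s) g) x ^ 2 ≤
      200 * decay ^ s * ∫ x, dyadicDiff (j - s) g x ^ 2 := by
  have hd := hg.dyadicDiff (j - s)
  have h0 : 0 ≤ ∫ x, dyadicDiff (j - s) g x ^ 2 := integral_nonneg fun _ => sq_nonneg _
  have hp := decay_pos
  rcases le_total 8 s with hs | hs
  · refine integral_circMean_sq_le hd j (by positivity) ?_ ?_ (dyadicMean_dyadicDiff _ hg)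
    · rw [← decay_pow_eight]
      exact pow_le_pow_of_le_one hp.le decay_lt_one.le hs
    · rw [← pow_mul, mul_comm, pow_mul, decay_pow_eight, zpow_neg, zpow_natCast, one_div, inv_pow]
  · refine (integral_circMean_sq_le_integral_sq hd _).trans ?_
    have : (1 : ℝ) / 2 ≤ decay ^ s := by
      rw [← decay_pow_eight]
      exact pow_le_pow_of_le_one hp.le decay_lt_one.le hs
    nlinarith

lemma sum_integral_circMean_dyadicDiff_sq_le (hg : Nice g) (J : Finset ℤ) (s : ℕ) :
    ∑ j ∈ J, ∫ x, circMean (2 ^ j) (dyadicDiff (j - s) g) x ^ 2 ≤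
      200 * decay ^ s * ∫ x, g x ^ 2 := by
  have hp := decay_pos
  refine (Finset.sum_le_sum fun j _ => integral_circMean_dyadicDiff_sq_le hg j s).trans ?_
  rw [← Finset.mul_sum]
  refine mul_le_mul_of_nonneg_left ?_ (by positivity)
  have := sum_integral_dyadicDiff_sq_le (J.image fun j => j - (s : ℤ)) hg
  rwa [Finset.sum_image fun a _ b _ hab => by simpa using hab] at this

end StoppingParts

section WeakType

variable {f g : ℝ × ℝ → ℝ}

lemma volume_lt_le (hf : Nice f) (hf0 : ∀ x, 0 ≤ f x) {ε : ℝ} (hε : 0 < ε) :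
    volume {x | ε < f x} ≤ ENNReal.ofReal (ε⁻¹ * ∫ x, f x) := by
  have h1 := mul_meas_ge_le_integral_of_nonneg (μ := volume)
    (Filter.Eventually.of_forall hf0) hf.integrable ε
  have hfin : volume {x | ε ≤ f x} < ∞ := hf.integrable.measure_ge_lt_top hε
  calc volume {x | ε < f x} ≤ volume {x | ε ≤ f x} := measure_mono fun x (hx : ε < f x) => hx.le
    _ = ENNReal.ofReal (volume.real {x | ε ≤ f x}) := (ofReal_measureReal hfin.ne).symm
    _ ≤ _ := ENNReal.ofReal_le_ofReal (by rwa [le_inv_mul_iff₀ hε])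

lemma floor_le_floor_add_one {a b : ℝ} (h : a ≤ b + 1) : ⌊a⌋ ≤ ⌊b⌋ + 1 := by
  rw [← Int.floor_add_one]; exact Int.floor_le_floor h

lemma volume_stopNhd_le (hf : Nice f) {h : ℝ} (hh : 0 < h) (I : Finset ℤ) :
    volume (stopNhd f h I) ≤ ENNReal.ofReal (9 * ∑ n ∈ I, volume.real (stopSet f h n)) := by
  set K : Finset (ℤ × ℤ) := Finset.Icc (-1) 1 ×ˢ Finset.Icc (-1) 1 with hK
  have hcard : K.card = 9 := by rfl
  set S : ℤ → ℤ × ℤ → Set (ℝ × ℝ) := fun n k =>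
    (fun x => x + -((2 : ℝ) ^ n • ((k.1 : ℝ), (k.2 : ℝ)))) ⁻¹' stopSet f h n with hS
  have hsub : stopNhd f h I ⊆ ⋃ n ∈ I, ⋃ k ∈ K, S n k := by
    rintro x ⟨n, hn, y, hy, hxy⟩
    have h2 : (0 : ℝ) < 2 ^ n := by positivity
    simp only [Set.mem_iUnion]
    refine ⟨n, hn, idx n x - idx n y, ?_, ?_⟩
    · rw [Prod.norm_def, max_le_iff] at hxy
      simp only [Prod.fst_sub, Prod.snd_sub, Real.norm_eq_abs, abs_le] at hxy
      have key : ∀ a b : ℝ, a - b ≤ 2 ^ n → ⌊a / 2 ^ n⌋ ≤ ⌊b / 2 ^ n⌋ + 1 := fun a b hab => by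
        refine floor_le_floor_add_one ?_
        rw [div_add_one h2.ne', div_le_div_iff_of_pos_right h2]; linarith
      have k1 := key x.1 y.1 hxy.1.2
      have k2 := key y.1 x.1 (by linarith [hxy.1.1])
      have k3 := key x.2 y.2 hxy.2.2
      have k4 := key y.2 x.2 (by linarith [hxy.2.1])
      simp only [hK, Finset.mem_product, Finset.mem_Icc, idx, Prod.fst_sub, Prod.snd_sub]
      omega
    · refine (mem_stopSet_congr (Eq.symm ?_)).1 hy
      simp only [idx, Prod.fst_add, Prod.snd_add, Prod.fst_neg, Prod.snd_neg, Prod.smul_fst,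
        Prod.smul_snd, smul_eq_mul, Prod.fst_sub, Prod.snd_sub]
      have key : ∀ a : ℝ, ∀ m : ℤ, (a + -(2 ^ n * (m : ℝ))) / 2 ^ n = a / 2 ^ n - m :=
        fun a m => by field_simp; ring
      rw [key, key, Int.floor_sub_intCast, Int.floor_sub_intCast]
      ext <;> simp
  refine (measure_mono hsub).trans ((measure_biUnion_finset_le _ _).trans ?_)
  rw [Finset.mul_sum, ENNReal.ofReal_sum_of_nonneg fun n _ => by positivity]
  refine Finset.sum_le_sum fun n _ => (measure_biUnion_finset_le _ _).trans ?_
  have : ∀ k, volume (S n k) = ENNReal.ofReal (volume.real (stopSet f h n)) := fun k => by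
    rw [hS, ofReal_measureReal (volume_stopSet_lt_top hf hh n).ne]
    exact measure_preimage_add_right _ _ _
  simp only [this, Finset.sum_const, hcard, nsmul_eq_mul]
  rw [ENNReal.ofReal_mul (by norm_num)]
  simp

lemma dyadicMean_sum {ι : Type*} (s : Finset ι) {F : ι → ℝ × ℝ → ℝ} (h : ∀ i ∈ s, Nice (F i))
    (n : ℤ) (x : ℝ × ℝ) :
    dyadicMean n (fun x => ∑ i ∈ s, F i x) x = ∑ i ∈ s, dyadicMean n (F i) x := by
  simp only [dyadicMean]
  rw [integral_finsetSum s fun i hi => (h i hi).integrable.integrableOn, Finset.mul_sum]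

lemma dyadicDiff_stopPart_of_lt (hf : Nice f) {h : ℝ} (hh : 0 < h) {n m : ℤ} (hnm : n < m)
    (x : ℝ × ℝ) : dyadicDiff m (stopPart f h n) x = 0 := by
  have key : ∀ k, n ≤ k → dyadicMean k (stopPart f h n) x = 0 := fun k hk => by
    rw [← dyadicMean_dyadicMean_of_le hk (nice_stopPart hf hh n)]
    simp [dyadicMean_const, show dyadicMean n (stopPart f h n) = fun _ => 0 from
      funext (dyadicMean_stopPart hf h n)]
  rw [dyadicDiff, key _ (by omega), key _ (by omega), sub_zero]

lemma dyadicDiff_stopPart_of_notMem {h : ℝ} {n m : ℤ} (hnm : m ≤ n)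
    {x : ℝ × ℝ} (hx : x ∉ stopSet f h n) : dyadicDiff m (stopPart f h n) x = 0 := by
  have key : ∀ k, k ≤ n → dyadicMean k (stopPart f h n) x = 0 := fun k hk => by
    have := dyadicMean_of_idx (n := k)
      (h := (stopSet f h n).indicator (fun _ => (1 : ℝ)))
      (fun a b hab => indicator_stopSet_congr a b (idx_refine hk hab))
      (fun y => f y - dyadicMean n f y) x
    rw [Set.indicator_of_notMem hx, mul_zero] at this
    exact this
  rw [dyadicDiff, key _ (by omega), key _ (by omega), sub_zero]

lemma circMean_dyadicDiff_stopPart_eq_zero (hf : Nice f) {h : ℝ} (hh : 0 < h) {I : Finset ℤ}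
    {n : ℤ} (hn : n ∈ I) {x : ℝ × ℝ} (hx : x ∉ stopNhd f h I) {j : ℤ} {s : ℕ}
    (hj : ¬ (n < j ∧ j ≤ n + s)) :
    circMean (2 ^ j) (dyadicDiff (j - s) (stopPart f h n)) x = 0 := by
  refine circMean_eq_zero fun θ => ?_
  by_cases hjn : j ≤ n
  · refine dyadicDiff_stopPart_of_notMem (by omega) fun hmem => hx ⟨n, hn, _, hmem, ?_⟩
    rw [sub_add_cancel_left, norm_neg]
    refine (norm_smul_circ_le _ _).trans ?_
    rw [abs_of_pos (by positivity)]
    exact zpow_le_zpow_right₀ (by norm_num) hjn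
  · exact dyadicDiff_stopPart_of_lt hf hh (by omega) _

lemma circMean_dyadicDiff_decomp (hf : Nice f) {h : ℝ} (hh : 0 < h) (I : Finset ℤ) (m : ℤ)
    (r : ℝ) (x : ℝ × ℝ) :
    circMean r (dyadicDiff m f) x = circMean r (dyadicDiff m (goodPart f h I)) x +
      ∑ n ∈ I, circMean r (dyadicDiff m (stopPart f h n)) x := by
  have hg := nice_goodPart hf hh I
  have hb := fun n (_ : n ∈ I) => nice_stopPart hf hh n
  have h1 : f = fun x => goodPart f h I x + ∑ n ∈ I, stopPart f h n x := by
    ext x; simp [goodPart]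
  have h2 : dyadicDiff m f = fun x => dyadicDiff m (goodPart f h I) x +
      ∑ n ∈ I, dyadicDiff m (stopPart f h n) x := by
    ext x
    have key : ∀ k, dyadicMean k f x = dyadicMean k (goodPart f h I) x +
        ∑ n ∈ I, dyadicMean k (stopPart f h n) x := fun k => by
      conv_lhs => rw [h1]
      rw [dyadicMean_add k hg (Nice.sum I hb), dyadicMean_sum I hb]
    simp only [dyadicDiff, key, Finset.sum_sub_distrib]
    ring
  have hd := fun n (hn : n ∈ I) => (hb n hn).dyadicDiff m
  rw [h2, circMean_add (hg.dyadicDiff m) (Nice.sum I hd), circMean_sum I hd]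

lemma integral_abs_dyadicDiff_le (hg : Nice g) (m : ℤ) :
    ∫ x, |dyadicDiff m g x| ≤ 2 * ∫ x, |g x| := by
  have i1 := (hg.dyadicMean (m - 1)).abs
  have i2 := (hg.dyadicMean m).abs
  have h1 := integral_mono (μ := volume) (hg.dyadicDiff m).abs.integrable (i1.add i2).integrable
    fun x => abs_sub (dyadicMean (m - 1) g x) (dyadicMean m g x)
  rw [integral_add i1.integrable i2.integrable] at h1
  linarith [integral_abs_dyadicMean_le (m - 1) hg, integral_abs_dyadicMean_le m hg]

/-- Weak type estimate for a single off-diagonal term. -/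
lemma volume_exists_circMean_dyadicDiff_le (hf : Nice f) (hf0 : ∀ x, 0 ≤ f x) {h : ℝ} (hh : 0 < h)
    {I : Finset ℤ} (hI : ∀ x, (∀ n ∈ I, x ∉ stopSet f h n) → f x ≤ h)
    {q : ℝ} (hq : 1 < q) (hq2 : q ≤ 2) (J : Finset ℤ) (s : ℕ) {μ : ℝ} (hμ : 0 < μ) :
    volume {x | ∃ j ∈ J, μ < circMean (2 ^ j) (dyadicDiff (j - s) f) x} ≤
      ENNReal.ofReal ((36 * h ^ (-q) + 128 * s * h * h ^ (-q) / μ +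
        52000 * decay ^ s * h ^ (2 - q) / μ ^ 2) * ∫ x, f x ^ q) := by
  set F := ∫ x, f x ^ q with hF
  have hF0 : 0 ≤ F := integral_nonneg fun x => Real.rpow_nonneg (hf0 x) q
  set V := ∑ n ∈ I, volume.real (stopSet f h n) with hV
  have hVF : V ≤ 4 * h ^ (-q) * F := sum_volume_stopSet_le hf hf0 hh I hq hq2
  have hg := nice_goodPart hf hh I
  have hb := fun n => nice_stopPart hf hh n
  set T : ℤ → (ℝ × ℝ → ℝ) → ℝ × ℝ → ℝ := fun j u => circMean (2 ^ j) (dyadicDiff (j - s) u) with hT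
  have hTn : ∀ j {u}, Nice u → Nice (T j u) := fun j u hu => (hu.dyadicDiff _).circMean _
  set Jn : ℤ → Finset ℤ := fun n => J.filter fun j => n < j ∧ j ≤ n + s with hJn
  set B : ℝ × ℝ → ℝ := fun x => ∑ n ∈ I, ∑ j ∈ Jn n, |T j (stopPart f h n) x| with hB
  set G : ℝ × ℝ → ℝ := fun x => ∑ j ∈ J, T j (goodPart f h I) x ^ 2 with hG
  have hBn : Nice B := Nice.sum I fun n _ => Nice.sum (Jn n) fun j _ => (hTn j (hb n)).abs
  have hGn : Nice G := Nice.sum J fun j _ => (hTn j hg).sq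
  have hsub : {x | ∃ j ∈ J, μ < circMean (2 ^ j) (dyadicDiff (j - s) f) x} ⊆
      stopNhd f h I ∪ ({x | μ / 2 < B x} ∪ {x | (μ / 2) ^ 2 < G x}) := by
    rintro x ⟨j, hj, hx⟩
    by_contra hcon
    simp only [Set.mem_union, Set.mem_ofPred_eq, not_or, not_lt] at hcon
    obtain ⟨c1, c2, c3⟩ := hcon
    rw [circMean_dyadicDiff_decomp hf hh I] at hx
    have h1 : T j (goodPart f h I) x ≤ μ / 2 := by
      have : T j (goodPart f h I) x ^ 2 ≤ (μ / 2) ^ 2 :=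
        (Finset.single_le_sum (f := fun j => T j (goodPart f h I) x ^ 2)
          (fun _ _ => sq_nonneg _) hj).trans c3
      exact (abs_le_of_sq_le_sq' this (by linarith)).2
    have h2 : ∑ n ∈ I, T j (stopPart f h n) x ≤ B x := by
      refine Finset.sum_le_sum fun n hn => ?_
      by_cases hjn : n < j ∧ j ≤ n + s
      · refine (le_abs_self _).trans (Finset.single_le_sum
          (f := fun j => |T j (stopPart f h n) x|) (fun _ _ => abs_nonneg _) ?_)
        simp [hJn, hj, hjn]
      · rw [hT]
        simp only
        rw [circMean_dyadicDiff_stopPart_eq_zero hf hh hn c1 hjn]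
        exact Finset.sum_nonneg fun _ _ => abs_nonneg _
    have h3 : T j (goodPart f h I) x + ∑ n ∈ I, T j (stopPart f h n) x ≤ μ := by linarith
    exact absurd hx (not_lt.2 h3)
  have hBi : ∫ x, B x ≤ 16 * s * h * V := by
    rw [hB, integral_finsetSum _ fun n _ =>
        (Nice.sum (Jn n) fun j _ => (hTn j (hb n)).abs).integrable,
      hV, Finset.mul_sum]
    refine Finset.sum_le_sum fun n _ => ?_
    rw [integral_finsetSum _ fun j _ => (hTn j (hb n)).abs.integrable]
    have hterm : ∀ j ∈ Jn n, ∫ x, |T j (stopPart f h n) x| ≤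
        2 * (8 * h * volume.real (stopSet f h n)) := fun j _ =>
      (integral_abs_circMean_le ((hb n).dyadicDiff _) _).trans
        ((integral_abs_dyadicDiff_le (hb n) _).trans
          (mul_le_mul_of_nonneg_left (integral_abs_stopPart_le hf hf0 hh n) (by norm_num)))
    refine (Finset.sum_le_sum hterm).trans ?_
    rw [Finset.sum_const, nsmul_eq_mul]
    have hcard : ((Jn n).card : ℝ) ≤ s := by
      have : (Jn n).card ≤ (Finset.Ioc n (n + s)).card := by
        refine Finset.card_le_card fun j hj => ?_
        simp only [hJn, Finset.mem_filter] at hj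
        simpa using hj.2
      simp only [Int.card_Ioc, add_sub_cancel_left, Int.toNat_natCast] at this
      exact_mod_cast this
    have h0 : 0 ≤ 2 * (8 * h * volume.real (stopSet f h n)) := by positivity
    nlinarith [mul_le_mul_of_nonneg_right hcard h0]
  have hGi : ∫ x, G x ≤ 200 * decay ^ s * (65 * h ^ (2 - q) * F) := by
    rw [hG, integral_finsetSum _ fun j _ => (hTn j hg).sq.integrable]
    have hp := decay_pos
    exact (sum_integral_circMean_dyadicDiff_sq_le hg J s).trans (mul_le_mul_of_nonneg_left
      (integral_goodPart_sq_le hf hf0 hh hI hq hq2) (by positivity))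
  have hB0 : ∀ x, 0 ≤ B x := fun x => Finset.sum_nonneg fun _ _ =>
    Finset.sum_nonneg fun _ _ => abs_nonneg _
  have hG0 : ∀ x, 0 ≤ G x := fun x => Finset.sum_nonneg fun _ _ => sq_nonneg _
  have m1 := volume_stopNhd_le hf hh I
  have m2 := volume_lt_le hBn hB0 (half_pos hμ)
  have m3 := volume_lt_le hGn hG0 (show 0 < (μ / 2) ^ 2 by positivity)
  have hV0 : 0 ≤ V := Finset.sum_nonneg fun _ _ => measureReal_nonneg
  have hBI0 : 0 ≤ ∫ x, B x := integral_nonneg hB0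
  have hGI0 : 0 ≤ ∫ x, G x := integral_nonneg hG0
  refine (measure_mono hsub).trans ((measure_union_le _ _).trans ((add_le_add m1
    ((measure_union_le _ _).trans (add_le_add m2 m3))).trans ?_))
  rw [← ENNReal.ofReal_add (by positivity) (by positivity),
    ← ENNReal.ofReal_add (by positivity) (by positivity)]
  refine ENNReal.ofReal_le_ofReal ?_
  have e1 : 9 * V ≤ 36 * h ^ (-q) * F := by linarith
  have e2 : (μ / 2)⁻¹ * ∫ x, B x ≤ 128 * s * h * h ^ (-q) / μ * F := by
    calc (μ / 2)⁻¹ * ∫ x, B x ≤ (μ / 2)⁻¹ * (16 * s * h * (4 * h ^ (-q) * F)) := by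
          gcongr
          exact hBi.trans (by gcongr)
      _ = 128 * s * h * h ^ (-q) / μ * F := by field_simp; ring
  have e3 : ((μ / 2) ^ 2)⁻¹ * ∫ x, G x ≤ 52000 * decay ^ s * h ^ (2 - q) / μ ^ 2 * F := by
    calc ((μ / 2) ^ 2)⁻¹ * ∫ x, G x ≤
          ((μ / 2) ^ 2)⁻¹ * (200 * decay ^ s * (65 * h ^ (2 - q) * F)) := by gcongr
      _ = 52000 * decay ^ s * h ^ (2 - q) / μ ^ 2 * F := by field_simp; ring
  linarith

end WeakType

section OffDiagonal

variable {f g : ℝ × ℝ → ℝ}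

lemma off_diagonal_const_le {l B W c q : ℝ} (hl : 0 < l) (hB : 0 < B) (hB1 : B ≤ 1) (hBW : B ≤ W)
    (hW1 : W ≤ 1) (hWB : W ^ 2 = B ^ (q - 1)) (hc : 0 < c) (s : ℕ) :
    36 * (l / B) ^ (-q) + 128 * s * (l / B) * (l / B) ^ (-q) / (c * W * l) +
      52000 * B ^ 2 * (l / B) ^ (2 - q) / (c * W * l) ^ 2 ≤
      l ^ (-q) * ((36 + 128 / c + 52000 / c ^ 2) * ((s + 1) * W)) := by
  have hW : 0 < W := hB.trans_le hBW
  have e1 : (l / B) ^ (-q) = l ^ (-q) * (B * W ^ 2) := by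
    rw [Real.div_rpow hl.le hB.le, hWB, Real.rpow_neg hB.le, div_inv_eq_mul,
      Real.rpow_sub_one hB.ne']
    field_simp
  have e2 : (l / B) ^ (2 - q) = (l / B) ^ 2 * (l ^ (-q) * (B * W ^ 2)) := by
    rw [← e1, sub_eq_add_neg, Real.rpow_add (by positivity)]; norm_num
  rw [e2, e1]
  have hL : 0 < l ^ (-q) := by positivity
  have t2 : 128 * s * (l / B) * (l ^ (-q) * (B * W ^ 2)) / (c * W * l) =
      l ^ (-q) * (128 / c * (s * W)) := by field_simp
  have t3 : 52000 * B ^ 2 * ((l / B) ^ 2 * (l ^ (-q) * (B * W ^ 2))) / (c * W * l) ^ 2 =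
      l ^ (-q) * (52000 / c ^ 2 * B) := by field_simp
  rw [t2, t3, ← mul_assoc, mul_comm 36, mul_assoc _ 36, ← mul_add, ← mul_add]
  refine mul_le_mul_of_nonneg_left ?_ hL.le
  have hs : (0 : ℝ) ≤ s := s.cast_nonneg
  have hBW2 : B * W ^ 2 ≤ W := by nlinarith [mul_le_mul hB1 hW1 hW.le zero_le_one]
  have hsW : 0 ≤ s * W := by positivity
  calc 36 * (B * W ^ 2) + 128 / c * (s * W) + 52000 / c ^ 2 * B
      ≤ 36 * ((s + 1) * W) + 128 / c * ((s + 1) * W) + 52000 / c ^ 2 * ((s + 1) * W) := by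
        refine add_le_add (add_le_add ?_ ?_) ?_ <;>
          exact mul_le_mul_of_nonneg_left (by linarith) (by positivity)
    _ = _ := by ring

lemma sum_dyadicDiff (j : ℤ) (S : ℕ) (x : ℝ × ℝ) :
    ∑ s ∈ Finset.range S, dyadicDiff (j - s) f x = dyadicMean (j - S) f x - dyadicMean j f x := by
  induction S with
  | zero => simp
  | succ S ih =>
    rw [Finset.sum_range_succ, ih, dyadicDiff]
    push_cast
    rw [sub_sub j]
    ring

lemma dyadicMean_eq_self_of_le {n₀ m : ℤ} (hn₀ : ∀ x y, idx n₀ x = idx n₀ y → f x = f y)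
    (hm : m ≤ n₀) (x : ℝ × ℝ) : dyadicMean m f x = f x :=
  dyadicMean_self (fun _ _ h => hn₀ _ _ (idx_refine hm h)) x

lemma mem_stopNhd_of_lt_circMean {n₀ n₁ : ℤ} (hf0 : ∀ x, 0 ≤ f x)
    (hn₀ : ∀ x y, idx n₀ x = idx n₀ y → f x = f y) {h : ℝ}
    (hn₁ : ∀ m, n₁ ≤ m → ∀ x, dyadicMean m f x ≤ h) {j : ℤ} {x : ℝ × ℝ}
    (hx : h < circMean (2 ^ j) (dyadicMean j f) x) : x ∈ stopNhd f h (Finset.Ico n₀ n₁) := by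
  obtain ⟨θ, hθ⟩ := exists_of_lt_circMean (dyadicMean_nonneg hf0 j) hx
  have hθ' : h < dyadicMean (max j n₀) f (x + (2 : ℝ) ^ j • circ θ) := by
    rcases le_total n₀ j with hj | hj
    · rwa [max_eq_left hj]
    · rw [max_eq_right hj, dyadicMean_eq_self_of_le hn₀ le_rfl]
      rwa [dyadicMean_eq_self_of_le hn₀ hj] at hθ
  obtain ⟨n, h1, h2, h3⟩ := exists_mem_stopSet hn₁ hθ'
  refine ⟨n, Finset.mem_Ico.2 ⟨(le_max_right _ _).trans h1, h2⟩, _, h3, ?_⟩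
  have hb := norm_smul_circ_le ((2 : ℝ) ^ j) θ
  rw [abs_of_nonneg (by positivity)] at hb
  rw [sub_add_cancel_left, norm_neg]
  exact hb.trans (zpow_le_zpow_right₀ (by norm_num) ((le_max_left _ _).trans h1))

lemma circMean_le_of_forall_le (hf : Nice f) {n₀ : ℤ}
    (hn₀ : ∀ x y, idx n₀ x = idx n₀ y → f x = f y) {j : ℤ} {S : ℕ} (hS : j - S ≤ n₀)
    {x : ℝ × ℝ} {a : ℝ} {c : ℕ → ℝ} (ha : circMean (2 ^ j) (dyadicMean j f) x ≤ a)
    (hc : ∀ s < S, circMean (2 ^ j) (dyadicDiff (j - s) f) x ≤ c s) :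
    circMean (2 ^ j) f x ≤ a + ∑ s ∈ Finset.range S, c s := by
  have hdec : f = fun x => dyadicMean j f x +
      ∑ s ∈ Finset.range S, dyadicDiff (j - s) f x := by
    funext y
    rw [sum_dyadicDiff, dyadicMean_eq_self_of_le hn₀ hS]
    ring
  have hD : ∀ s ∈ Finset.range S, Nice (dyadicDiff (j - (s : ℕ)) f) := fun s _ => hf.dyadicDiff _
  have h1 : circMean (2 ^ j) f x = circMean (2 ^ j) (dyadicMean j f) x +
      ∑ s ∈ Finset.range S, circMean (2 ^ j) (dyadicDiff (j - s) f) x := by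
    rw [← circMean_sum _ hD, ← circMean_add (hf.dyadicMean j) (Nice.sum _ hD)]
    exact congrArg (fun u => circMean (2 ^ j) u x) hdec
  rw [h1]
  exact add_le_add ha (Finset.sum_le_sum fun s hs => hc s (Finset.mem_range.1 hs))

/-- Weak type `(q, q)` bound for dyadic circular means of functions constant on small squares. -/
lemma exists_weak_type_of_idx {q : ℝ} (hq : 1 < q) (hq2 : q ≤ 2) : ∃ C : ℝ, 0 < C ∧
    ∀ (f : ℝ × ℝ → ℝ) (n₀ : ℤ) (J : Finset ℤ) (l : ℝ), Nice f → (∀ x, 0 ≤ f x) →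
      (∀ x y, idx n₀ x = idx n₀ y → f x = f y) → 0 < l →
      volume {x | ∃ j ∈ J, l < circMean (2 ^ j) f x} ≤
        ENNReal.ofReal (C * l ^ (-q) * ∫ x, f x ^ q) := by
  set b : ℝ := decay ^ (1 / 2 : ℝ) with hb
  have hb0 : 0 < b := Real.rpow_pos_of_pos decay_pos _
  have hb1 : b < 1 := Real.rpow_lt_one decay_pos.le decay_lt_one (by norm_num)
  have hbd : b ^ 2 = decay := by
    rw [hb, ← Real.rpow_natCast, ← Real.rpow_mul decay_pos.le]; norm_num
  set w : ℝ := b ^ ((q - 1) / 2) with hw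
  have hw0 : 0 < w := Real.rpow_pos_of_pos hb0 _
  have hw1 : w < 1 := Real.rpow_lt_one hb0.le hb1 (by linarith)
  have hbw : b ≤ w := by
    conv_lhs => rw [← Real.rpow_one b]
    exact Real.rpow_le_rpow_of_exponent_ge hb0 hb1.le (by linarith)
  have hw2 : w ^ 2 = b ^ (q - 1) := by
    rw [hw, ← Real.rpow_natCast, ← Real.rpow_mul hb0.le]; congr 1; push_cast; ring
  set c : ℝ := (1 - w) / 2 with hc
  have hc0 : 0 < c := by rw [hc]; linarith
  set K : ℝ := 36 + 128 / c + 52000 / c ^ 2 with hK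
  have hK0 : 0 < K := by positivity
  have hsum : Summable fun s : ℕ => ((s : ℝ) + 1) * w ^ s := by
    have h1 := summable_pow_mul_geometric_of_norm_lt_one 1 (r := w)
      (by rwa [Real.norm_of_nonneg hw0.le])
    have h2 := summable_geometric_of_lt_one hw0.le hw1
    refine (h1.add h2).congr fun s => by simp; ring
  set Z := ∑' s : ℕ, ((s : ℝ) + 1) * w ^ s with hZ
  have hZ0 : 0 ≤ Z := tsum_nonneg fun s => by positivity
  refine ⟨36 * 2 ^ q + K * Z, by positivity, fun f n₀ J l hf hf0 hn₀ hl => ?_⟩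
  set F := ∫ x, f x ^ q with hF
  have hF0 : 0 ≤ F := integral_nonneg fun x => Real.rpow_nonneg (hf0 x) q
  obtain ⟨S, hS⟩ : ∃ S : ℕ, ∀ j ∈ J, j - S ≤ n₀ := by
    obtain ⟨M, hM⟩ := J.bddAbove
    exact ⟨(M - n₀).toNat, fun j hj => by have := hM hj; have := Int.self_le_toNat (M - n₀); omega⟩
  obtain ⟨n₁, hn₁⟩ := exists_scale hf hf0 (half_pos hl)
  set E : ℕ → Set (ℝ × ℝ) := fun s =>
    {x | ∃ j ∈ J, c * w ^ s * l < circMean (2 ^ j) (dyadicDiff (j - s) f) x} with hE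
  have hsub : {x | ∃ j ∈ J, l < circMean (2 ^ j) f x} ⊆
      stopNhd f (l / 2) (Finset.Ico n₀ n₁) ∪ ⋃ s ∈ Finset.range S, E s := by
    rintro x ⟨j, hj, hx⟩
    by_contra hcon
    simp only [Set.mem_union, Set.mem_iUnion, not_or, not_exists, Finset.mem_range] at hcon
    obtain ⟨h1, h2⟩ := hcon
    have h3 := circMean_le_of_forall_le hf hn₀ (hS j hj) (x := x) (a := l / 2)
      (c := fun s => c * w ^ s * l)
      (not_lt.1 fun h => h1 (mem_stopNhd_of_lt_circMean hf0 hn₀ hn₁ h))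
      (fun s hs => not_lt.1 fun h => h2 s hs ⟨j, hj, h⟩)
    have h4 : ∑ s ∈ Finset.range S, c * w ^ s * l ≤ l / 2 := by
      rw [← Finset.sum_mul, ← Finset.mul_sum]
      have : ∑ s ∈ Finset.range S, w ^ s ≤ (1 - w)⁻¹ := by
        rw [← tsum_geometric_of_lt_one hw0.le hw1]
        exact (summable_geometric_of_lt_one hw0.le hw1).sum_le_tsum _ fun s _ => by positivity
      have h5 : c * ∑ s ∈ Finset.range S, w ^ s ≤ 1 / 2 := by
        refine (mul_le_mul_of_nonneg_left this hc0.le).trans ?_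
        have : 1 - w ≠ 0 := by linarith
        rw [hc]; field_simp; rfl
      nlinarith
    linarith
  have hEm : ∀ s, volume (E s) ≤ ENNReal.ofReal (l ^ (-q) * (K * ((s + 1) * w ^ s)) * F) := by
    intro s
    have hbs : 0 < b ^ s := by positivity
    obtain ⟨n₂, hn₂⟩ := exists_scale hf hf0 (div_pos hl hbs)
    have hI : ∀ x, (∀ n ∈ Finset.Ico n₀ n₂, x ∉ stopSet f (l / b ^ s) n) → f x ≤ l / b ^ s := by
      intro x hx
      by_contra! hcon
      rw [← dyadicMean_eq_self_of_le hn₀ le_rfl] at hcon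
      obtain ⟨n, h1, h2, h3⟩ := exists_mem_stopSet hn₂ hcon
      exact hx n (Finset.mem_Ico.2 ⟨h1, h2⟩) h3
    refine (volume_exists_circMean_dyadicDiff_le hf hf0 (div_pos hl hbs) hI hq hq2 J s
      (μ := c * w ^ s * l) (by positivity)).trans (ENNReal.ofReal_le_ofReal ?_)
    refine mul_le_mul_of_nonneg_right ?_ hF0
    have := off_diagonal_const_le (q := q) (c := c) hl hbs (pow_le_one₀ hb0.le hb1.le)
      (pow_le_pow_left₀ hb0.le hbw s) (pow_le_one₀ hw0.le hw1.le)
      (by rw [← pow_mul, mul_comm s, pow_mul, hw2, ← Real.rpow_natCast, ← Real.rpow_mul hb0.le,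
            mul_comm, Real.rpow_mul hb0.le, Real.rpow_natCast]) hc0 s
    rwa [← pow_mul b s 2, mul_comm s 2, pow_mul, hbd] at this
  have hnhd : volume (stopNhd f (l / 2) (Finset.Ico n₀ n₁)) ≤
      ENNReal.ofReal (36 * 2 ^ q * l ^ (-q) * F) := by
    refine (volume_stopNhd_le hf (half_pos hl) _).trans (ENNReal.ofReal_le_ofReal ?_)
    have := sum_volume_stopSet_le hf hf0 (half_pos hl) (Finset.Ico n₀ n₁) hq hq2
    have e : (l / 2) ^ (-q) = 2 ^ q * l ^ (-q) := by
      rw [Real.div_rpow hl.le zero_le_two, Real.rpow_neg zero_le_two, div_inv_eq_mul, mul_comm]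
    rw [e] at this
    linarith
  refine (measure_mono hsub).trans ((measure_union_le _ _).trans ((add_le_add hnhd
    ((measure_biUnion_finset_le _ _).trans (Finset.sum_le_sum fun s _ => hEm s))).trans ?_))
  rw [← ENNReal.ofReal_sum_of_nonneg fun s _ => by positivity,
    ← ENNReal.ofReal_add (by positivity) (Finset.sum_nonneg fun s _ => by positivity)]
  refine ENNReal.ofReal_le_ofReal ?_
  have hle : ∑ s ∈ Finset.range S, ((s : ℝ) + 1) * w ^ s ≤ Z :=
    hsum.sum_le_tsum _ fun s _ => by positivity
  have e : ∑ s ∈ Finset.range S, l ^ (-q) * (K * (((s : ℝ) + 1) * w ^ s)) * F =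
      l ^ (-q) * K * F * ∑ s ∈ Finset.range S, ((s : ℝ) + 1) * w ^ s := by
    rw [Finset.mul_sum]; exact Finset.sum_congr rfl fun s _ => by ring
  rw [e]
  have h0 : 0 ≤ l ^ (-q) * K * F := by positivity
  nlinarith [mul_le_mul_of_nonneg_left hle h0]

lemma dyadicMean_rpow_le (hf : Nice f) (hf0 : ∀ x, 0 ≤ f x) {q : ℝ} (hq : 1 ≤ q) (n : ℤ)
    (x : ℝ × ℝ) : dyadicMean n f x ^ q ≤ dyadicMean n (fun y => f y ^ q) x := by
  have h4 : (0 : ℝ) < (4 : ℝ) ^ n := by positivity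
  have hr : volume.real (cell n x) = 4 ^ n := by
    rw [Measure.real, volume_cell, ENNReal.toReal_ofReal h4.le]
  have := (convexOn_rpow hq).map_set_average_le (μ := volume) (t := cell n x) (f := f)
    (Real.continuous_rpow_const (by linarith)).continuousOn isClosed_Ici
    (by rw [volume_cell]; simpa using h4) (by rw [volume_cell]; simp)
    (Filter.Eventually.of_forall fun y => hf0 y) hf.integrable.integrableOn
    (hf.rpow hf0 (by linarith)).integrable.integrableOn
  simp only [setAverage_eq, hr, smul_eq_mul] at this
  exact this

lemma integral_dyadicMean_rpow_le (hf : Nice f) (hf0 : ∀ x, 0 ≤ f x) {q : ℝ} (hq : 1 ≤ q)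
    (n : ℤ) : ∫ x, dyadicMean n f x ^ q ≤ ∫ x, f x ^ q := by
  have hq0 : 0 < q := by linarith
  rw [← integral_dyadicMean n (hf.rpow hf0 hq0)]
  exact integral_mono ((hf.dyadicMean n).rpow (dyadicMean_nonneg hf0 n) hq0).integrable
    ((hf.rpow hf0 hq0).dyadicMean n).integrable fun x => dyadicMean_rpow_le hf hf0 hq n x

lemma exists_dyadicMean_close (hf : Nice f) (hfu : UniformContinuous f) {ε : ℝ} (hε : 0 < ε) :
    ∃ n : ℤ, ∀ x, |dyadicMean n f x - f x| ≤ ε := by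
  obtain ⟨δ, hδ, h⟩ := Metric.uniformContinuous_iff.1 hfu ε hε
  obtain ⟨k, hk⟩ := exists_pow_lt_of_lt_one hδ (show (1 / 2 : ℝ) < 1 by norm_num)
  refine ⟨-k, fun x => abs_dyadicMean_sub_le hf fun y hy => ?_⟩
  have h1 := norm_sub_le_of_idx_eq (n := -(k : ℤ)) (x := y) (y := x) hy
  have h2 : (2 : ℝ) ^ (-(k : ℤ)) = (1 / 2) ^ k := by simp
  exact (h (by rw [dist_eq_norm]; linarith)).le

/-- Weak type `(q, q)` bound for dyadic circular means of continuous functions. -/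
lemma exists_weak_type {q : ℝ} (hq : 1 < q) (hq2 : q ≤ 2) : ∃ C : ℝ, 0 < C ∧
    ∀ (f : ℝ × ℝ → ℝ) (J : Finset ℤ) (l : ℝ), Nice f → UniformContinuous f → (∀ x, 0 ≤ f x) →
      0 < l → volume {x | ∃ j ∈ J, l < circMean (2 ^ j) f x} ≤
        ENNReal.ofReal (C * l ^ (-q) * ∫ x, f x ^ q) := by
  obtain ⟨C, hC, H⟩ := exists_weak_type_of_idx hq hq2
  refine ⟨C * 2 ^ q, by positivity, fun f J l hf hfu hf0 hl => ?_⟩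
  obtain ⟨n, hn⟩ := exists_dyadicMean_close hf hfu (half_pos hl)
  have h1 : {x | ∃ j ∈ J, l < circMean (2 ^ j) f x} ⊆
      {x | ∃ j ∈ J, l / 2 < circMean (2 ^ j) (dyadicMean n f) x} := by
    rintro x ⟨j, hj, hx⟩
    refine ⟨j, hj, ?_⟩
    have : circMean (2 ^ j) f x ≤ circMean (2 ^ j) (dyadicMean n f) x + l / 2 := by
      have i := (hf.dyadicMean n).integrable_shift (2 ^ j) x
      calc circMean (2 ^ j) f x
          ≤ ∫ θ, (dyadicMean n f (x + (2 : ℝ) ^ j • circ θ) + l / 2) ∂angle := by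
            refine integral_mono (hf.integrable_shift _ x) (i.add (integrable_const _)) fun θ => ?_
            have := (abs_le.1 (hn (x + (2 : ℝ) ^ j • circ θ))).1
            simp only
            linarith
        _ = _ := by rw [integral_add i (integrable_const _)]; simp [circMean]
    linarith
  refine (measure_mono h1).trans ((H _ n J _ (hf.dyadicMean n) (dyadicMean_nonneg hf0 n)
    (fun x y h => dyadicMean_congr h) (half_pos hl)).trans (ENNReal.ofReal_le_ofReal ?_))
  have e : (l / 2) ^ (-q) = 2 ^ q * l ^ (-q) := by
    rw [Real.div_rpow hl.le zero_le_two, Real.rpow_neg zero_le_two, div_inv_eq_mul, mul_comm]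
  rw [e, ← mul_assoc]
  exact mul_le_mul_of_nonneg_left (integral_dyadicMean_rpow_le hf hf0 hq.le n) (by positivity)

end OffDiagonal

section StrongType

variable {f g : ℝ × ℝ → ℝ}

lemma lintegral_rpow_Ioo {r a : ℝ} (hr : -1 < r) (ha : 0 ≤ a) :
    ∫⁻ t in Set.Ioo 0 a, ENNReal.ofReal (t ^ r) = ENNReal.ofReal (a ^ (r + 1) / (r + 1)) := by
  have h1 : IntegrableOn (fun t : ℝ => t ^ r) (Set.Ioo 0 a) :=
    ((intervalIntegral.intervalIntegrable_rpow' hr).1).mono_set Set.Ioo_subset_Ioc_self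
  rw [← ofReal_integral_eq_lintegral_ofReal h1]
  · congr 1
    rw [← integral_Ioc_eq_integral_Ioo, ← intervalIntegral.integral_of_le ha,
      integral_rpow (Or.inl hr), Real.zero_rpow (by linarith), sub_zero]
  · exact (ae_restrict_iff' measurableSet_Ioo).2
      (Filter.Eventually.of_forall fun t ht => Real.rpow_nonneg ht.1.le r)

/-- The dyadic circular maximal function over a finite set of scales. -/
noncomputable def circMax (J : Finset ℤ) (f : ℝ × ℝ → ℝ) (x : ℝ × ℝ) : NNReal :=
  J.sup fun j => (circMean (2 ^ j) f x).toNNReal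

lemma lt_circMax {J : Finset ℤ} {t : ℝ} (ht : 0 ≤ t) {x : ℝ × ℝ} :
    t < circMax J f x ↔ ∃ j ∈ J, t < circMean (2 ^ j) f x := by
  lift t to NNReal using ht
  rw [NNReal.coe_lt_coe, circMax, Finset.lt_sup_iff]
  exact exists_congr fun j => and_congr_right fun _ => by
    rw [Real.lt_toNNReal_iff_coe_lt]

lemma measurable_circMax (hf : Nice f) (J : Finset ℤ) : Measurable (circMax J f) := by
  classical
  unfold circMax
  induction J using Finset.induction_on with
  | empty => simp
  | insert a s _ ih =>
    simp only [Finset.sup_insert]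
    exact ((hf.circMean _).meas.real_toNNReal).sup ih

lemma volume_lt_circMax_le {q C : ℝ} (hq : 1 < q)
    (H : ∀ (f : ℝ × ℝ → ℝ) (J : Finset ℤ) (l : ℝ), Nice f → UniformContinuous f →
      (∀ x, 0 ≤ f x) → 0 < l → volume {x | ∃ j ∈ J, l < circMean (2 ^ j) f x} ≤
        ENNReal.ofReal (C * l ^ (-q) * ∫ x, f x ^ q)) (hC : 0 < C)
    (hf : Nice f) (hfu : UniformContinuous f) (hf0 : ∀ x, 0 ≤ f x) (J : Finset ℤ) {t : ℝ}
    (ht : 0 < t) : volume {x | t < circMax J f x} ≤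
      ENNReal.ofReal (C * 2 ^ q * t ^ (-q)) *
        ∫⁻ x, {x | t < 2 * f x}.indicator (fun x => ENNReal.ofReal (f x ^ q)) x := by
  set u : ℝ × ℝ → ℝ := fun x => max (f x - t / 2) 0 with hu
  have hun : Nice u := by
    obtain ⟨K, hK⟩ := hf.bdd
    obtain ⟨R, hR⟩ := hf.supp
    refine ⟨(hf.meas.sub measurable_const).max measurable_const, ⟨K, fun x => ?_⟩,
      ⟨R, fun x hx => hR x fun h => hx ?_⟩⟩
    · rw [hu, abs_of_nonneg (le_max_right _ _)]
      exact max_le ((by linarith : f x - t / 2 ≤ f x).trans ((le_abs_self _).trans (hK x)))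
        ((abs_nonneg _).trans (hK x))
    · simp only [hu, h]; exact max_eq_right (by linarith)
  have huu : UniformContinuous u := by
    rw [Metric.uniformContinuous_iff] at hfu ⊢
    intro ε hε
    obtain ⟨δ, hδ, h⟩ := hfu ε hε
    refine ⟨δ, hδ, fun {a b} hab => lt_of_le_of_lt ?_ (h hab)⟩
    rw [Real.dist_eq, Real.dist_eq]
    refine (abs_max_sub_max_le_abs _ _ _).trans (le_of_eq ?_)
    ring_nf
  have hu0 : ∀ x, 0 ≤ u x := fun x => le_max_right _ _
  have hsub : {x | t < circMax J f x} ⊆ {x | ∃ j ∈ J, t / 2 < circMean (2 ^ j) u x} := by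
    intro x hx
    obtain ⟨j, hj, hx⟩ := (lt_circMax ht.le).1 hx
    refine ⟨j, hj, ?_⟩
    have i := hun.integrable_shift (2 ^ j) x
    have : circMean (2 ^ j) f x ≤ circMean (2 ^ j) u x + t / 2 := by
      calc circMean (2 ^ j) f x
          ≤ ∫ θ, (u (x + (2 : ℝ) ^ j • circ θ) + t / 2) ∂angle := by
            refine integral_mono (hf.integrable_shift _ x) (i.add (integrable_const _)) fun θ => ?_
            have := le_max_left (f (x + (2 : ℝ) ^ j • circ θ) - t / 2) 0
            simp only [hu]
            linarith
        _ = _ := by rw [integral_add i (integrable_const _)]; simp [circMean]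
    linarith
  refine (measure_mono hsub).trans ((H u J (t / 2) hun huu hu0 (half_pos ht)).trans ?_)
  have e : (t / 2) ^ (-q) = 2 ^ q * t ^ (-q) := by
    rw [Real.div_rpow ht.le zero_le_two, Real.rpow_neg zero_le_two, div_inv_eq_mul, mul_comm]
  rw [e, ← mul_assoc, ENNReal.ofReal_mul (by positivity),
    ofReal_integral_eq_lintegral_ofReal (hun.rpow hu0 (by linarith)).integrable
      (Filter.Eventually.of_forall fun x => Real.rpow_nonneg (hu0 x) q)]
  gcongr with x
  by_cases hx : t < 2 * f x
  · rw [Set.indicator_of_mem (by exact hx)]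
    exact ENNReal.ofReal_le_ofReal (Real.rpow_le_rpow (hu0 x)
      (max_le (by linarith) (hf0 x)) (by linarith))
  · have : u x = 0 := max_eq_right (by linarith)
    rw [this, Real.zero_rpow (by linarith)]
    simp

/-- Strong type `(p, p)` bound for the planar dyadic circular maximal function. -/
lemma exists_strong_type {p : ℝ} (hp : 1 < p) : ∃ C : ℝ, 0 < C ∧
    ∀ (f : ℝ × ℝ → ℝ) (J : Finset ℤ), Nice f → UniformContinuous f → (∀ x, 0 ≤ f x) →
      ∫⁻ x, (circMax J f x : ℝ≥0∞) ^ p ≤ ENNReal.ofReal C * ∫⁻ x, ENNReal.ofReal (f x) ^ p := by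
  set q : ℝ := min 2 ((1 + p) / 2) with hqdef
  have hq : 1 < q := lt_min (by norm_num) (by linarith)
  have hq2 : q ≤ 2 := min_le_left _ _
  have hqp : q < p := (min_le_right _ _).trans_lt (by linarith)
  obtain ⟨C, hC, H⟩ := exists_weak_type hq hq2
  have hpq : 0 < p - q := by linarith
  refine ⟨p * (C * 2 ^ q * (2 ^ (p - q) / (p - q))), by positivity, fun f J hf hfu hf0 => ?_⟩
  have hm := measurable_circMax hf J
  have e0 : ∫⁻ x, (circMax J f x : ℝ≥0∞) ^ p = ∫⁻ x, ENNReal.ofReal ((circMax J f x : ℝ) ^ p) := by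
    refine lintegral_congr fun x => ?_
    rw [← ENNReal.ofReal_rpow_of_nonneg (NNReal.coe_nonneg _) (by linarith),
      ENNReal.ofReal_coe_nnreal]
  rw [e0, lintegral_rpow_eq_lintegral_meas_lt_mul volume
    (Filter.Eventually.of_forall fun x => NNReal.coe_nonneg _) hm.coe_nnreal_real.aemeasurable
    (by linarith)]
  set G : ℝ → ℝ × ℝ → ℝ≥0∞ := fun t x => {x | t < 2 * f x}.indicator
    (fun x => ENNReal.ofReal (f x ^ q)) x * ENNReal.ofReal (t ^ (p - 1 - q)) with hG
  have hGm : Measurable (Function.uncurry G) := by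
    refine Measurable.mul ?_ (by fun_prop)
    have : (fun a : ℝ × (ℝ × ℝ) => {x | a.1 < 2 * f x}.indicator
        (fun x => ENNReal.ofReal (f x ^ q)) a.2) =
        {a : ℝ × (ℝ × ℝ) | a.1 < 2 * f a.2}.indicator (fun a => ENNReal.ofReal (f a.2 ^ q)) := by
      funext a; simp [Set.indicator]
    rw [this]
    have hf2 : Measurable fun a : ℝ × (ℝ × ℝ) => f a.2 := hf.meas.comp measurable_snd
    exact (hf2.pow_const q).ennreal_ofReal.indicator
      (measurableSet_lt measurable_fst (hf2.const_mul 2))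
  have h1 : ∫⁻ t in Set.Ioi (0 : ℝ), volume {x | t < circMax J f x} * ENNReal.ofReal (t ^ (p - 1)) ≤
      ENNReal.ofReal (C * 2 ^ q) * ∫⁻ t in Set.Ioi (0 : ℝ), ∫⁻ x, G t x := by
    have hGm' : Measurable fun t => ∫⁻ x, G t x := hGm.lintegral_prod_right'
    rw [← lintegral_const_mul _ hGm']
    refine lintegral_mono_ae ((ae_restrict_iff' measurableSet_Ioi).2
      (Filter.Eventually.of_forall fun t ht => ?_))
    have ht : 0 < t := ht
    have := volume_lt_circMax_le hq H hC hf hfu hf0 J ht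
    have e1 : ∫⁻ x, G t x = (∫⁻ x, {x | t < 2 * f x}.indicator
        (fun x => ENNReal.ofReal (f x ^ q)) x) * ENNReal.ofReal (t ^ (p - 1 - q)) :=
      lintegral_mul_const _ ((hf.meas.pow_const q).ennreal_ofReal.indicator
        (measurableSet_lt measurable_const (hf.meas.const_mul 2)))
    have e2 : ENNReal.ofReal (t ^ (p - 1 - q)) =
        ENNReal.ofReal (t ^ (-q)) * ENNReal.ofReal (t ^ (p - 1)) := by
      rw [← ENNReal.ofReal_mul (by positivity), ← Real.rpow_add ht]; ring_nf
    calc _ ≤ _ := mul_le_mul_left this _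
      _ = _ := by
        rw [e1, e2, ENNReal.ofReal_mul (p := C * 2 ^ q) (by positivity)]; ring
  have h2 : ∫⁻ t in Set.Ioi (0 : ℝ), ∫⁻ x, G t x =
      ENNReal.ofReal (2 ^ (p - q) / (p - q)) * ∫⁻ x, ENNReal.ofReal (f x) ^ p := by
    rw [lintegral_lintegral_swap hGm.aemeasurable,
      ← lintegral_const_mul _ (hf.meas.ennreal_ofReal.pow_const p)]
    refine lintegral_congr fun x => ?_
    have e1 : ∀ t, G t x = ENNReal.ofReal (f x ^ q) * (Set.Iio (2 * f x)).indicator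
        (fun t => ENNReal.ofReal (t ^ (p - 1 - q))) t := by
      intro t
      by_cases h : t < 2 * f x <;> simp [hG, Set.indicator, h]
    simp only [e1]
    rw [lintegral_const_mul _ ((by fun_prop : Measurable fun t : ℝ =>
      ENNReal.ofReal (t ^ (p - 1 - q))).indicator measurableSet_Iio),
      lintegral_indicator measurableSet_Iio, Measure.restrict_restrict measurableSet_Iio,
      Set.inter_comm, Set.Ioi_inter_Iio, lintegral_rpow_Ioo (by linarith) (by linarith [hf0 x]),
      show p - 1 - q + 1 = p - q by ring, ENNReal.ofReal_rpow_of_nonneg (hf0 x) (by linarith),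
      ← ENNReal.ofReal_mul (Real.rpow_nonneg (hf0 x) q), ← ENNReal.ofReal_mul (by positivity),
      Real.mul_rpow zero_le_two (hf0 x)]
    congr 1
    rcases (hf0 x).eq_or_lt with h0 | h0
    · rw [← h0, Real.zero_rpow (by linarith : q ≠ 0), Real.zero_rpow (by linarith : p ≠ 0)]; simp
    · rw [show f x ^ p = f x ^ q * f x ^ (p - q) by rw [← Real.rpow_add h0]; ring_nf]
      ring
  calc _ ≤ ENNReal.ofReal p * (ENNReal.ofReal (C * 2 ^ q) * (ENNReal.ofReal (2 ^ (p - q) / (p - q)) *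
        ∫⁻ x, ENNReal.ofReal (f x) ^ p)) := by gcongr; exact h1.trans_eq (by rw [h2])
    _ = _ := by
      rw [ENNReal.ofReal_mul (p := p) (by linarith), ENNReal.ofReal_mul (p := C * 2 ^ q)
        (by positivity)]
      ring

end StrongType

lemma lintegral_rpow_le_of_prob {α : Type*} [MeasurableSpace α] {μ : Measure α}
    [IsProbabilityMeasure μ] {g : α → ℝ≥0∞} (hg : AEMeasurable g μ) {p : ℝ} (hp : 1 < p) :
    (∫⁻ a, g a ∂μ) ^ p ≤ ∫⁻ a, g a ^ p ∂μ := by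
  have h := ENNReal.lintegral_mul_le_Lp_mul_Lq μ (Real.HolderConjugate.conjExponent hp) hg
    (aemeasurable_const (b := (1 : ℝ≥0∞)))
  simp only [Pi.mul_apply, mul_one, ENNReal.one_rpow, lintegral_one, measure_univ] at h
  have h2 := ENNReal.rpow_le_rpow h (show 0 ≤ p by linarith)
  rwa [← ENNReal.rpow_mul, one_div_mul_cancel (by linarith), ENNReal.rpow_one] at h2

section Transference

variable {E : Type*} [NormedAddCommGroup E] [NormedSpace ℝ E] [MeasurableSpace E] [BorelSpace E]
  [SecondCountableTopology E]

/-- Averages of `F` over the ellipse centred at `z` with conjugate radii `r • a` and `r • b`. -/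
noncomputable def ellMean (F : E → ℝ) (a b : E) (r : ℝ) (z : E) : ℝ≥0∞ :=
  ∫⁻ θ, ENNReal.ofReal (F (z + r • (Real.cos θ • a + Real.sin θ • b))) ∂angle

/-- The dyadic maximal function along ellipses, over a finite set of scales. -/
noncomputable def ellMax (J : Finset ℤ) (F : E → ℝ) (a b : E) (z : E) : ℝ≥0∞ :=
  ⨆ j ∈ J, ellMean F a b (2 ^ j) z

lemma measurable_ellMax {F : E → ℝ} (hF : Continuous F) (J : Finset ℤ) :
    Measurable fun w : E × (E × E) => ellMax J F w.2.1 w.2.2 w.1 := by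
  unfold ellMax
  refine Measurable.biSup _ J.countable_toSet fun j _ => ?_
  unfold ellMean
  refine Measurable.lintegral_prod_right' (f := fun q : (E × (E × E)) × ℝ => ENNReal.ofReal
    (F (q.1.1 + (2 : ℝ) ^ j • (Real.cos q.2 • q.1.2.1 + Real.sin q.2 • q.1.2.2)))) ?_
  exact (by fun_prop : Continuous _).measurable.ennreal_ofReal

/-- Planar cutoff equal to `1` for `‖v‖ ≤ 2 * K` and vanishing for `‖v‖ ≥ 3 * K`. -/
noncomputable def cutoff (K : ℝ) (v : ℝ × ℝ) : ℝ := max 0 (min 1 (3 - ‖v‖ / K))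

lemma continuous_cutoff (K : ℝ) : Continuous (cutoff K) := by
  unfold cutoff
  fun_prop

lemma cutoff_nonneg (K : ℝ) (v : ℝ × ℝ) : 0 ≤ cutoff K v := le_max_left _ _

lemma cutoff_le_one (K : ℝ) (v : ℝ × ℝ) : cutoff K v ≤ 1 :=
  max_le zero_le_one (min_le_left _ _)

lemma cutoff_eq_one {K : ℝ} (hK : 0 < K) {v : ℝ × ℝ} (hv : ‖v‖ ≤ 2 * K) : cutoff K v = 1 := by
  have : ‖v‖ / K ≤ 2 := by rwa [div_le_iff₀ hK]
  rw [cutoff, min_eq_left (by linarith), max_eq_right zero_le_one]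

lemma norm_le_of_cutoff_ne_zero {K : ℝ} (hK : 0 < K) {v : ℝ × ℝ} (hv : cutoff K v ≠ 0) :
    ‖v‖ ≤ 3 * K := by
  by_contra! h
  refine hv (max_eq_left ((min_le_right _ _).trans ?_))
  have : 3 ≤ ‖v‖ / K := by rw [le_div_iff₀ hK]; exact h.le
  linarith

lemma volume_planar_closedBall {R : ℝ} (hR : 0 ≤ R) :
    volume (Metric.closedBall (0 : ℝ × ℝ) R) = ENNReal.ofReal (4 * R ^ 2) := by
  rw [← Prod.mk_zero_zero, ← closedBall_prod_same, Measure.volume_eq_prod, Measure.prod_prod,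
    Real.volume_closedBall, ← ENNReal.ofReal_mul (by linarith)]
  ring_nf

lemma lintegral_ellMax_rpow_le_of_planar {p C : ℝ} (hp : 1 < p)
    (H : ∀ (f : ℝ × ℝ → ℝ) (J : Finset ℤ), Nice f → UniformContinuous f → (∀ x, 0 ≤ f x) →
      ∫⁻ x, (circMax J f x : ℝ≥0∞) ^ p ≤ ENNReal.ofReal C * ∫⁻ x, ENNReal.ofReal (f x) ^ p)
    {μ : Measure E} [SFinite μ] [μ.IsAddRightInvariant] {F : E → ℝ} (hF : Continuous F)
    (hF0 : ∀ z, 0 ≤ F z) (J : Finset ℤ) (a b : E) :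
    ∫⁻ z, ellMax J F a b z ^ p ∂μ ≤ 9 * ENNReal.ofReal C * ∫⁻ z, ENNReal.ofReal (F z) ^ p ∂μ := by
  obtain ⟨K, hK, hJK⟩ : ∃ K : ℝ, 0 < K ∧ ∀ j ∈ J, (2 : ℝ) ^ j ≤ K := by
    obtain ⟨M, hM⟩ := J.bddAbove
    exact ⟨2 ^ M, by positivity, fun j hj => zpow_le_zpow_right₀ (by norm_num) (hM hj)⟩
  set L : ℝ × ℝ → E := fun v => v.1 • a + v.2 • b with hL
  have hLc : Continuous L := by fun_prop
  set B := Metric.closedBall (0 : ℝ × ℝ) K with hB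
  set B' := Metric.closedBall (0 : ℝ × ℝ) (3 * K) with hB'
  set u : E → ℝ × ℝ → ℝ := fun z v => F (z + L v) * cutoff K v with hu
  have huc : ∀ z, Continuous (u z) := fun z => by
    have := continuous_cutoff K
    fun_prop
  have hus : ∀ z, HasCompactSupport (u z) := fun z =>
    HasCompactSupport.of_support_subset_isCompact (isCompact_closedBall (0 : ℝ × ℝ) (3 * K))
      fun v hv => by simpa using norm_le_of_cutoff_ne_zero hK (right_ne_zero_of_mul hv)
  have hun : ∀ z, Nice (u z) := fun z => by
    obtain ⟨c, hc⟩ := (huc z).bounded_above_of_compact_support (hus z)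
    exact ⟨(huc z).measurable, ⟨c, hc⟩, ⟨3 * K, fun v hv =>
      norm_le_of_cutoff_ne_zero hK (right_ne_zero_of_mul hv)⟩⟩
  have hu0 : ∀ z v, 0 ≤ u z v := fun z v => mul_nonneg (hF0 _) (cutoff_nonneg K v)
  have hmS : Measurable fun z => ellMax J F a b z :=
    (measurable_ellMax hF J).comp (g := fun w : E × (E × E) => ellMax J F w.2.1 w.2.2 w.1)
      (f := fun z => (z, (a, b))) (measurable_id.prodMk measurable_const)
  have hmF : Measurable fun z => ENNReal.ofReal (F z) ^ p :=
    hF.measurable.ennreal_ofReal.pow_const p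
  have hpt : ∀ z, ∀ v ∈ B, ellMax J F a b (z + L v) ≤ circMax J (u z) v := by
    intro z v hv
    refine iSup₂_le fun j hj => ?_
    have h1 : ellMean F a b (2 ^ j) (z + L v) = ENNReal.ofReal (circMean (2 ^ j) (u z) v) := by
      rw [circMean, ofReal_integral_eq_lintegral_ofReal ((hun z).integrable_shift _ _)
        (Filter.Eventually.of_forall fun _ => hu0 z _), ellMean]
      refine lintegral_congr fun θ => ?_
      have h2 : ‖v + (2 : ℝ) ^ j • circ θ‖ ≤ 2 * K := by
        have h3 := norm_smul_circ_le ((2 : ℝ) ^ j) θ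
        rw [abs_of_nonneg (by positivity)] at h3
        have h4 : ‖v‖ ≤ K := by simpa [hB] using hv
        linarith [norm_add_le v ((2 : ℝ) ^ j • circ θ), hJK j hj]
      simp only [hu]
      rw [cutoff_eq_one hK h2, mul_one]
      congr 2
      simp only [hL, circ, Prod.fst_add, Prod.snd_add, Prod.smul_mk, smul_eq_mul]
      module
    rw [h1]
    change ((circMean (2 ^ j) (u z) v).toNNReal : ℝ≥0∞) ≤ _
    exact_mod_cast Finset.le_sup (f := fun j => (circMean (2 ^ j) (u z) v).toNNReal) hj
  have hpos : volume B ≠ 0 := by rw [hB, volume_planar_closedBall hK.le]; simp; positivity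
  have hfin : volume B ≠ ∞ := by
    rw [hB, volume_planar_closedBall hK.le]
    exact ENNReal.ofReal_ne_top
  have h9 : volume B' = 9 * volume B := by
    rw [hB, hB', volume_planar_closedBall hK.le, volume_planar_closedBall (by positivity),
      show (9 : ℝ≥0∞) = ENNReal.ofReal 9 by simp, ← ENNReal.ofReal_mul (by norm_num)]
    congr 1; ring
  have key : volume B * ∫⁻ z, ellMax J F a b z ^ p ∂μ ≤
      volume B * (9 * ENNReal.ofReal C * ∫⁻ z, ENNReal.ofReal (F z) ^ p ∂μ) := by
    have hz : ∀ z, ∫⁻ v in B, ellMax J F a b (z + L v) ^ p ≤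
        ENNReal.ofReal C * ∫⁻ v in B', ENNReal.ofReal (F (z + L v)) ^ p := by
      intro z
      calc ∫⁻ v in B, ellMax J F a b (z + L v) ^ p
          ≤ ∫⁻ v in B, (circMax J (u z) v : ℝ≥0∞) ^ p :=
            setLIntegral_mono' Metric.isClosed_closedBall.measurableSet fun v hv =>
              ENNReal.rpow_le_rpow (hpt z v hv) (by linarith)
        _ ≤ ∫⁻ v, (circMax J (u z) v : ℝ≥0∞) ^ p := setLIntegral_le_lintegral _ _
        _ ≤ ENNReal.ofReal C * ∫⁻ v, ENNReal.ofReal (u z v) ^ p :=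
            H _ J (hun z) ((hus z).uniformContinuous_of_continuous (huc z)) (hu0 z)
        _ ≤ _ := by
            rw [← lintegral_indicator Metric.isClosed_closedBall.measurableSet]
            gcongr with v
            by_cases hv : v ∈ B'
            · rw [Set.indicator_of_mem hv]
              refine ENNReal.rpow_le_rpow (ENNReal.ofReal_le_ofReal ?_) (by linarith)
              · exact mul_le_of_le_one_right (hF0 _) (cutoff_le_one K v)
            · have : cutoff K v = 0 := by
                by_contra h
                exact hv (by simpa [hB'] using norm_le_of_cutoff_ne_zero hK h)
              simp [hu, this, show 0 < p by linarith]
    have hzL : Continuous fun q : E × (ℝ × ℝ) => q.1 + L q.2 := by fun_prop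
    have hSL : Measurable fun q : E × (ℝ × ℝ) => ellMax J F a b (q.1 + L q.2) ^ p :=
      (hmS.comp (g := fun z => ellMax J F a b z) hzL.measurable).pow_const p
    have hFL : Measurable fun q : E × (ℝ × ℝ) => ENNReal.ofReal (F (q.1 + L q.2)) ^ p :=
      hmF.comp (g := fun z => ENNReal.ofReal (F z) ^ p) hzL.measurable
    have swapS := lintegral_lintegral_swap (μ := μ) (ν := volume.restrict B)
      (f := fun z v => ellMax J F a b (z + L v) ^ p) hSL.aemeasurable
    have swapF := lintegral_lintegral_swap (μ := μ) (ν := volume.restrict B')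
      (f := fun z v => ENNReal.ofReal (F (z + L v)) ^ p) hFL.aemeasurable
    calc volume B * ∫⁻ z, ellMax J F a b z ^ p ∂μ
        = ∫⁻ v in B, ∫⁻ z, ellMax J F a b (z + L v) ^ p ∂μ := by
          have : ∀ v, ∫⁻ z, ellMax J F a b (z + L v) ^ p ∂μ = ∫⁻ z, ellMax J F a b z ^ p ∂μ :=
            fun v => lintegral_add_right_eq_self (fun z => ellMax J F a b z ^ p) (L v)
          simp only [this, setLIntegral_const, mul_comm]
      _ = ∫⁻ z, (∫⁻ v in B, ellMax J F a b (z + L v) ^ p) ∂μ := swapS.symm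
      _ ≤ ∫⁻ z, ENNReal.ofReal C * (∫⁻ v in B', ENNReal.ofReal (F (z + L v)) ^ p) ∂μ :=
          lintegral_mono hz
      _ = ENNReal.ofReal C * ∫⁻ v in B', ∫⁻ z, ENNReal.ofReal (F (z + L v)) ^ p ∂μ := by
          rw [lintegral_const_mul' _ _ ENNReal.ofReal_ne_top, swapF]
      _ = volume B * (9 * ENNReal.ofReal C * ∫⁻ z, ENNReal.ofReal (F z) ^ p ∂μ) := by
          have : ∀ v, ∫⁻ z, ENNReal.ofReal (F (z + L v)) ^ p ∂μ =
              ∫⁻ z, ENNReal.ofReal (F z) ^ p ∂μ :=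
            fun v => lintegral_add_right_eq_self (fun z => ENNReal.ofReal (F z) ^ p) (L v)
          simp only [this, setLIntegral_const, h9]
          ring
  exact (ENNReal.mul_le_mul_iff_right hpos hfin).1 key

end Transference

section Rotation

variable {I : Type*} [Fintype I]

/-- An orthogonal complex structure on a Euclidean space acting by signed permutation of the
coordinates. -/
structure SignedInvolution (I : Type*) where
  perm : I → I
  sign : I → ℝ
  perm_perm : ∀ i, perm (perm i) = i
  sign_sq : ∀ i, sign i ^ 2 = 1
  sign_perm : ∀ i, sign (perm i) = -sign i

/-- The linear map defined by a signed involution. -/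
noncomputable def SignedInvolution.toLin (S : SignedInvolution I) :
    EuclideanSpace ℝ I →ₗ[ℝ] EuclideanSpace ℝ I where
  toFun w := WithLp.toLp 2 fun i => S.sign i * w (S.perm i)
  map_add' v w := by ext i; simp [mul_add]
  map_smul' c w := by ext i; simp; ring

omit [Fintype I] in
lemma SignedInvolution.toLin_apply (S : SignedInvolution I) (w : EuclideanSpace ℝ I) (i : I) :
    S.toLin w i = S.sign i * w (S.perm i) := rfl

lemma SignedInvolution.sum_perm (S : SignedInvolution I) (g : I → ℝ) :
    ∑ i, g (S.perm i) = ∑ i, g i :=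
  Equiv.sum_comp (Function.Involutive.toPerm S.perm S.perm_perm) g

/-- Rotation by the angle `θ` in the complex structure. -/
noncomputable def SignedInvolution.rot (S : SignedInvolution I) (θ : ℝ) :
    EuclideanSpace ℝ I →ₗᵢ[ℝ] EuclideanSpace ℝ I where
  toLinearMap := Real.cos θ • LinearMap.id + Real.sin θ • S.toLin
  norm_map' w := by
    rw [EuclideanSpace.norm_eq, EuclideanSpace.norm_eq]
    congr 1
    have h1 : ∑ i, w (S.perm i) ^ 2 = ∑ i, w i ^ 2 := S.sum_perm fun i => w i ^ 2
    have h2 : ∑ i, S.sign i * w i * w (S.perm i) = 0 := by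
      have := S.sum_perm fun i => S.sign i * w i * w (S.perm i)
      have h3 : ∀ i, S.sign (S.perm i) * w (S.perm i) * w (S.perm (S.perm i)) =
          -(S.sign i * w i * w (S.perm i)) := fun i => by
        rw [S.sign_perm, S.perm_perm]; ring
      simp only [h3, Finset.sum_neg_distrib] at this
      linarith
    have h4 : ∀ i, ‖((Real.cos θ • LinearMap.id + Real.sin θ • S.toLin :
        EuclideanSpace ℝ I →ₗ[ℝ] EuclideanSpace ℝ I) w) i‖ ^ 2 =
        Real.cos θ ^ 2 * w i ^ 2 + 2 * Real.cos θ * Real.sin θ * (S.sign i * w i * w (S.perm i)) +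
          Real.sin θ ^ 2 * w (S.perm i) ^ 2 := by
      intro i
      simp only [LinearMap.add_apply, LinearMap.smul_apply, LinearMap.id_apply, PiLp.add_apply,
        PiLp.smul_apply, smul_eq_mul, S.toLin_apply, Real.norm_eq_abs, sq_abs]
      linear_combination Real.sin θ ^ 2 * w (S.perm i) ^ 2 * S.sign_sq i
    rw [Finset.sum_congr rfl fun i _ => h4 i]
    simp only [Finset.sum_add_distrib, ← Finset.mul_sum, h1, h2, Real.norm_eq_abs, sq_abs]
    linear_combination (∑ i, w i ^ 2) * Real.cos_sq_add_sin_sq θ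

lemma SignedInvolution.rot_apply (S : SignedInvolution I) (θ : ℝ) (w : EuclideanSpace ℝ I) :
    S.rot θ w = Real.cos θ • w + Real.sin θ • S.toLin w := rfl

/-- The uniform probability measure on the unit ball. -/
noncomputable def unifBall (I : Type*) [Fintype I] : Measure (EuclideanSpace ℝ I) :=
  (volume (Metric.closedBall (0 : EuclideanSpace ℝ I) 1))⁻¹ •
    volume.restrict (Metric.closedBall (0 : EuclideanSpace ℝ I) 1)

lemma volume_unit_ball_ne_zero :
    volume (Metric.closedBall (0 : EuclideanSpace ℝ I) 1) ≠ 0 :=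
  (Metric.measure_closedBall_pos volume _ one_pos).ne'

lemma volume_unit_ball_ne_top :
    volume (Metric.closedBall (0 : EuclideanSpace ℝ I) 1) ≠ ∞ :=
  measure_closedBall_lt_top.ne

instance : IsProbabilityMeasure (unifBall I) := ⟨by
  rw [unifBall, Measure.smul_apply, Measure.restrict_apply MeasurableSet.univ, Set.univ_inter,
    smul_eq_mul, ENNReal.inv_mul_cancel volume_unit_ball_ne_zero volume_unit_ball_ne_top]⟩

lemma SignedInvolution.measurePreserving_rot (S : SignedInvolution I) (θ : ℝ) :
    MeasurePreserving (S.rot θ) (unifBall I) (unifBall I) := by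
  have h1 : MeasurePreserving (S.rot θ) (volume : Measure (EuclideanSpace ℝ I)) volume :=
    ((S.rot θ).toLinearIsometryEquiv rfl).measurePreserving
  have h2 := h1.restrict_preimage
    (s := Metric.closedBall (0 : EuclideanSpace ℝ I) 1) Metric.isClosed_closedBall.measurableSet
  have h3 : S.rot θ ⁻¹' Metric.closedBall (0 : EuclideanSpace ℝ I) 1 =
      Metric.closedBall (0 : EuclideanSpace ℝ I) 1 := by
    ext w; simp
  rw [h3] at h2
  exact h2.smul_measure _

lemma SignedInvolution.continuous_rot (S : SignedInvolution I) :
    Continuous fun q : EuclideanSpace ℝ I × ℝ => S.rot q.2 q.1 := by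
  have : Continuous S.toLin := S.toLin.continuous_of_finiteDimensional
  simp only [S.rot_apply]
  fun_prop

lemma SignedInvolution.lintegral_rot (S : SignedInvolution I) {g : EuclideanSpace ℝ I → ℝ≥0∞}
    (hg : Measurable g) :
    ∫⁻ w, ∫⁻ θ, g (S.rot θ w) ∂angle ∂(unifBall I) = ∫⁻ w, g w ∂(unifBall I) := by
  have hm : Measurable fun q : EuclideanSpace ℝ I × ℝ => g (S.rot q.2 q.1) :=
    hg.comp S.continuous_rot.measurable
  rw [lintegral_lintegral_swap (f := fun w θ => g (S.rot θ w)) hm.aemeasurable]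
  have : ∀ θ, ∫⁻ w, g (S.rot θ w) ∂(unifBall I) = ∫⁻ w, g w ∂(unifBall I) := fun θ =>
    (S.measurePreserving_rot θ).lintegral_comp hg
  simp [this]

end Rotation

section Lifting

variable {I : Type*} [Fintype I]
variable {E : Type*} [NormedAddCommGroup E] [NormedSpace ℝ E] [MeasurableSpace E] [BorelSpace E]
  [SecondCountableTopology E]

/-- The dyadic maximal function of averages over the image of a ball. -/
noncomputable def liftMax (J : Finset ℤ) (F : E → ℝ) (π : EuclideanSpace ℝ I →L[ℝ] E) (z : E) :
    ℝ≥0∞ :=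
  ⨆ j ∈ J, ∫⁻ w, ENNReal.ofReal (F (z + (2 : ℝ) ^ j • π w)) ∂(unifBall I)

omit [SecondCountableTopology E] in
lemma measurable_liftMax {F : E → ℝ} (hF : Continuous F) (J : Finset ℤ)
    (π : EuclideanSpace ℝ I →L[ℝ] E) : Measurable (liftMax J F π) := by
  unfold liftMax
  refine Measurable.biSup _ J.countable_toSet fun j _ => ?_
  refine Measurable.lintegral_prod_right' (f := fun q : E × EuclideanSpace ℝ I => ENNReal.ofReal
    (F (q.1 + (2 : ℝ) ^ j • π q.2))) ?_
  exact (by fun_prop : Continuous _).measurable.ennreal_ofReal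

omit [MeasurableSpace E] [BorelSpace E] [SecondCountableTopology E] in
lemma liftMax_le_lintegral_ellMax (S : SignedInvolution I) {F : E → ℝ} (hF : Continuous F)
    (J : Finset ℤ) (π : EuclideanSpace ℝ I →L[ℝ] E) (z : E) :
    liftMax J F π z ≤ ∫⁻ w, ellMax J F (π w) (π (S.toLin w)) z ∂(unifBall I) := by
  refine iSup₂_le fun j hj => ?_
  have hm : Measurable fun w : EuclideanSpace ℝ I =>
      ENNReal.ofReal (F (z + (2 : ℝ) ^ j • π w)) :=
    (by fun_prop : Continuous fun w => F (z + (2 : ℝ) ^ j • π w)).measurable.ennreal_ofReal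
  rw [← S.lintegral_rot hm]
  refine lintegral_mono fun w => ?_
  refine le_trans (le_of_eq ?_) (le_iSup₂ (f := fun j (_ : j ∈ J) =>
    ellMean F (π w) (π (S.toLin w)) (2 ^ j) z) j hj)
  refine lintegral_congr fun θ => ?_
  rw [S.rot_apply, map_add, map_smul, map_smul]

lemma measurable_ellMax_toLin (S : SignedInvolution I) {F : E → ℝ} (hF : Continuous F)
    (J : Finset ℤ) (π : EuclideanSpace ℝ I →L[ℝ] E) :
    Measurable fun q : E × EuclideanSpace ℝ I => ellMax J F (π q.2) (π (S.toLin q.2)) q.1 := by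
  have h1 : Continuous fun w : EuclideanSpace ℝ I => π w := π.continuous
  have h2 : Continuous fun w : EuclideanSpace ℝ I => π (S.toLin w) :=
    π.continuous.comp S.toLin.continuous_of_finiteDimensional
  generalize hu : (fun w : EuclideanSpace ℝ I => π w) = u at h1
  generalize hv : (fun w : EuclideanSpace ℝ I => π (S.toLin w)) = v at h2
  have h3 : Measurable fun q : E × EuclideanSpace ℝ I => ellMax J F (u q.2) (v q.2) q.1 :=
    (measurable_ellMax hF J).comp (f := fun q : E × EuclideanSpace ℝ I => (q.1, (u q.2, v q.2)))
      (measurable_fst.prodMk ((h1.measurable.comp measurable_snd).prodMk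
        (h2.measurable.comp measurable_snd)))
  subst hu hv
  exact h3

/-- Maximal bound for averages over images of balls, from the bound for circular means. -/
lemma lintegral_liftMax_rpow_le_of_planar {p : ℝ} (hp : 1 < p) {C : ℝ}
    (H : ∀ (f : ℝ × ℝ → ℝ) (J : Finset ℤ), Nice f → UniformContinuous f → (∀ x, 0 ≤ f x) →
      ∫⁻ x, (circMax J f x : ℝ≥0∞) ^ p ≤ ENNReal.ofReal C * ∫⁻ x, ENNReal.ofReal (f x) ^ p)
    {μ : Measure E} [SFinite μ] [μ.IsAddRightInvariant]
    (S : SignedInvolution I) {F : E → ℝ} (hF : Continuous F) (hF0 : ∀ z, 0 ≤ F z) (J : Finset ℤ)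
    (π : EuclideanSpace ℝ I →L[ℝ] E) :
    ∫⁻ z, liftMax J F π z ^ p ∂μ ≤ 9 * ENNReal.ofReal C * ∫⁻ z, ENNReal.ofReal (F z) ^ p ∂μ := by
  have hm := measurable_ellMax_toLin S hF J π
  have hmp : Measurable fun q : E × EuclideanSpace ℝ I =>
    ellMax J F (π q.2) (π (S.toLin q.2)) q.1 ^ p := hm.pow_const p
  have hmz : ∀ z, Measurable fun w : EuclideanSpace ℝ I =>
      ellMax J F (π w) (π (S.toLin w)) z := fun z =>
    hm.comp (g := fun q : E × EuclideanSpace ℝ I =>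
          ellMax J F (π q.2) (π (S.toLin q.2)) q.1) (f := fun w => (z, w)) measurable_prodMk_left
  have swap := lintegral_lintegral_swap (μ := μ) (ν := unifBall I)
    (f := fun z w => ellMax J F (π w) (π (S.toLin w)) z ^ p) hmp.aemeasurable
  calc ∫⁻ z, liftMax J F π z ^ p ∂μ
      ≤ ∫⁻ z, ∫⁻ w, ellMax J F (π w) (π (S.toLin w)) z ^ p ∂(unifBall I) ∂μ := by
        refine lintegral_mono fun z => ?_
        refine (ENNReal.rpow_le_rpow (liftMax_le_lintegral_ellMax S hF J π z)
          (by linarith)).trans ?_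
        exact lintegral_rpow_le_of_prob (hmz z).aemeasurable hp
    _ = ∫⁻ w, ∫⁻ z, ellMax J F (π w) (π (S.toLin w)) z ^ p ∂μ ∂(unifBall I) := swap
    _ ≤ ∫⁻ w, 9 * ENNReal.ofReal C * ∫⁻ z, ENNReal.ofReal (F z) ^ p ∂μ ∂(unifBall I) :=
        lintegral_mono fun w => lintegral_ellMax_rpow_le_of_planar hp H hF hF0 J _ _
    _ = _ := by
        rw [lintegral_const, measure_univ, mul_one]

end Lifting

/-- A finite set of even cardinality carries a signed involution. -/
lemma exists_signedInvolution (I : Type*) [Fintype I] (h : Even (Fintype.card I)) :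
    Nonempty (SignedInvolution I) := by
  obtain ⟨m, hm⟩ := h
  have e : I ≃ Fin m ⊕ Fin m := Fintype.equivOfCardEq (by simp [hm])
  refine ⟨⟨fun i => e.symm (e i).swap, fun i => Sum.elim (fun _ => 1) (fun _ => -1) (e i),
    fun i => by simp, fun i => ?_, fun i => ?_⟩⟩
  · rcases e i <;> simp
  · simp only [Equiv.apply_symm_apply]
    rcases e i <;> simp

section Tent

/-- The one-dimensional tent function. -/
noncomputable def tent (t : ℝ) : ℝ := max 0 (1 - |t|)

lemma continuous_tent : Continuous tent := by unfold tent; fun_prop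

lemma tent_nonneg (t : ℝ) : 0 ≤ tent t := le_max_left _ _

lemma tent_neg (t : ℝ) : tent (-t) = tent t := by simp [tent]

lemma abs_le_one_of_tent_ne_zero {t : ℝ} (h : tent t ≠ 0) : |t| < 1 := by
  by_contra! h1
  exact h (max_eq_left (by linarith))

lemma hasCompactSupport_tent : HasCompactSupport tent :=
  HasCompactSupport.of_support_subset_isCompact (isCompact_Icc (a := (-1 : ℝ)) (b := 1))
    fun _ ht => abs_le.1 (abs_le_one_of_tent_ne_zero ht).le

lemma integrable_tent : Integrable tent :=
  continuous_tent.integrable_of_hasCompactSupport hasCompactSupport_tent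

lemma integral_tent : ∫ t, tent t = 1 := by
  have h1 : ∫ t, tent t = 2 * ∫ t in Set.Ioi 0, max 0 (1 - t) :=
    integral_comp_abs (f := fun s => max 0 (1 - s))
  rw [h1, setIntegral_eq_of_subset_of_forall_sdiff_eq_zero
    (s := Set.Ioc (0 : ℝ) 1) measurableSet_Ioi Set.Ioc_subset_Ioi_self]
  · have h2 : ∫ t in Set.Ioc (0 : ℝ) 1, max 0 (1 - t) = ∫ t in (0 : ℝ)..1, (1 - t) := by
      rw [intervalIntegral.integral_of_le zero_le_one]
      refine setIntegral_congr_fun measurableSet_Ioc fun t ht => ?_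
      exact max_eq_right (by linarith [ht.2])
    rw [h2, intervalIntegral.integral_sub (by simp) (by simp)]
    norm_num
  · intro t ht
    simp only [Set.mem_sdiff, Set.mem_Ioi, Set.mem_Ioc, not_and, not_le] at ht
    exact max_eq_left (by linarith [ht.2 ht.1])

lemma tent_fract (t : ℝ) : tent (t - ⌊t⌋) = 1 - Int.fract t := by
  rw [← Int.fract, tent, abs_of_nonneg (Int.fract_nonneg t)]
  exact max_eq_right (by linarith [Int.fract_lt_one t])

lemma tent_fract_sub_one (t : ℝ) : tent (t - (⌊t⌋ + 1 : ℤ)) = Int.fract t := by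
  have : t - (⌊t⌋ + 1 : ℤ) = Int.fract t - 1 := by rw [Int.fract]; push_cast; ring
  rw [this, tent, abs_of_nonpos (by linarith [Int.fract_lt_one t])]
  rw [max_eq_right (by linarith [Int.fract_nonneg t])]
  ring

variable {d : ℕ}

/-- The tensor product tent function. -/
noncomputable def tents (z : Fin d → ℝ) : ℝ := ∏ i, tent (z i)

lemma continuous_tents : Continuous (tents (d := d)) :=
  continuous_finsetProd _ fun i _ => continuous_tent.comp (continuous_apply i)

lemma tents_nonneg (z : Fin d → ℝ) : 0 ≤ tents z := Finset.prod_nonneg fun _ _ => tent_nonneg _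

lemma tents_neg (z : Fin d → ℝ) : tents (-z) = tents z := by
  simp [tents, tent_neg]

lemma abs_le_one_of_tents_ne_zero {z : Fin d → ℝ} (h : tents z ≠ 0) (i : Fin d) : |z i| < 1 :=
  abs_le_one_of_tent_ne_zero (Finset.prod_ne_zero_iff.1 h i (Finset.mem_univ i))

lemma lintegral_tents : ∫⁻ z : Fin d → ℝ, ENNReal.ofReal (tents z) = 1 := by
  have hi : Integrable (tents (d := d)) := Integrable.fintype_prod fun _ => integrable_tent
  rw [← ofReal_integral_eq_lintegral_ofReal hi (Filter.Eventually.of_forall tents_nonneg)]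
  unfold tents
  rw [integral_fintype_prod_volume_eq_prod (fun _ => tent)]
  simp [integral_tent]

/-- The coordinatewise cast of a lattice point. -/
def latticeCast (y : Fin d → ℤ) : Fin d → ℝ := fun i => y i

/-- The vertices of the lattice cube containing `z`. -/
noncomputable def corners (z : Fin d → ℝ) : Finset (Fin d → ℤ) :=
  Fintype.piFinset fun i => {⌊z i⌋, ⌊z i⌋ + 1}

lemma sum_corners (z : Fin d → ℝ) (g : Fin d → ℤ → ℝ) :
    ∑ y ∈ corners z, tents (z - latticeCast y) * ∏ i, g i (y i) =
      ∏ i, ((1 - Int.fract (z i)) * g i ⌊z i⌋ + Int.fract (z i) * g i (⌊z i⌋ + 1)) := by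
  have h : ∀ i, (1 - Int.fract (z i)) * g i ⌊z i⌋ + Int.fract (z i) * g i (⌊z i⌋ + 1) =
      ∑ b ∈ ({⌊z i⌋, ⌊z i⌋ + 1} : Finset ℤ), tent (z i - b) * g i b := by
    intro i
    rw [Finset.sum_pair (by simp), tent_fract, tent_fract_sub_one]
  simp_rw [h]
  rw [Finset.prod_univ_sum, corners]
  refine Finset.sum_congr rfl fun y _ => ?_
  rw [Finset.prod_mul_distrib]
  rfl

lemma sum_corners_tents (z : Fin d → ℝ) : ∑ y ∈ corners z, tents (z - latticeCast y) = 1 := by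
  have := sum_corners z fun _ _ => 1
  simpa using this

lemma mem_corners_of_tents_ne_zero {z : Fin d → ℝ} {y : Fin d → ℤ}
    (h : tents (z - latticeCast y) ≠ 0) : y ∈ corners z := by
  rw [corners, Fintype.mem_piFinset]
  intro i
  have h1 : |z i - y i| < 1 := abs_le_one_of_tents_ne_zero h i
  rw [abs_lt] at h1
  have h2 : ⌊z i⌋ ≤ y i := by
    have : ⌊z i⌋ < y i + 1 := Int.floor_lt.2 (by push_cast; linarith)
    omega
  have h3 : y i - 1 ≤ ⌊z i⌋ := Int.le_floor.2 (by push_cast; linarith)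
  simp only [Finset.mem_insert, Finset.mem_singleton]
  omega

lemma sum_tents_le_one (z : Fin d → ℝ) (Y : Finset (Fin d → ℤ)) :
    ∑ y ∈ Y, tents (z - latticeCast y) ≤ 1 := by
  rw [← sum_corners_tents z]
  classical
  rw [← Finset.sum_filter_ne_zero]
  refine Finset.sum_le_sum_of_subset_of_nonneg (fun y hy => ?_) fun _ _ _ => tents_nonneg _
  exact mem_corners_of_tents_ne_zero (Finset.mem_filter.1 hy).2

end Tent

section LatticeCount

variable {d : ℕ}

lemma finite_latticeBallSet (d : ℕ) (N : ℝ) : (latticeBallSet d N).Finite := by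
  refine (Set.Finite.pi' (t := fun _ : Fin d => Set.Icc (-⌈|N|⌉) ⌈|N|⌉)
    fun _ => Set.finite_Icc _ _).subset fun y hy i => ?_
  have h1 : ((y i : ℝ)) ^ 2 ≤ N ^ 2 :=
    (Finset.single_le_sum (f := fun j => ((y j : ℝ)) ^ 2) (fun _ _ => sq_nonneg _)
      (Finset.mem_univ i)).trans hy
  have h2 := abs_le.1 ((sq_le_sq.1 h1).trans (Int.le_ceil |N|))
  exact ⟨by exact_mod_cast h2.1, by exact_mod_cast h2.2⟩

lemma ncard_latticeBallSet_pos (d : ℕ) (N : ℝ) : 0 < (latticeBallSet d N).ncard := by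
  rw [Set.ncard_pos (finite_latticeBallSet d N)]
  exact ⟨0, by simpa [latticeBallSet] using sq_nonneg N⟩

lemma exp_le_one_add_add_sq {t : ℝ} (ht : |t| ≤ 1) : Real.exp t ≤ 1 + t + t ^ 2 := by
  have := (abs_le.1 (Real.abs_exp_sub_one_sub_id_le ht)).2
  linarith

/-- Exponential moments of randomized rounding. -/
lemma sum_corners_exp_le (z a : Fin d → ℝ) (ha : ∑ i, a i ^ 2 ≤ 1) :
    ∑ y ∈ corners z, tents (z - latticeCast y) * Real.exp (∑ i, a i * (y i - z i)) ≤
      Real.exp 1 := by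
  simp_rw [Real.exp_sum]
  rw [sum_corners z fun i b => Real.exp (a i * (b - z i))]
  have ha1 : ∀ i, |a i| ≤ 1 := fun i => by
    have := (Finset.single_le_sum (f := fun j => a j ^ 2) (fun _ _ => sq_nonneg _)
      (Finset.mem_univ i)).trans ha
    exact (sq_le_one_iff_abs_le_one _).1 this
  calc _ ≤ ∏ i, Real.exp (a i ^ 2) := by
        refine Finset.prod_le_prod (fun i _ => ?_) fun i _ => ?_
        · have := Int.fract_nonneg (z i)
          have := Int.fract_lt_one (z i)
          have : 0 ≤ 1 - Int.fract (z i) := by linarith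
          positivity
        · have h0 := Int.fract_nonneg (z i)
          have h1 := Int.fract_lt_one (z i)
          have e1 : a i * ((⌊z i⌋ : ℝ) - z i) = -(a i * Int.fract (z i)) := by
            rw [Int.fract]; ring
          have e2 : a i * (((⌊z i⌋ + 1 : ℤ) : ℝ) - z i) = a i * (1 - Int.fract (z i)) := by
            rw [Int.fract]; push_cast; ring
          rw [e1, e2]
          set t := Int.fract (z i)
          have b1 : Real.exp (-(a i * t)) ≤ 1 + -(a i * t) + (-(a i * t)) ^ 2 :=
            exp_le_one_add_add_sq (by
              rw [abs_neg, abs_mul, abs_of_nonneg h0]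
              exact mul_le_one₀ (ha1 i) h0 h1.le)
          have b2 : Real.exp (a i * (1 - t)) ≤ 1 + a i * (1 - t) + (a i * (1 - t)) ^ 2 :=
            exp_le_one_add_add_sq (by
              rw [abs_mul, abs_of_nonneg (by linarith : 0 ≤ 1 - t)]
              exact mul_le_one₀ (ha1 i) (by linarith) (by linarith))
          calc (1 - t) * Real.exp (-(a i * t)) + t * Real.exp (a i * (1 - t))
              ≤ (1 - t) * (1 + -(a i * t) + (-(a i * t)) ^ 2) +
                t * (1 + a i * (1 - t) + (a i * (1 - t)) ^ 2) := by
                have : 0 ≤ 1 - t := by linarith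
                gcongr
            _ = 1 + a i ^ 2 * (t * (1 - t)) := by ring
            _ ≤ a i ^ 2 + 1 := by nlinarith [sq_nonneg (a i), mul_nonneg h0 (sub_nonneg.2 h1.le)]
            _ ≤ Real.exp (a i ^ 2) := Real.add_one_le_exp _
    _ = Real.exp (∑ i, a i ^ 2) := (Real.exp_sum _ _).symm
    _ ≤ Real.exp 1 := Real.exp_le_exp.2 ha

/-- With probability at least one half, randomized rounding moves a point of a ball into the
slightly enlarged ball. -/
lemma half_le_sum_tents {N K : ℝ} (hK : 4 ≤ K) (hKN : K ≤ N) (hd : (d : ℝ) ≤ (K - 4) * N)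
    {z : Fin d → ℝ} (hz : ∑ i, z i ^ 2 ≤ (N - K) ^ 2) :
    1 / 2 ≤ ∑ y ∈ (finite_latticeBallSet d N).toFinset, tents (z - latticeCast y) := by
  classical
  set r := √(∑ i, z i ^ 2) with hr
  have hr0 : 0 ≤ r := Real.sqrt_nonneg _
  have hr2 : r ^ 2 = ∑ i, z i ^ 2 := Real.sq_sqrt (Finset.sum_nonneg fun _ _ => sq_nonneg _)
  have hrρ : r ≤ N - K := by
    rw [← hr2] at hz
    exact (sq_le_sq₀ hr0 (by linarith)).1 hz
  set a : Fin d → ℝ := fun i => z i / r with haa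
  have ha : ∑ i, a i ^ 2 ≤ 1 := by
    simp only [haa, div_pow, ← Finset.sum_div, ← hr2]
    exact div_self_le_one _
  have har : ∀ i, z i = r * a i := fun i => by
    by_cases h : r = 0
    · have : ∑ i, z i ^ 2 = 0 := by rw [← hr2, h]; ring
      rw [Finset.sum_eq_zero_iff_of_nonneg fun _ _ => sq_nonneg _] at this
      have := this i (Finset.mem_univ i)
      rw [h, zero_mul]
      exact pow_eq_zero_iff (two_ne_zero) |>.1 this
    · simp only [haa]; field_simp
  set P := (corners z).filter (· ∈ latticeBallSet d N)
  set Q := (corners z).filter (· ∉ latticeBallSet d N)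
  have hPQ : ∑ y ∈ P, tents (z - latticeCast y) + ∑ y ∈ Q, tents (z - latticeCast y) = 1 := by
    rw [Finset.sum_filter_add_sum_filter_not, sum_corners_tents]
  have hP : ∑ y ∈ P, tents (z - latticeCast y) ≤
      ∑ y ∈ (finite_latticeBallSet d N).toFinset, tents (z - latticeCast y) :=
    Finset.sum_le_sum_of_subset_of_nonneg (fun y hy => by
      simpa using (Finset.mem_filter.1 hy).2) fun _ _ _ => tents_nonneg _
  have hQ : ∑ y ∈ Q, tents (z - latticeCast y) ≤ Real.exp (-1) := by
    calc ∑ y ∈ Q, tents (z - latticeCast y)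
        ≤ ∑ y ∈ Q, tents (z - latticeCast y) * Real.exp (∑ i, a i * (y i - z i)) *
            Real.exp (-2) := by
          refine Finset.sum_le_sum fun y hy => ?_
          obtain ⟨-, hy⟩ := Finset.mem_filter.1 hy
          by_cases ht : tents (z - latticeCast y) = 0
          · simp [ht]
          rw [mul_assoc, ← Real.exp_add]
          refine le_mul_of_one_le_right (tents_nonneg _) (Real.one_le_exp ?_)
          by_contra! hlt
          refine hy ?_
          have hs : ∑ i, (y i - z i) ^ 2 ≤ d := by
            calc ∑ i, ((y i : ℝ) - z i) ^ 2 ≤ ∑ i : Fin d, (1 : ℝ) := by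
                  refine Finset.sum_le_sum fun i _ => ?_
                  rw [sq_le_one_iff_abs_le_one, abs_sub_comm]
                  exact (abs_le_one_of_tents_ne_zero ht i).le
              _ = d := by simp
          have e : ∑ i, (y i : ℝ) ^ 2 =
              r ^ 2 + 2 * r * ∑ i, a i * (y i - z i) + ∑ i, (y i - z i) ^ 2 := by
            rw [hr2, Finset.mul_sum, ← Finset.sum_add_distrib, ← Finset.sum_add_distrib]
            refine Finset.sum_congr rfl fun i _ => ?_
            linear_combination (2 * (y i - z i)) * har i
          change ∑ i, (y i : ℝ) ^ 2 ≤ N ^ 2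
          rw [e]
          nlinarith
      _ ≤ ∑ y ∈ corners z, tents (z - latticeCast y) * Real.exp (∑ i, a i * (y i - z i)) *
            Real.exp (-2) :=
          Finset.sum_le_sum_of_subset_of_nonneg (Finset.filter_subset _ _) fun y _ _ =>
            mul_nonneg (mul_nonneg (tents_nonneg _) (Real.exp_pos _).le) (Real.exp_pos _).le
      _ ≤ Real.exp 1 * Real.exp (-2) := by
          rw [← Finset.sum_mul]
          exact mul_le_mul_of_nonneg_right (sum_corners_exp_le z a ha) (Real.exp_pos _).le
      _ = Real.exp (-1) := by rw [← Real.exp_add]; norm_num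
  have he : Real.exp (-1) ≤ 1 / 2 := by
    rw [Real.exp_neg, one_div]
    exact inv_anti₀ two_pos (by linarith [Real.add_one_le_exp (1 : ℝ)])
  linarith

/-- The ball in coordinate space. -/
def coordBall (I : Type*) [Fintype I] (r : ℝ) : Set (I → ℝ) := {z | ∑ i, z i ^ 2 ≤ r ^ 2}

lemma isClosed_coordBall (I : Type*) [Fintype I] (r : ℝ) : IsClosed (coordBall I r) :=
  isClosed_le (by fun_prop) continuous_const

/-- The volume of a ball bounds the number of lattice points in a slightly larger ball. -/
lemma volume_coordBall_le_ncard {N K : ℝ} (hK : 4 ≤ K) (hKN : K ≤ N)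
    (hd : (d : ℝ) ≤ (K - 4) * N) :
    volume (coordBall (Fin d) (N - K)) ≤ 2 * ((latticeBallSet d N).ncard : ℝ≥0∞) := by
  set Y := (finite_latticeBallSet d N).toFinset
  have hm : ∀ y : Fin d → ℤ, Measurable fun z => ENNReal.ofReal (tents (z - latticeCast y)) :=
    fun y => (continuous_tents.comp (continuous_sub_right _)).measurable.ennreal_ofReal
  calc volume (coordBall (Fin d) (N - K))
      = ∫⁻ z in coordBall (Fin d) (N - K), 1 := by simp
    _ ≤ ∫⁻ z in coordBall (Fin d) (N - K),
          2 * ∑ y ∈ Y, ENNReal.ofReal (tents (z - latticeCast y)) := by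
        refine setLIntegral_mono' (isClosed_coordBall _ _).measurableSet fun z hz => ?_
        rw [← ENNReal.ofReal_sum_of_nonneg fun _ _ => tents_nonneg _,
          show (2 : ℝ≥0∞) = ENNReal.ofReal 2 by simp, ← ENNReal.ofReal_mul two_pos.le,
          ← ENNReal.ofReal_one]
        refine ENNReal.ofReal_le_ofReal ?_
        linarith [half_le_sum_tents hK hKN hd hz]
    _ ≤ ∫⁻ z, 2 * ∑ y ∈ Y, ENNReal.ofReal (tents (z - latticeCast y)) :=
        setLIntegral_le_lintegral _ _
    _ = 2 * ∑ y ∈ Y, ∫⁻ z, ENNReal.ofReal (tents (z - latticeCast y)) := by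
        rw [lintegral_const_mul' _ _ (by simp), lintegral_finsetSum _ fun y _ => hm y]
    _ = _ := by
        have : ∀ y : Fin d → ℤ, ∫⁻ z, ENNReal.ofReal (tents (z - latticeCast y)) = 1 := fun y => by
          rw [lintegral_sub_right_eq_self fun z => ENNReal.ofReal (tents z), lintegral_tents]
        simp [this, Y, Set.ncard_eq_toFinset_card _ (finite_latticeBallSet d N)]

end LatticeCount

section Volumes

/-- The volume of the `n`-dimensional Euclidean unit ball. -/
noncomputable def ballConst (n : ℕ) : ℝ := √Real.pi ^ n / Real.Gamma (n / 2 + 1)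

lemma ballConst_pos (n : ℕ) : 0 < ballConst n := by
  have : 0 < Real.Gamma (n / 2 + 1) := Real.Gamma_pos_of_pos (by positivity)
  have := Real.pi_pos
  unfold ballConst
  positivity

lemma preimage_coordBall (I : Type*) [Fintype I] {r : ℝ} (hr : 0 ≤ r) :
    (WithLp.ofLp : EuclideanSpace ℝ I → I → ℝ) ⁻¹' coordBall I r =
      Metric.closedBall (0 : EuclideanSpace ℝ I) r := by
  ext w
  rw [mem_closedBall_zero_iff, ← sq_le_sq₀ (norm_nonneg _) hr, EuclideanSpace.norm_sq_eq]
  simp [coordBall]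

lemma volume_coordBall (I : Type*) [Fintype I] [Nonempty I] {r : ℝ} (hr : 0 ≤ r) :
    volume (coordBall I r) =
      ENNReal.ofReal (r ^ Fintype.card I * ballConst (Fintype.card I)) := by
  rw [← (PiLp.volume_preserving_ofLp I).measure_preimage
    (isClosed_coordBall I r).measurableSet.nullMeasurableSet, preimage_coordBall I hr,
    EuclideanSpace.volume_closedBall, ENNReal.ofReal_mul (by positivity), ENNReal.ofReal_pow hr]
  rfl

lemma ballConst_succ_le (n : ℕ) (hn : 1 ≤ n) :
    ballConst (n + 1) ≤ √(2 * Real.pi) / √n * ballConst n := by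
  set s : ℝ := (n : ℝ) / 2 + 1 / 2 with hs
  have hn' : (1 : ℝ) ≤ n := by exact_mod_cast hn
  have hs0 : 0 < s := by positivity
  have g1 : 0 < Real.Gamma s := Real.Gamma_pos_of_pos hs0
  have g2 : 0 < Real.Gamma (n / 2 + 1) := Real.Gamma_pos_of_pos (by positivity)
  have h1 : Real.Gamma (s + 1) = s * Real.Gamma s := Real.Gamma_add_one hs0.ne'
  have h2 : Real.Gamma (n / 2 + 1) ≤ √s * Real.Gamma s := by
    have := Real.Gamma_mul_add_mul_le_rpow_Gamma_mul_rpow_Gamma hs0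
      (by positivity : 0 < s + 1) (by norm_num : (0 : ℝ) < 1 / 2)
      (by norm_num : (0 : ℝ) < 1 / 2) (by norm_num)
    rw [show 1 / 2 * s + 1 / 2 * (s + 1) = (n : ℝ) / 2 + 1 by rw [hs]; ring, h1,
      ← Real.sqrt_eq_rpow, ← Real.sqrt_eq_rpow, Real.sqrt_mul hs0.le] at this
    calc _ ≤ _ := this
      _ = √s * (√(Real.Gamma s) * √(Real.Gamma s)) := by ring
      _ = _ := by rw [Real.mul_self_sqrt g1.le]
  have h3 : √(n : ℝ) * √s ≤ √2 * s := by
    rw [← Real.sqrt_mul (by positivity), ← Real.sqrt_sq hs0.le, ← Real.sqrt_mul (by positivity)]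
    rw [Real.sqrt_sq hs0.le]
    exact Real.sqrt_le_sqrt (by rw [hs]; nlinarith)
  have e1 : ((n + 1 : ℕ) : ℝ) / 2 + 1 = s + 1 := by rw [hs]; push_cast; ring
  have hπ := Real.pi_pos
  have hsn : 0 < √(n : ℝ) := Real.sqrt_pos.2 (by positivity)
  rw [ballConst, ballConst, e1, h1, Real.sqrt_mul (by norm_num), div_mul_div_comm,
    div_le_div_iff₀ (by positivity) (by positivity), pow_succ]
  calc √Real.pi ^ n * √Real.pi * (√n * Real.Gamma (n / 2 + 1))
      ≤ √Real.pi ^ n * √Real.pi * (√n * (√s * Real.Gamma s)) := by gcongr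
    _ = √Real.pi ^ n * √Real.pi * Real.Gamma s * (√n * √s) := by ring
    _ ≤ √Real.pi ^ n * √Real.pi * Real.Gamma s * (√2 * s) := by gcongr
    _ = _ := by ring

lemma ballConst_add_le (n e : ℕ) (hn : 1 ≤ n) (he : e ≤ 1) :
    ballConst (n + e) ≤ (√(2 * Real.pi) / √n) ^ e * ballConst n := by
  interval_cases e
  · simp
  · simpa using ballConst_succ_le n hn

lemma volume_coordBall_le_cube (d : ℕ) {N : ℝ} (hN : 0 ≤ N) :
    volume (coordBall (Fin d) N) ≤ ENNReal.ofReal ((2 * N) ^ d) := by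
  calc volume (coordBall (Fin d) N) ≤ volume (Set.Icc (fun _ : Fin d => -N) fun _ => N) := by
        refine measure_mono fun z hz => ?_
        have h : ∀ i, -N ≤ z i ∧ z i ≤ N := fun i => by
          have h1 : z i ^ 2 ≤ N ^ 2 :=
            (Finset.single_le_sum (f := fun j => z j ^ 2) (fun _ _ => sq_nonneg _)
              (Finset.mem_univ i)).trans hz
          exact abs_le_of_sq_le_sq' h1 hN
        exact ⟨fun i => (h i).1, fun i => (h i).2⟩
    _ = _ := by
        rw [Real.volume_Icc_pi]
        simp only [Finset.prod_const, Finset.card_univ, Fintype.card_fin]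
        rw [ENNReal.ofReal_pow (by positivity)]
        congr 2; ring

/-- On large scales, the volume of a ball is at most a constant times the number of lattice points
it contains. -/
lemma exists_ballConst_le_ncard {c : ℝ} (hc : 0 < c) : ∃ C : ℝ, 0 < C ∧
    ∀ (d : ℕ) (N : ℝ), 1 ≤ d → c * d ≤ N →
      N ^ d * ballConst d ≤ C * (latticeBallSet d N).ncard := by
  set K : ℝ := 4 + 1 / c with hK
  have hc' : 0 < 1 / c := by positivity
  have hK0 : 4 ≤ K := by linarith
  refine ⟨2 * Real.exp (2 * K / c) + (4 * K) ^ (2 * K / c), by positivity, fun d N hd hN => ?_⟩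
  have hd' : (1 : ℝ) ≤ d := by exact_mod_cast hd
  have : Nonempty (Fin d) := ⟨⟨0, hd⟩⟩
  have hN0 : 0 < N := lt_of_lt_of_le (by positivity) hN
  have hdN : (d : ℝ) ≤ N / c := by rw [le_div_iff₀ hc]; linarith
  have hn1 : (1 : ℝ) ≤ (latticeBallSet d N).ncard := by
    exact_mod_cast ncard_latticeBallSet_pos d N
  have hb := ballConst_pos d
  rw [add_mul]
  rcases le_or_gt (2 * K) N with h | h
  · have h1 := volume_coordBall_le_ncard (d := d) (N := N) hK0 (by linarith)
      (by rw [hK, add_sub_cancel_left, one_div_mul_eq_div]; exact hdN)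
    have hNK : 0 < N - K := by linarith
    rw [volume_coordBall _ hNK.le, show (2 : ℝ≥0∞) * ((latticeBallSet d N).ncard : ℝ≥0∞) =
      ENNReal.ofReal (2 * (latticeBallSet d N).ncard) by
        rw [ENNReal.ofReal_mul (by norm_num)]; simp,
      ENNReal.ofReal_le_ofReal_iff (by positivity), Fintype.card_fin] at h1
    have h2 : N ^ d ≤ Real.exp (2 * K / c) * (N - K) ^ d := by
      have h3 : N ≤ Real.exp (2 * K / N) * (N - K) := by
        have : 2 * K / N + 1 ≤ Real.exp (2 * K / N) := Real.add_one_le_exp _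
        refine le_trans ?_ (mul_le_mul_of_nonneg_right this hNK.le)
        rw [div_add_one hN0.ne', div_mul_eq_mul_div, le_div_iff₀ hN0]
        nlinarith
      calc N ^ d ≤ (Real.exp (2 * K / N) * (N - K)) ^ d := by gcongr
        _ = Real.exp (d * (2 * K / N)) * (N - K) ^ d := by rw [mul_pow, Real.exp_nat_mul]
        _ ≤ _ := by
            gcongr
            rw [mul_div_assoc', div_le_div_iff₀ hN0 hc]
            nlinarith
    calc N ^ d * ballConst d ≤ Real.exp (2 * K / c) * (N - K) ^ d * ballConst d := by gcongr
      _ = Real.exp (2 * K / c) * ((N - K) ^ d * ballConst d) := by ring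
      _ ≤ Real.exp (2 * K / c) * (2 * (latticeBallSet d N).ncard) := by gcongr
      _ = 2 * Real.exp (2 * K / c) * (latticeBallSet d N).ncard := by ring
      _ ≤ _ := le_add_of_nonneg_right (by positivity)
  · have h1 := volume_coordBall_le_cube d hN0.le
    rw [volume_coordBall _ hN0.le, ENNReal.ofReal_le_ofReal_iff (by positivity),
      Fintype.card_fin] at h1
    have h2 : (2 * N) ^ d ≤ (4 * K) ^ (2 * K / c) := by
      calc (2 * N) ^ d ≤ (4 * K) ^ d :=
            pow_le_pow_left₀ (by positivity) (by linarith) _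
        _ = (4 * K) ^ (d : ℝ) := (Real.rpow_natCast _ _).symm
        _ ≤ _ := by
            refine Real.rpow_le_rpow_of_exponent_le (by linarith) (hdN.trans ?_)
            gcongr
    calc N ^ d * ballConst d ≤ (4 * K) ^ (2 * K / c) := h1.trans h2
      _ ≤ (4 * K) ^ (2 * K / c) * (latticeBallSet d N).ncard :=
          le_mul_of_one_le_right (by positivity) hn1
      _ ≤ _ := le_add_of_nonneg_left (by positivity)

/-- The radius inflation factor. -/
noncomputable def inflation (c : ℝ) (d : ℕ) : ℝ := √(1 + (4 / c ^ 2 + 1) / d)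

/-- The volume of an inflated ball, in at most one more dimension, against the number of lattice
points. -/
lemma exists_volume_inflated_le {c : ℝ} (hc : 0 < c) : ∃ C : ℝ, 0 < C ∧
    ∀ (d e : ℕ) (N : ℝ), 1 ≤ d → e ≤ 1 → c * d ≤ N →
      (N * inflation c d) ^ (d + e) * ballConst (d + e) ≤
        C * ((2 * N / √d) ^ e * (latticeBallSet d N).ncard) := by
  obtain ⟨C, hC, H⟩ := exists_ballConst_le_ncard hc
  set κ : ℝ := 4 / c ^ 2 + 1 with hκ
  have hκ0 : 0 < κ := by positivity
  refine ⟨Real.exp κ * (√(2 * Real.pi) + 1) * C, by positivity, fun d e N hd he hN => ?_⟩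
  have hd' : (1 : ℝ) ≤ d := by exact_mod_cast hd
  have hN0 : 0 < N := lt_of_lt_of_le (by positivity) hN
  have hb := ballConst_pos d
  have hsd : 0 < √(d : ℝ) := Real.sqrt_pos.2 (by positivity)
  have h1 : inflation c d ^ (d + e) ≤ Real.exp κ := by
    have h0 : 1 ≤ inflation c d := by
      rw [inflation, Real.one_le_sqrt]
      exact le_add_of_nonneg_right (by positivity)
    calc inflation c d ^ (d + e) ≤ inflation c d ^ (2 * d) :=
          pow_le_pow_right₀ h0 (by omega)
      _ = (1 + κ / d) ^ d := by rw [pow_mul, inflation, Real.sq_sqrt (by positivity)]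
      _ ≤ Real.exp (κ / d) ^ d := by
          gcongr
          rw [add_comm]
          exact Real.add_one_le_exp _
      _ = Real.exp κ := by
          rw [← Real.exp_nat_mul, mul_div_cancel₀ _ (by positivity)]
  have h2 : (√(2 * Real.pi) / √d) ^ e * N ^ e ≤ (√(2 * Real.pi) + 1) * (2 * N / √d) ^ e := by
    have hs := Real.sqrt_nonneg (2 * Real.pi)
    interval_cases e
    · simp
    · simp only [pow_one]
      rw [div_mul_eq_mul_div, mul_div_assoc']
      refine div_le_div_of_nonneg_right ?_ hsd.le
      nlinarith
  calc (N * inflation c d) ^ (d + e) * ballConst (d + e)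
      = inflation c d ^ (d + e) * (N ^ d * N ^ e) * ballConst (d + e) := by
        rw [mul_pow, pow_add N]; ring
    _ ≤ Real.exp κ * (N ^ d * N ^ e) * ((√(2 * Real.pi) / √d) ^ e * ballConst d) := by
        have := ballConst_add_le d e hd he
        gcongr
        exact (ballConst_pos _).le
    _ = Real.exp κ * ((√(2 * Real.pi) / √d) ^ e * N ^ e) * (N ^ d * ballConst d) := by ring
    _ ≤ Real.exp κ * ((√(2 * Real.pi) + 1) * (2 * N / √d) ^ e) *
          (C * (latticeBallSet d N).ncard) := by
        have := H d N hd hN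
        gcongr
    _ = _ := by ring

end Volumes

section Slicing

lemma lintegral_unifBall_eq {I : Type*} [Fintype I] [Nonempty I] {R : ℝ} (hR : 0 < R)
    {H : (I → ℝ) → ℝ≥0∞} (hH : Measurable H) :
    ∫⁻ w, H (R • WithLp.ofLp w) ∂(unifBall I) =
      ENNReal.ofReal (R ^ Fintype.card I * ballConst (Fintype.card I))⁻¹ *
        ∫⁻ v in coordBall I R, H v := by
  have hbc := ballConst_pos (Fintype.card I)
  have hB1 := (isClosed_coordBall I 1).measurableSet
  have hBR := (isClosed_coordBall I R).measurableSet
  have hsm : Measurable fun v : I → ℝ => R • v := measurable_const_smul R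
  have hv : volume (Metric.closedBall (0 : EuclideanSpace ℝ I) 1) =
      ENNReal.ofReal (ballConst (Fintype.card I)) := by
    rw [← preimage_coordBall I zero_le_one, (PiLp.volume_preserving_ofLp I).measure_preimage
      hB1.nullMeasurableSet, volume_coordBall I zero_le_one, one_pow, one_mul]
  have h1 : ∫⁻ w in Metric.closedBall (0 : EuclideanSpace ℝ I) 1, H (R • WithLp.ofLp w) =
      ∫⁻ v in coordBall I 1, H (R • v) := by
    rw [← preimage_coordBall I zero_le_one]
    exact (PiLp.volume_preserving_ofLp I).setLIntegral_comp_preimage hB1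
      (f := fun v => H (R • v)) (hH.comp hsm)
  have hpre : (fun v : I → ℝ => R • v) ⁻¹' coordBall I R = coordBall I 1 := by
    ext v
    simp only [coordBall, Set.mem_preimage, Set.mem_ofPred_eq, Pi.smul_apply, smul_eq_mul, mul_pow,
      ← Finset.mul_sum]
    rw [one_pow]
    exact mul_le_iff_le_one_right (by positivity)
  have h2 : ∫⁻ v in coordBall I 1, H (R • v) =
      ENNReal.ofReal (R ^ Fintype.card I)⁻¹ * ∫⁻ v in coordBall I R, H v := by
    have h3 := Measure.map_addHaar_smul (volume : Measure (I → ℝ)) hR.ne'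
    rw [← hpre, ← setLIntegral_map hBR hH hsm, h3, Measure.restrict_smul, lintegral_smul_measure,
      Module.finrank_fintype_fun_eq_card, abs_of_pos (by positivity), smul_eq_mul]
  rw [unifBall, lintegral_smul_measure, smul_eq_mul, h1, h2, hv, ← mul_assoc,
    ← ENNReal.ofReal_inv_of_pos hbc, ← ENNReal.ofReal_mul (by positivity), mul_inv_rev]

/-- Slicing the ball of radius `R` along the extra coordinates. -/
lemma le_lintegral_unifBall_inl {d e : ℕ} (hd : 1 ≤ d) (he : e ≤ 1) {R a b : ℝ} (hR : 0 < R)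
    (hab : a ^ 2 + b ^ 2 ≤ R ^ 2) {G : (Fin d → ℝ) → ℝ≥0∞} (hG : Measurable G) :
    ENNReal.ofReal ((2 * b) ^ e / (R ^ (d + e) * ballConst (d + e))) *
        ∫⁻ ζ in coordBall (Fin d) a, G ζ ≤
      ∫⁻ w, G (R • fun i => w (Sum.inl i)) ∂(unifBall (Fin d ⊕ Fin e)) := by
  have : Nonempty (Fin d) := ⟨⟨0, hd⟩⟩
  have hbc := ballConst_pos (d + e)
  have hinl : Measurable fun v : Fin d ⊕ Fin e → ℝ => G fun i => v (Sum.inl i) :=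
    hG.comp (measurable_pi_lambda _ fun i => measurable_pi_apply _)
  have h1 := lintegral_unifBall_eq (I := Fin d ⊕ Fin e) hR hinl
  have h2 : ENNReal.ofReal ((2 * b) ^ e) * ∫⁻ ζ in coordBall (Fin d) a, G ζ ≤
      ∫⁻ v in coordBall (Fin d ⊕ Fin e) R, G fun i => v (Sum.inl i) := by
    have hmp := volume_measurePreserving_sumPiEquivProdPi_symm fun _ : Fin d ⊕ Fin e => ℝ
    set Q : Set (Fin e → ℝ) := Set.Icc (fun _ => -b) fun _ => b
    have hQ : volume Q = ENNReal.ofReal ((2 * b) ^ e) := by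
      rw [Real.volume_Icc_pi]
      interval_cases e
      · simp
      · simp [two_mul]
    rw [← hmp.setLIntegral_comp_preimage (isClosed_coordBall _ R).measurableSet hinl]
    have hsub : coordBall (Fin d) a ×ˢ Q ⊆
        (MeasurableEquiv.sumPiEquivProdPi fun _ : Fin d ⊕ Fin e => ℝ).symm ⁻¹'
          coordBall (Fin d ⊕ Fin e) R := by
      rintro ⟨ζ, t⟩ ⟨hζ, ht⟩
      change ∑ i : Fin d ⊕ Fin e,
        (Equiv.sumPiEquivProdPi fun _ : Fin d ⊕ Fin e => ℝ).symm (ζ, t) i ^ 2 ≤ R ^ 2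
      rw [Fintype.sum_sum_type]
      change ∑ i, ζ i ^ 2 + ∑ i, t i ^ 2 ≤ R ^ 2
      have h3 : ∑ i, t i ^ 2 ≤ b ^ 2 := by
        calc ∑ i, t i ^ 2 ≤ ∑ _i : Fin e, b ^ 2 :=
              Finset.sum_le_sum fun i _ => sq_le_sq' (ht.1 i) (ht.2 i)
          _ = e * b ^ 2 := by simp
          _ ≤ 1 * b ^ 2 := by
              have : (e : ℝ) ≤ 1 := by exact_mod_cast he
              gcongr
          _ = b ^ 2 := one_mul _
      have h4 : ∑ i, ζ i ^ 2 ≤ a ^ 2 := hζ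
      linarith
    refine le_trans ?_ (lintegral_mono_set hsub)
    change _ ≤ ∫⁻ q in coordBall (Fin d) a ×ˢ Q, G q.1 ∂((volume : Measure (Fin d → ℝ)).prod
      (volume : Measure (Fin e → ℝ)))
    have hG1 : Measurable fun q : (Fin d → ℝ) × (Fin e → ℝ) => G q.1 := hG.comp measurable_fst
    rw [← Measure.prod_restrict, lintegral_prod _ hG1.aemeasurable]
    simp only [lintegral_const, Measure.restrict_apply MeasurableSet.univ, Set.univ_inter, hQ]
    rw [lintegral_mul_const _ hG, mul_comm]
  calc _ = ENNReal.ofReal (R ^ (d + e) * ballConst (d + e))⁻¹ *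
        (ENNReal.ofReal ((2 * b) ^ e) * ∫⁻ ζ in coordBall (Fin d) a, G ζ) := by
        rw [div_eq_inv_mul, ENNReal.ofReal_mul (by positivity), mul_assoc]
    _ ≤ _ := by
        refine (mul_le_mul_right h2 _).trans (le_of_eq ?_)
        simp only [Fintype.card_sum, Fintype.card_fin] at h1
        exact h1.symm

variable {d : ℕ}

/-- Two independent symmetric displacements keep a point of the ball in a slightly enlarged ball
with probability at least one half. -/
lemma half_le_lintegral_tents {a N : ℝ} {q : Fin d → ℝ} (hq : ∑ i, q i ^ 2 ≤ N ^ 2)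
    (ha : N ^ 2 + 4 * d ≤ a ^ 2) :
    1 ≤ 2 * ∫⁻ u : Fin d → ℝ, ENNReal.ofReal (tents u) *
      ∫⁻ ζ in coordBall (Fin d) a, ENNReal.ofReal (tents (ζ + q + u)) := by
  set t : (Fin d → ℝ) → ℝ≥0∞ := fun z => ENNReal.ofReal (tents z) with ht
  have htm : Measurable t := continuous_tents.measurable.ennreal_ofReal
  have htn : ∀ z, t (-z) = t z := fun z => by simp only [ht, tents_neg]
  have ht1 : ∫⁻ z, t z = 1 := lintegral_tents
  set B := coordBall (Fin d) a
  have hB : MeasurableSet B := (isClosed_coordBall (Fin d) a).measurableSet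
  set χ : (Fin d → ℝ) → ℝ≥0∞ := B.indicator 1 with hχ
  have hχm : Measurable χ := measurable_one.indicator hB
  have hχn : ∀ z, χ (-z) = χ z := fun z => by
    have : -z ∈ B ↔ z ∈ B := by simp [B, coordBall]
    by_cases h : z ∈ B
    · simp [hχ, h, this.2 h]
    · simp [hχ, h, this.not.2 h]
  have e1 : ∀ u, ∫⁻ ζ in B, t (ζ + q + u) = ∫⁻ ζ, χ (ζ - (q + u)) * t ζ := by
    intro u
    rw [← lintegral_indicator hB, ← lintegral_sub_right_eq_self _ (q + u)]
    refine lintegral_congr fun ζ => ?_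
    by_cases h : ζ - (q + u) ∈ B
    · simp only [hχ, Set.indicator_of_mem h, Pi.one_apply, one_mul]
      congr 1; abel
    · simp only [hχ, Set.indicator_of_notMem h, zero_mul]
  have e2 : ∫⁻ u, t u * ∫⁻ ζ, χ (ζ - (q + u)) * t ζ =
      ∫⁻ u, t u * ∫⁻ ζ, χ (ζ + q - u) * t ζ := by
    rw [← lintegral_neg_eq_self]
    refine lintegral_congr fun u => ?_
    rw [htn, ← lintegral_neg_eq_self]
    congr 1
    refine lintegral_congr fun ζ => ?_
    rw [htn, ← hχn]
    congr 2; abel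
  have m1 : Measurable fun w : (Fin d → ℝ) × (Fin d → ℝ) => χ (w.2 - (q + w.1)) * t w.2 :=
    (hχm.comp (by fun_prop : Continuous fun w : (Fin d → ℝ) × (Fin d → ℝ) =>
      w.2 - (q + w.1)).measurable).mul (htm.comp measurable_snd)
  have m2 : Measurable fun w : (Fin d → ℝ) × (Fin d → ℝ) => χ (w.2 + q - w.1) * t w.2 :=
    (hχm.comp (by fun_prop : Continuous fun w : (Fin d → ℝ) × (Fin d → ℝ) =>
      w.2 + q - w.1).measurable).mul (htm.comp measurable_snd)
  have n1 : ∀ u, Measurable fun ζ => χ (ζ - (q + u)) * t ζ := fun u =>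
    m1.comp (f := fun ζ => (u, ζ)) measurable_prodMk_left
  have key : 1 ≤ ∫⁻ u, ((t u * ∫⁻ ζ, χ (ζ - (q + u)) * t ζ) +
      (t u * ∫⁻ ζ, χ (ζ + q - u) * t ζ)) := by
    calc (1 : ℝ≥0∞) = ∫⁻ u, t u * ∫⁻ ζ, t ζ := by simp [ht1]
      _ ≤ ∫⁻ u, t u * ∫⁻ ζ, χ (ζ - (q + u)) * t ζ + χ (ζ + q - u) * t ζ := by
          refine lintegral_mono fun u => ?_
          rw [← lintegral_const_mul _ htm]
          rw [← lintegral_const_mul' _ _ ENNReal.ofReal_ne_top]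
          refine lintegral_mono fun ζ => ?_
          by_cases hu : tents u = 0
          · simp [ht, hu]
          by_cases hz : tents ζ = 0
          · simp [ht, hz]
          refine mul_le_mul_right ?_ _
          rw [← add_mul]
          refine le_mul_of_one_le_left zero_le ?_
          have hsum : ∑ i, (ζ i - u i) ^ 2 ≤ 4 * d := by
            calc ∑ i, (ζ i - u i) ^ 2 ≤ ∑ _i : Fin d, (4 : ℝ) := by
                  refine Finset.sum_le_sum fun i _ => ?_
                  have h1 := abs_lt.1 (abs_le_one_of_tents_ne_zero hu i)
                  have h2 := abs_lt.1 (abs_le_one_of_tents_ne_zero hz i)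
                  nlinarith [h1.1, h1.2, h2.1, h2.2]
              _ = 4 * d := by simp [mul_comm]
          rcases le_total 0 (∑ i, q i * (ζ i - u i)) with h | h
          · have : ζ - (q + u) ∈ B := by
              change ∑ i, (ζ i - (q i + u i)) ^ 2 ≤ a ^ 2
              have : ∑ i, (ζ i - (q i + u i)) ^ 2 = ∑ i, q i ^ 2 - 2 * ∑ i, q i * (ζ i - u i) +
                  ∑ i, (ζ i - u i) ^ 2 := by
                rw [Finset.mul_sum, ← Finset.sum_sub_distrib, ← Finset.sum_add_distrib]
                exact Finset.sum_congr rfl fun i _ => by ring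
              linarith
            simp [hχ, this]
          · have : ζ + q - u ∈ B := by
              change ∑ i, (ζ i + q i - u i) ^ 2 ≤ a ^ 2
              have : ∑ i, (ζ i + q i - u i) ^ 2 = ∑ i, q i ^ 2 + 2 * ∑ i, q i * (ζ i - u i) +
                  ∑ i, (ζ i - u i) ^ 2 := by
                rw [Finset.mul_sum, ← Finset.sum_add_distrib, ← Finset.sum_add_distrib]
                exact Finset.sum_congr rfl fun i _ => by ring
              linarith
            simp [hχ, this]
      _ = _ := by
          refine lintegral_congr fun u => ?_
          rw [lintegral_add_left (n1 u), mul_add]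
  have m3 : Measurable fun u => t u * ∫⁻ ζ, χ (ζ - (q + u)) * t ζ :=
    htm.mul (Measurable.lintegral_prod_right' (f := fun w :
      (Fin d → ℝ) × (Fin d → ℝ) => χ (w.2 - (q + w.1)) * t w.2) m1)
  rw [lintegral_add_left m3, ← e2, ← two_mul] at key
  change 1 ≤ 2 * ∫⁻ u, t u * ∫⁻ ζ in B, t (ζ + q + u)
  simp only [e1]
  exact key

end Slicing

section Interpolation

variable {d : ℕ}

/-- Multilinear interpolation of a finitely supported function on the lattice. -/
noncomputable def interp (Y : Finset (Fin d → ℤ)) (g : (Fin d → ℤ) → ℝ) (z : Fin d → ℝ) : ℝ :=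
  ∑ y ∈ Y, g y * tents (z - latticeCast y)

lemma continuous_interp (Y : Finset (Fin d → ℤ)) (g : (Fin d → ℤ) → ℝ) :
    Continuous (interp Y g) :=
  continuous_finsetSum _ fun _ _ =>
    continuous_const.mul (continuous_tents.comp (continuous_sub_right _))

lemma interp_nonneg (Y : Finset (Fin d → ℤ)) {g : (Fin d → ℤ) → ℝ} (hg : ∀ y, 0 ≤ g y)
    (z : Fin d → ℝ) : 0 ≤ interp Y g z :=
  Finset.sum_nonneg fun y _ => mul_nonneg (hg y) (tents_nonneg _)

lemma measurable_ofReal_tents_sub (a : Fin d → ℝ) :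
    Measurable fun z : Fin d → ℝ => ENNReal.ofReal (tents (z - a)) :=
  (continuous_tents.comp (continuous_sub_right _)).measurable.ennreal_ofReal

lemma interp_rpow_le (Y : Finset (Fin d → ℤ)) {g : (Fin d → ℤ) → ℝ} (hg : ∀ y, 0 ≤ g y)
    {p : ℝ} (hp : 1 < p) (z : Fin d → ℝ) :
    interp Y g z ^ p ≤ ∑ y ∈ Y, tents (z - latticeCast y) * g y ^ p := by
  have h1 := Real.inner_le_weight_mul_Lp_of_nonneg Y hp.le
    (fun y => tents (z - latticeCast y)) g (fun _ => tents_nonneg _) hg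
  have h2 : 0 ≤ ∑ y ∈ Y, tents (z - latticeCast y) * g y ^ p :=
    Finset.sum_nonneg fun y _ => mul_nonneg (tents_nonneg _) (Real.rpow_nonneg (hg y) _)
  have h3 : interp Y g z ≤ (∑ y ∈ Y, tents (z - latticeCast y) * g y ^ p) ^ p⁻¹ := by
    have hp1 : 0 ≤ 1 - p⁻¹ := by
      have := inv_lt_one_of_one_lt₀ hp
      linarith
    calc interp Y g z = ∑ y ∈ Y, tents (z - latticeCast y) * g y :=
          Finset.sum_congr rfl fun _ _ => mul_comm _ _
      _ ≤ _ := h1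
      _ ≤ _ := mul_le_of_le_one_left (Real.rpow_nonneg h2 _)
          (Real.rpow_le_one (Finset.sum_nonneg fun _ _ => tents_nonneg _)
            (sum_tents_le_one z Y) hp1)
  calc interp Y g z ^ p ≤ ((∑ y ∈ Y, tents (z - latticeCast y) * g y ^ p) ^ p⁻¹) ^ p :=
        Real.rpow_le_rpow (interp_nonneg Y hg z) h3 (by linarith)
    _ = _ := Real.rpow_inv_rpow h2 (by linarith)

lemma lintegral_interp_rpow_le (Y : Finset (Fin d → ℤ)) {g : (Fin d → ℤ) → ℝ} (hg : ∀ y, 0 ≤ g y)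
    {p : ℝ} (hp : 1 < p) :
    ∫⁻ z, ENNReal.ofReal (interp Y g z) ^ p ≤ ∑ y ∈ Y, ENNReal.ofReal (g y) ^ p := by
  have hp0 : 0 ≤ p := by linarith
  calc ∫⁻ z, ENNReal.ofReal (interp Y g z) ^ p
      ≤ ∫⁻ z, ∑ y ∈ Y, ENNReal.ofReal (tents (z - latticeCast y)) * ENNReal.ofReal (g y) ^ p := by
        refine lintegral_mono fun z => ?_
        rw [ENNReal.ofReal_rpow_of_nonneg (interp_nonneg Y hg z) hp0]
        refine (ENNReal.ofReal_le_ofReal (interp_rpow_le Y hg hp z)).trans (le_of_eq ?_)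
        rw [ENNReal.ofReal_sum_of_nonneg fun y _ =>
          mul_nonneg (tents_nonneg _) (Real.rpow_nonneg (hg y) _)]
        refine Finset.sum_congr rfl fun y _ => ?_
        rw [ENNReal.ofReal_mul (tents_nonneg _), ENNReal.ofReal_rpow_of_nonneg (hg y) hp0]
    _ = ∑ y ∈ Y, ENNReal.ofReal (g y) ^ p := by
        rw [lintegral_finsetSum _ fun y _ => (measurable_ofReal_tents_sub _).mul_const _]
        refine Finset.sum_congr rfl fun y _ => ?_
        rw [lintegral_mul_const _ (measurable_ofReal_tents_sub _),
          lintegral_sub_right_eq_self fun z => ENNReal.ofReal (tents z), lintegral_tents, one_mul]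

/-- Local averages at lattice points are dominated in `L^p` by the full function. -/
lemma sum_lintegral_tents_rpow_le {p : ℝ} (hp : 1 < p) (X : Finset (Fin d → ℤ))
    {S : (Fin d → ℝ) → ℝ≥0∞} (hS : Measurable S) :
    ∑ x ∈ X, (∫⁻ u, ENNReal.ofReal (tents u) * S (latticeCast x + u)) ^ p ≤ ∫⁻ z, S z ^ p := by
  set t : (Fin d → ℝ) → ℝ≥0∞ := fun z => ENNReal.ofReal (tents z) with ht
  have htm : Measurable t := continuous_tents.measurable.ennreal_ofReal
  have hprob : IsProbabilityMeasure ((volume : Measure (Fin d → ℝ)).withDensity t) := ⟨by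
    rw [withDensity_apply _ MeasurableSet.univ, Measure.restrict_univ]
    exact lintegral_tents⟩
  have h1 : ∀ x : Fin d → ℤ, (∫⁻ u, t u * S (latticeCast x + u)) ^ p ≤
      ∫⁻ z, t (z - latticeCast x) * S z ^ p := by
    intro x
    have hSx : Measurable fun u => S (latticeCast x + u) := hS.comp (measurable_const_add _)
    have h2 := lintegral_rpow_le_of_prob (μ := (volume : Measure (Fin d → ℝ)).withDensity t)
      hSx.aemeasurable hp
    rw [lintegral_withDensity_eq_lintegral_mul _ htm hSx,
      lintegral_withDensity_eq_lintegral_mul _ htm (hSx.pow_const p)] at h2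
    refine h2.trans (le_of_eq ?_)
    rw [← lintegral_sub_right_eq_self _ (latticeCast x)]
    refine lintegral_congr fun z => ?_
    simp
  calc _ ≤ ∑ x ∈ X, ∫⁻ z, t (z - latticeCast x) * S z ^ p := Finset.sum_le_sum fun x _ => h1 x
    _ = ∫⁻ z, ∑ x ∈ X, t (z - latticeCast x) * S z ^ p :=
        (lintegral_finsetSum _ fun x _ =>
          (measurable_ofReal_tents_sub _).mul (hS.pow_const p)).symm
    _ ≤ ∫⁻ z, S z ^ p := by
        refine lintegral_mono fun z => ?_
        rw [← Finset.sum_mul]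
        refine mul_le_of_le_one_left zero_le ?_
        rw [← ENNReal.ofReal_sum_of_nonneg fun _ _ => tents_nonneg _, ← ENNReal.ofReal_one]
        exact ENNReal.ofReal_le_ofReal (sum_tents_le_one z X)

/-- A scaled projection of a Euclidean space onto its first coordinates. -/
noncomputable def inlProj (d e : ℕ) (r : ℝ) :
    EuclideanSpace ℝ (Fin d ⊕ Fin e) →L[ℝ] (Fin d → ℝ) :=
  ContinuousLinearMap.pi fun i => r • EuclideanSpace.proj (Sum.inl i)

lemma inlProj_apply (d e : ℕ) (r : ℝ) (w : EuclideanSpace ℝ (Fin d ⊕ Fin e)) :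
    inlProj d e r w = r • fun i => w (Sum.inl i) := by
  ext i; simp [inlProj]

/-- Discrete averages are controlled by local averages of continuous averages. -/
lemma sum_le_lintegral_tents_unifBall {e : ℕ} (hd : 1 ≤ d) (he : e ≤ 1) {c N : ℝ} (hc : 0 < c)
    (hN : c * d ≤ N) (Y : Finset (Fin d → ℤ)) {g : (Fin d → ℤ) → ℝ} (hg : ∀ y, 0 ≤ g y)
    (x : Fin d → ℤ) (Y' : Finset (Fin d → ℤ)) (hY : Y' ⊆ Y)
    (hY' : ∀ y ∈ Y', x - y ∈ latticeBallSet d N) :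
    ENNReal.ofReal ((2 * N / √d) ^ e / ((N * inflation c d) ^ (d + e) * ballConst (d + e))) *
        ∑ y ∈ Y', ENNReal.ofReal (g y) ≤
      2 * ∫⁻ u, ENNReal.ofReal (tents u) * ∫⁻ w, ENNReal.ofReal (interp Y g
        (latticeCast x + u + N • inlProj d e (inflation c d) w)) ∂(unifBall (Fin d ⊕ Fin e)) := by
  have hd' : (1 : ℝ) ≤ d := by exact_mod_cast hd
  have hN0 : 0 < N := lt_of_lt_of_le (by positivity) hN
  set R := N * inflation c d with hR
  have hinf : inflation c d ^ 2 = 1 + (4 / c ^ 2 + 1) / d := Real.sq_sqrt (by positivity)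
  have hinf0 : 0 < inflation c d := Real.sqrt_pos.2 (by positivity)
  have hR0 : 0 < R := by positivity
  set a := √(N ^ 2 + 4 * d) with ha
  have ha2 : a ^ 2 = N ^ 2 + 4 * d := Real.sq_sqrt (by positivity)
  set b := N / √d with hb
  have hb2 : b ^ 2 = N ^ 2 / d := by rw [hb, div_pow, Real.sq_sqrt (by positivity)]
  have hab : a ^ 2 + b ^ 2 ≤ R ^ 2 := by
    have h1 : (d : ℝ) ≤ N ^ 2 / c ^ 2 / d := by
      rw [le_div_iff₀ (by positivity), le_div_iff₀ (by positivity)]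
      calc (d : ℝ) * d * c ^ 2 = (c * d) ^ 2 := by ring
        _ ≤ N ^ 2 := by gcongr
    rw [ha2, hb2, hR, mul_pow, hinf]
    have : N ^ 2 * (1 + (4 / c ^ 2 + 1) / d) = N ^ 2 + 4 * (N ^ 2 / c ^ 2 / d) + N ^ 2 / d := by
      field_simp
      ring
    linarith
  set t : (Fin d → ℝ) → ℝ≥0∞ := fun z => ENNReal.ofReal (tents z) with ht
  have htm : Measurable t := continuous_tents.measurable.ennreal_ofReal
  set A := ENNReal.ofReal ((2 * N / √d) ^ e / (R ^ (d + e) * ballConst (d + e)))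
  set B := coordBall (Fin d) a
  have hslice : ∀ u, A * ∑ y ∈ Y', ENNReal.ofReal (g y) *
      ∫⁻ ζ in B, t (ζ + (latticeCast x - latticeCast y) + u) ≤
      ∫⁻ w, ENNReal.ofReal (interp Y g
        (latticeCast x + u + N • inlProj d e (inflation c d) w)) ∂(unifBall (Fin d ⊕ Fin e)) := by
    intro u
    have hmy : ∀ y : Fin d → ℤ, Measurable fun ζ =>
        t (ζ + (latticeCast x - latticeCast y) + u) := fun y =>
      htm.comp ((measurable_add_const _).comp (measurable_add_const _))
    have h1 := le_lintegral_unifBall_inl (d := d) (e := e) hd he hR0 hab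
      (G := fun ζ => ENNReal.ofReal (interp Y g (latticeCast x + u + ζ)))
      ((continuous_interp Y g).comp (continuous_const_add _)).measurable.ennreal_ofReal
    have e1 : 2 * b = 2 * N / √d := by rw [hb]; ring
    rw [e1] at h1
    calc _ ≤ A * ∫⁻ ζ in B, ENNReal.ofReal (interp Y g (latticeCast x + u + ζ)) := by
          refine mul_le_mul_right ?_ _
          have : ∀ y ∈ Y', ENNReal.ofReal (g y) *
              ∫⁻ ζ in B, t (ζ + (latticeCast x - latticeCast y) + u) = ∫⁻ ζ in B,
                ENNReal.ofReal (g y) * t (ζ + (latticeCast x - latticeCast y) + u) := fun y _ =>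
            (lintegral_const_mul _ (hmy y)).symm
          rw [Finset.sum_congr rfl this, ← lintegral_finsetSum _ fun y _ => (hmy y).const_mul _]
          refine lintegral_mono fun ζ => ?_
          rw [interp, ENNReal.ofReal_sum_of_nonneg fun y _ => mul_nonneg (hg y) (tents_nonneg _)]
          refine (Finset.sum_le_sum fun y _ => le_of_eq ?_).trans
            (Finset.sum_le_sum_of_subset hY)
          rw [ENNReal.ofReal_mul (hg y)]
          simp only [ht]
          congr 3
          abel
      _ ≤ _ := h1
      _ = _ := by
          refine lintegral_congr fun w => ?_
          rw [inlProj_apply, smul_smul]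
  have hin : ∀ y : Fin d → ℤ, Measurable fun u =>
      ∫⁻ ζ in B, t (ζ + (latticeCast x - latticeCast y) + u) := fun y => by
    have : Measurable fun w : (Fin d → ℝ) × (Fin d → ℝ) =>
        t (w.2 + (latticeCast x - latticeCast y) + w.1) :=
      htm.comp (by fun_prop : Continuous fun w : (Fin d → ℝ) × (Fin d → ℝ) =>
        w.2 + (latticeCast x - latticeCast y) + w.1).measurable
    exact Measurable.lintegral_prod_right' (f := fun w : (Fin d → ℝ) × (Fin d → ℝ) =>
      t (w.2 + (latticeCast x - latticeCast y) + w.1)) this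
  calc A * ∑ y ∈ Y', ENNReal.ofReal (g y)
      ≤ A * ∑ y ∈ Y', ENNReal.ofReal (g y) * (2 * ∫⁻ u, t u *
          ∫⁻ ζ in B, t (ζ + (latticeCast x - latticeCast y) + u)) := by
        refine mul_le_mul_right (Finset.sum_le_sum fun y hy => ?_) _
        refine le_mul_of_one_le_right zero_le (half_le_lintegral_tents (N := N) ?_ ha2.ge)
        have := hY' y hy
        simp only [latticeBallSet, Set.mem_ofPred_eq, Pi.sub_apply] at this
        simpa [latticeCast] using this
    _ = 2 * ∫⁻ u, t u * (A * ∑ y ∈ Y', ENNReal.ofReal (g y) *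
          ∫⁻ ζ in B, t (ζ + (latticeCast x - latticeCast y) + u)) := by
        have e1 : ∀ u, t u * (A * ∑ y ∈ Y', ENNReal.ofReal (g y) *
            ∫⁻ ζ in B, t (ζ + (latticeCast x - latticeCast y) + u)) =
            A * ∑ y ∈ Y', ENNReal.ofReal (g y) * (t u *
              ∫⁻ ζ in B, t (ζ + (latticeCast x - latticeCast y) + u)) := fun u => by
          simp only [Finset.mul_sum]
          exact Finset.sum_congr rfl fun y _ => by ring
        have m1 : ∀ y : Fin d → ℤ, Measurable fun u => ENNReal.ofReal (g y) * (t u *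
              ∫⁻ ζ in B, t (ζ + (latticeCast x - latticeCast y) + u)) := fun y =>
          (htm.mul (hin y)).const_mul _
        simp only [e1]
        rw [lintegral_const_mul' _ _ ENNReal.ofReal_ne_top, lintegral_finsetSum _ fun y _ => m1 y]
        simp only [Finset.mul_sum]
        refine Finset.sum_congr rfl fun y _ => ?_
        rw [lintegral_const_mul' _ _ ENNReal.ofReal_ne_top]
        ring
    _ ≤ _ := by
        refine mul_le_mul_right (lintegral_mono fun u => ?_) _
        exact mul_le_mul_right (hslice u) _

end Interpolation

section Assembly

/-- The lattice points of the ball centred at `x`. -/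
noncomputable def shiftedBall (d : ℕ) (N : ℝ) (x : Fin d → ℤ) : Finset (Fin d → ℤ) :=
  (finite_latticeBallSet d N).toFinset.image fun y => x - y

lemma enorm_ballAvg_le (d : ℕ) (N : ℝ) (f : (Fin d → ℤ) → ℂ) (x : Fin d → ℤ) :
    (‖ballAvg d N f x‖₊ : ℝ≥0∞) ≤
      ENNReal.ofReal ((latticeBallSet d N).ncard : ℝ)⁻¹ *
        ∑ y ∈ shiftedBall d N x, ENNReal.ofReal ‖f y‖ := by
  have hfin := finite_latticeBallSet d N
  have h1 : ‖ballAvg d N f x‖ ≤ ((latticeBallSet d N).ncard : ℝ)⁻¹ *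
      ∑ y ∈ shiftedBall d N x, ‖f y‖ := by
    rw [ballAvg, finsum_mem_eq_finite_toFinset_sum _ hfin, norm_div, Complex.norm_natCast,
      div_eq_inv_mul, shiftedBall, Finset.sum_image fun _ _ _ _ h => sub_right_injective h]
    gcongr
    exact norm_sum_le _ _
  calc (‖ballAvg d N f x‖₊ : ℝ≥0∞) = ENNReal.ofReal ‖ballAvg d N f x‖ :=
        (ofReal_norm _).symm
    _ ≤ _ := ENNReal.ofReal_le_ofReal h1
    _ = _ := by
        rw [ENNReal.ofReal_mul (by positivity),
          ENNReal.ofReal_sum_of_nonneg fun _ _ => norm_nonneg _]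

/-- The maximal function over finitely many scales. -/
noncomputable def truncMax (c : ℝ) (d M : ℕ) (f : (Fin d → ℤ) → ℂ) (x : Fin d → ℤ) : ℝ≥0∞ :=
  ⨆ n ∈ Finset.range M, ⨆ _ : c * (d : ℝ) ≤ (2 : ℝ) ^ n, (‖ballAvg d ((2 : ℝ) ^ n) f x‖₊ : ℝ≥0∞)

/-- The truncated maximal function is controlled by local averages of the continuous one. -/
lemma exists_truncMax_le {c : ℝ} (hc : 0 < c) : ∃ C : ℝ, 0 < C ∧
    ∀ (d e M : ℕ) (f : (Fin d → ℤ) → ℂ) (x : Fin d → ℤ) (Y : Finset (Fin d → ℤ)), 1 ≤ d → e ≤ 1 →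
      (∀ n < M, shiftedBall d ((2 : ℝ) ^ n) x ⊆ Y) →
      truncMax c d M f x ≤ ENNReal.ofReal C * ∫⁻ u, ENNReal.ofReal (tents u) *
        liftMax ((Finset.range M).image ((↑) : ℕ → ℤ)) (interp Y fun y => ‖f y‖)
          (inlProj d e (inflation c d)) (latticeCast x + u) := by
  obtain ⟨C, hC, H⟩ := exists_volume_inflated_le hc
  refine ⟨2 * C, by positivity, fun d e M f x Y hd he hY => ?_⟩
  have hd' : (1 : ℝ) ≤ d := by exact_mod_cast hd
  refine iSup₂_le fun n hn => iSup_le fun hN => ?_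
  have hn' := Finset.mem_range.1 hn
  set N : ℝ := 2 ^ n with hNdef
  have hN0 : 0 < N := by positivity
  have hinf0 : 0 < inflation c d := Real.sqrt_pos.2 (by positivity)
  have hbc := ballConst_pos (d + e)
  have hB : (0 : ℝ) < (latticeBallSet d N).ncard := by
    exact_mod_cast ncard_latticeBallSet_pos d N
  set A : ℝ := (2 * N / √d) ^ e / ((N * inflation c d) ^ (d + e) * ballConst (d + e)) with hA
  have hBA : ((latticeBallSet d N).ncard : ℝ)⁻¹ ≤ C * A := by
    rw [hA, mul_div_assoc', inv_eq_one_div, div_le_div_iff₀ hB (by positivity), one_mul]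
    calc _ ≤ _ := H d e N hd he hN
      _ = _ := by ring
  calc (‖ballAvg d N f x‖₊ : ℝ≥0∞)
      ≤ ENNReal.ofReal ((latticeBallSet d N).ncard : ℝ)⁻¹ *
        ∑ y ∈ shiftedBall d N x, ENNReal.ofReal ‖f y‖ := enorm_ballAvg_le d N f x
    _ ≤ ENNReal.ofReal (C * A) * ∑ y ∈ shiftedBall d N x, ENNReal.ofReal ‖f y‖ := by gcongr
    _ = ENNReal.ofReal C *
          (ENNReal.ofReal A * ∑ y ∈ shiftedBall d N x, ENNReal.ofReal ‖f y‖) := by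
        rw [ENNReal.ofReal_mul hC.le, mul_assoc]
    _ ≤ ENNReal.ofReal C * (2 * ∫⁻ u, ENNReal.ofReal (tents u) * ∫⁻ w, ENNReal.ofReal
          (interp Y (fun y => ‖f y‖) (latticeCast x + u + N • inlProj d e (inflation c d) w))
          ∂(unifBall (Fin d ⊕ Fin e))) := by
        refine mul_le_mul_right (sum_le_lintegral_tents_unifBall hd he hc hN Y
          (fun y => norm_nonneg _) x _ (hY n hn') fun y hy => ?_) _
        obtain ⟨v, hv, rfl⟩ := Finset.mem_image.1 hy
        simpa using hv
    _ ≤ ENNReal.ofReal C * (2 * ∫⁻ u, ENNReal.ofReal (tents u) *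
        liftMax ((Finset.range M).image ((↑) : ℕ → ℤ)) (interp Y fun y => ‖f y‖)
          (inlProj d e (inflation c d)) (latticeCast x + u)) := by
        refine mul_le_mul_right (mul_le_mul_right (lintegral_mono fun u =>
          mul_le_mul_right ?_ _) _) _
        refine le_trans (le_of_eq ?_) (le_iSup₂ (f := fun (j : ℤ)
          (_ : j ∈ (Finset.range M).image ((↑) : ℕ → ℤ)) => ∫⁻ w, ENNReal.ofReal
          (interp Y (fun y => ‖f y‖) (latticeCast x + u + (2 : ℝ) ^ j •
            inlProj d e (inflation c d) w)) ∂(unifBall (Fin d ⊕ Fin e)))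
          (n : ℤ) (Finset.mem_image_of_mem _ hn))
        rw [zpow_natCast]
    _ = _ := by
        rw [← mul_assoc, mul_comm 2 C, ENNReal.ofReal_mul hC.le]
        simp

/-- The maximal inequality for finitely many scales and finitely many points. -/
lemma exists_sum_truncMax_le {p c : ℝ} (hp : 1 < p) (hc : 0 < c) : ∃ C : ℝ, 0 < C ∧
    ∀ (d M : ℕ) (f : (Fin d → ℤ) → ℂ) (X : Finset (Fin d → ℤ)), 1 ≤ d →
      ∑ x ∈ X, truncMax c d M f x ^ p ≤ ENNReal.ofReal C * ∑' x, (‖f x‖₊ : ℝ≥0∞) ^ p := by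
  classical
  obtain ⟨C₁, hC₁, H₁⟩ := exists_truncMax_le hc
  obtain ⟨C₂, hC₂, H₂⟩ := exists_strong_type hp
  have hp0 : 0 ≤ p := by linarith
  refine ⟨C₁ ^ p * (9 * C₂), by positivity, fun d M f X hd => ?_⟩
  obtain ⟨S⟩ := exists_signedInvolution (Fin d ⊕ Fin (d % 2)) (by
    simp only [Fintype.card_sum, Fintype.card_fin]
    rw [Nat.even_iff]; omega)
  set Y := X.biUnion fun x => (Finset.range M).biUnion fun n => shiftedBall d ((2 : ℝ) ^ n) x
  set F := interp Y fun y => ‖f y‖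
  set J := (Finset.range M).image ((↑) : ℕ → ℤ)
  set π := inlProj d (d % 2) (inflation c d)
  have hF : Continuous F := continuous_interp _ _
  calc ∑ x ∈ X, truncMax c d M f x ^ p
      ≤ ∑ x ∈ X, ENNReal.ofReal C₁ ^ p * (∫⁻ u, ENNReal.ofReal (tents u) *
          liftMax J F π (latticeCast x + u)) ^ p := by
        refine Finset.sum_le_sum fun x hx => ?_
        rw [← ENNReal.mul_rpow_of_nonneg _ _ hp0]
        refine ENNReal.rpow_le_rpow (H₁ d (d % 2) M f x Y hd (by omega) fun n hn => ?_) hp0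
        exact (Finset.subset_biUnion_of_mem (fun n => shiftedBall d ((2 : ℝ) ^ n) x)
          (Finset.mem_range.2 hn)).trans (Finset.subset_biUnion_of_mem (fun x =>
            (Finset.range M).biUnion fun n => shiftedBall d ((2 : ℝ) ^ n) x) hx)
    _ = ENNReal.ofReal C₁ ^ p * ∑ x ∈ X, (∫⁻ u, ENNReal.ofReal (tents u) *
          liftMax J F π (latticeCast x + u)) ^ p := by rw [Finset.mul_sum]
    _ ≤ ENNReal.ofReal C₁ ^ p * ∫⁻ z, liftMax J F π z ^ p :=
        mul_le_mul_right (sum_lintegral_tents_rpow_le hp X (measurable_liftMax hF J π)) _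
    _ ≤ ENNReal.ofReal C₁ ^ p * (9 * ENNReal.ofReal C₂ * ∫⁻ z, ENNReal.ofReal (F z) ^ p) :=
        mul_le_mul_right (lintegral_liftMax_rpow_le_of_planar hp H₂ S hF
          (interp_nonneg Y fun _ => norm_nonneg _) J π) _
    _ ≤ ENNReal.ofReal C₁ ^ p * (9 * ENNReal.ofReal C₂ * ∑ y ∈ Y, ENNReal.ofReal ‖f y‖ ^ p) := by
        gcongr
        exact lintegral_interp_rpow_le Y (fun _ => norm_nonneg _) hp
    _ ≤ ENNReal.ofReal C₁ ^ p * (9 * ENNReal.ofReal C₂ * ∑' x, (‖f x‖₊ : ℝ≥0∞) ^ p) := by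
        gcongr
        simp only [ofReal_norm]
        exact ENNReal.sum_le_tsum _
    _ = _ := by
        rw [ENNReal.ofReal_rpow_of_nonneg hC₁.le hp0, ENNReal.ofReal_mul (by positivity),
          ENNReal.ofReal_mul (by norm_num)]
        simp only [ENNReal.ofReal_ofNat]
        ring

lemma iSup_eq_iSup_biSup_range (a : ℕ → ℝ≥0∞) : ⨆ n, a n = ⨆ M, ⨆ n ∈ Finset.range M, a n :=
  le_antisymm
    (iSup_le fun n => le_iSup_of_le (n + 1)
      (le_iSup₂_of_le n (Finset.self_mem_range_succ n) le_rfl))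
    (iSup_le fun _ => iSup₂_le fun n _ => le_iSup a n)

lemma iSup_eq_iSup_truncMax (c : ℝ) (d : ℕ) (f : (Fin d → ℤ) → ℂ) (x : Fin d → ℤ) :
    (⨆ (n : ℕ) (_ : c * (d : ℝ) ≤ (2 : ℝ) ^ n), (‖ballAvg d ((2 : ℝ) ^ n) f x‖₊ : ℝ≥0∞)) =
      ⨆ M, truncMax c d M f x := by
  simp only [truncMax]
  exact iSup_eq_iSup_biSup_range _

lemma monotone_truncMax (c : ℝ) (d : ℕ) (f : (Fin d → ℤ) → ℂ) (x : Fin d → ℤ) :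
    Monotone fun M => truncMax c d M f x := fun _ _ h =>
  biSup_mono fun _ hn => Finset.range_mono h hn

end Assembly

end PlanarDyadic

/-- Dimension-free `ℓ_p` bound, `1 < p < ∞`, for the discrete dyadic
Hardy–Littlewood maximal operator over Euclidean balls, with the supremum
restricted to dyadic radii `N = 2^n ≥ c₃ d` (the large-scale case). -/
theorem dimension_free_discrete_dyadic_maximal_large_scale
    (p : ℝ) (hp : 1 < p) (c₃ : ℝ) (hc₃ : 0 < c₃) :
    ∃ C : ℝ, 0 < C ∧
      ∀ d : ℕ, 1 ≤ d → ∀ f : (Fin d → ℤ) → ℂ,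
        lpNorm d p
            (fun x => ⨆ (n : ℕ) (_ : c₃ * (d : ℝ) ≤ (2 : ℝ) ^ n),
              (‖ballAvg d ((2 : ℝ) ^ n) f x‖₊ : ℝ≥0∞)) ≤
          ENNReal.ofReal C * lpNorm d p (fun x => (‖f x‖₊ : ℝ≥0∞)) := by
  obtain ⟨C, hC, H⟩ := PlanarDyadic.exists_sum_truncMax_le hp hc₃
  have hp0 : 0 < p := by linarith
  refine ⟨C ^ (1 / p), by positivity, fun d hd f => ?_⟩
  simp only [PlanarDyadic.iSup_eq_iSup_truncMax]
  unfold _root_.lpNorm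
  rw [← ENNReal.ofReal_rpow_of_nonneg hC.le (by positivity),
    ← ENNReal.mul_rpow_of_nonneg _ _ (by positivity)]
  refine ENNReal.rpow_le_rpow ?_ (by positivity)
  rw [ENNReal.tsum_eq_iSup_sum]
  refine iSup_le fun X => ?_
  have h1 : ∀ x, (⨆ M, PlanarDyadic.truncMax c₃ d M f x) ^ p =
      ⨆ M, PlanarDyadic.truncMax c₃ d M f x ^ p := fun x =>
    (ENNReal.orderIsoRpow p hp0).map_iSup _
  simp only [h1]
  rw [ENNReal.finsetSum_iSup_of_monotone fun x _ _ h =>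
    ENNReal.rpow_le_rpow (PlanarDyadic.monotone_truncMax c₃ d f x h) hp0.le]
  exact iSup_le fun M => H d M f X hd
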